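/- Fix B ≥ 1 and k ∈ {2, 3, 6, 7}. There exist constants c1 > 0 and C > 0 such that for every sufficiently large integer n, every pair of integers a, q with 0 ≤ a ≤ q, gcd(a,q) = 1 and 1 ≤ q ≤ L^B, and every real α with |α − a/q| ≤ L^B / n, one has |f_k(α) − (S_k(q,a)/φ(q)) · v_k(α − a/q)| ≤ C · P_k · exp(−c1 · √L). -/

import Mathlib

open MeasureTheory Finset

noncomputable section

/-- `e(x) = exp(2πix)`. -/
def e (x : ℝ) : ℂ := Complex.exp (2 * Real.pi * Complex.I * x)

/-- `P_k = n^(1/k)`. -/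
def P (n k : ℕ) : ℝ := (n : ℝ) ^ ((k : ℝ))⁻¹

/-- `θ_6 = 5/6`, `θ_7 = 87/98`. -/
def θ (c : ℕ) : ℝ := if c = 6 then 5 / 6 else 87 / 98

/-- `Θ_c = 2/3 + θ_c/5 + 1/6 + 1/c`. -/
def Θ (c : ℕ) : ℝ := 2 / 3 + θ c / 5 + 1 / 6 + ((c : ℝ))⁻¹

/-- `f_k(α) = Σ_{P_k/2 < p ≤ P_k, p prime} e(α p^k) log p`. -/
def f (n k : ℕ) (α : ℝ) : ℂ :=
  ∑ p ∈ (Finset.range (n + 1)).filter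
      (fun p : ℕ => p.Prime ∧ P n k / 2 < (p : ℝ) ∧ (p : ℝ) ≤ P n k),
    e (α * (p : ℝ) ^ k) * (Real.log p)

/-- `f_{5,c}(α) = Σ_{1 < p ≤ P_5^{θ_c}, p prime} e(α p^5) log p`. -/
def f5 (n c : ℕ) (α : ℝ) : ℂ :=
  ∑ p ∈ (Finset.range (n + 1)).filter
      (fun p : ℕ => p.Prime ∧ 1 < (p : ℝ) ∧ (p : ℝ) ≤ P n 5 ^ θ c),
    e (α * (p : ℝ) ^ 5) * (Real.log p)

/-- `F_c(α) = f_2(α)^2 f_3(α)^2 f_{5,c}(α) f_6(α) f_c(α)`. -/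
def F (n c : ℕ) (α : ℝ) : ℂ :=
  f n 2 α ^ 2 * f n 3 α ^ 2 * f5 n c α * f n 6 α * f n c α

/-- `S_k(q,a) = Σ_{x=1,(x,q)=1}^{q} e(a x^k / q)`. -/
def S (k q a : ℕ) : ℂ :=
  ∑ x ∈ (Finset.Icc 1 q).filter (fun x => Nat.gcd x q = 1),
    e ((a : ℝ) * (x : ℝ) ^ k / q)

/-- `v_k(β) = (1/k) Σ_{2^{-k} n < m ≤ n} m^{1/k-1} e(β m)`. -/
def v (n k : ℕ) (β : ℝ) : ℂ :=
  ((k : ℂ))⁻¹ *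
    ∑ m ∈ (Finset.Icc 1 n).filter (fun m : ℕ => (n : ℝ) / 2 ^ k < (m : ℝ)),
      ((m : ℝ) ^ ((k : ℝ)⁻¹ - 1) : ℝ) * e (β * m)

/-- `w_c(β) = v_2(β)^2 v_3(β)^2 v_6(β) v_c(β)`. -/
def w (n c : ℕ) (β : ℝ) : ℂ := v n 2 β ^ 2 * v n 3 β ^ 2 * v n 6 β * v n c β

/-- `U_c(q,a) = S_2(q,a)^2 S_3(q,a)^2 S_5(q,a) S_6(q,a) S_c(q,a)`. -/
def U (c q a : ℕ) : ℂ := S 2 q a ^ 2 * S 3 q a ^ 2 * S 5 q a * S 6 q a * S c q a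

/-- `A_{n,c}(q) = Σ_{a=1,(a,q)=1}^{q} U_c(q,a) e(-a n / q)`. -/
def A (n : ℤ) (c q : ℕ) : ℂ :=
  ∑ a ∈ (Finset.Icc 1 q).filter (fun a => Nat.gcd a q = 1),
    U c q a * e (-((a : ℝ) * (n : ℝ)) / q)

/-- The major arcs `𝔐`. -/
def Maj (n : ℕ) (B : ℝ) : Set ℝ :=
  {α | α ∈ Set.Icc (0 : ℝ) 1 ∧ ∃ a q : ℕ, a ≤ q ∧ 1 ≤ q ∧
    (q : ℝ) ≤ Real.log n ^ B ∧ Nat.gcd a q = 1 ∧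
    |α - (a : ℝ) / q| ≤ Real.log n ^ B / n}

/-- `Q_c = n^{2/(3c²(c-1))}`. -/
def Q (n c : ℕ) : ℝ := (n : ℝ) ^ (2 / (3 * (c : ℝ) ^ 2 * ((c : ℝ) - 1)))

/-- The arcs `𝕽_c`. -/
def R (n c : ℕ) : Set ℝ :=
  {α | α ∈ Set.Icc (0 : ℝ) 1 ∧ ∃ a q : ℕ, a ≤ q ∧ 1 ≤ q ∧
    (q : ℝ) ≤ Q n c ∧ Nat.gcd a q = 1 ∧ |(q : ℝ) * α - a| ≤ Q n c / n}

/-- `τ = 2^{-20}`. -/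
def τ : ℝ := ((2 : ℝ) ^ (20 : ℕ))⁻¹

/-- The sets `𝓔_c`. -/
def E (n c : ℕ) : Set ℝ :=
  {α | α ∈ Set.Icc (0 : ℝ) 1 ∧
    ‖f n c α‖ ≤ P n c ^ (if c = 6 then 1 - 24 * τ else 139 / 140 - 24 * τ)}

end


open MeasureTheory Finset

namespace SW

open Complex Metric Filter Topology

/-- logarithm on a ball -/
lemma exists_log_ball {f : ℂ → ℂ} {c : ℂ} {R : ℝ} (hR : 0 < R)
    (hf : DifferentiableOn ℂ f (ball c R)) (hne : ∀ z ∈ ball c R, f z ≠ 0) :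
    ∃ h : ℂ → ℂ, h c = 0 ∧ (∀ z ∈ ball c R, HasDerivAt h (deriv f z / f z) z) ∧
      ∀ z ∈ ball c R, f z = f c * exp (h z) := by
  have hd : DifferentiableOn ℂ (fun z => deriv f z / f z) (ball c R) :=
    (hf.deriv isOpen_ball).div hf hne
  obtain ⟨h0, hh0⟩ := hd.isExactOn_ball
  refine ⟨fun z => h0 z - h0 c, by simp, fun z hz => (hh0 z hz).sub_const _, ?_⟩
  intro z hz
  have hc : c ∈ ball c R := mem_ball_self hR
  have hg : ∀ w ∈ ball c R, HasDerivAt (fun w => f w * exp (-(h0 w - h0 c))) 0 w := by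
    intro w hw
    have h1 : HasDerivAt f (deriv f w) w :=
      ((hf w hw).differentiableAt (isOpen_ball.mem_nhds hw)).hasDerivAt
    have h2 := ((hh0 w hw).sub_const (h0 c)).neg.cexp
    have h3 := h1.mul h2
    refine h3.congr_deriv ?_
    have := hne w hw
    show deriv f w * exp (-(h0 w - h0 c)) + f w * (exp (-(h0 w - h0 c)) * -(deriv f w / f w)) = 0
    field_simp
    ring
  have hconst : f z * exp (-(h0 z - h0 c)) = f c * exp (-(h0 c - h0 c)) := by
    refine (convex_ball c R).is_const_of_fderivWithin_eq_zero (𝕜 := ℂ)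
      (f := fun w => f w * exp (-(h0 w - h0 c))) ?_ ?_ hz hc
    · intro w hw
      exact (hg w hw).differentiableAt.differentiableWithinAt
    · intro w hw
      rw [fderivWithin_of_isOpen isOpen_ball hw]
      have := (hg w hw).hasFDerivAt.fderiv
      rw [this]; ext; simp
  simp at hconst
  rw [← hconst, mul_assoc, ← Complex.exp_add]
  simp

/-- Bound of the logarithmic derivative of a zero-free function. -/
lemma logDeriv_bound {f : ℂ → ℂ} {c : ℂ} {R M : ℝ} (hR : 0 < R) (hM : 0 < M)
    (hf : DifferentiableOn ℂ f (ball c R)) (hne : ∀ z ∈ ball c R, f z ≠ 0)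
    (hb : ∀ z ∈ ball c R, ‖f z‖ ≤ Real.exp M * ‖f c‖) {z : ℂ} (hz : dist z c ≤ R / 2) :
    ‖deriv f z / f z‖ ≤ 40 * M / R := by
  obtain ⟨h, h0, hd, he⟩ := exists_log_ball hR hf hne
  have hc : c ∈ ball c R := mem_ball_self hR
  have hfc : 0 < ‖f c‖ := norm_pos_iff.2 (hne c hc)
  have hre : ∀ w ∈ ball c R, (h w).re ≤ M := by
    intro w hw
    have h1 := hb w hw
    rw [he w hw, norm_mul, Complex.norm_exp, mul_comm] at h1
    exact Real.exp_le_exp.1 (le_of_mul_le_mul_right h1 hfc)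
  have hbc : ∀ w, dist w c ≤ 3 * R / 4 → ‖h w‖ ≤ 6 * M := by
    intro w hw
    have hmem : w - c ∈ ball (0 : ℂ) R := by
      rw [mem_ball_zero_iff, ← dist_eq_norm]; linarith
    have key := borelCaratheodory_zero (f := fun u => h (u + c)) (M := M) (R := R) (z := w - c) hM
      (by
        intro u hu
        have hu' : u + c ∈ ball c R := by simpa [mem_ball, dist_eq_norm] using hu
        have := (hd (u + c) hu').differentiableAt
        exact (this.comp u (by fun_prop : DifferentiableAt ℂ (fun u => u + c) u)).differentiableWithinAt)
      (by
        intro u hu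
        have hu' : u + c ∈ ball c R := by simpa [mem_ball, dist_eq_norm] using hu
        exact hre _ hu') hR hmem (by simpa using h0)
    simp only [sub_add_cancel] at key
    refine key.trans ?_
    have hn : ‖w - c‖ ≤ 3 * R / 4 := by rwa [← dist_eq_norm]
    have : 0 < R - ‖w - c‖ := by linarith
    rw [div_le_iff₀ this]
    nlinarith
  have hcau : ‖deriv h z‖ ≤ (6 * M) / (R / 4) := by
    refine Complex.norm_deriv_le_of_forall_mem_sphere_norm_le (by positivity) ?_ ?_
    · refine DifferentiableOn.diffContOnCl (s := ball z (R/4)) ?_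
      rw [closure_ball z (by positivity : R / 4 ≠ 0)]
      intro w hw
      have : w ∈ ball c R := by
        have := dist_triangle w z c
        rw [mem_closedBall] at hw; rw [mem_ball]; linarith
      exact (hd w this).differentiableAt.differentiableWithinAt
    · intro w hw
      apply hbc
      have := dist_triangle w z c
      rw [mem_sphere] at hw; linarith
  have hzb : z ∈ ball c R := by rw [mem_ball]; linarith
  rw [(hd z hzb).deriv] at hcau
  refine hcau.trans ?_
  rw [div_le_div_iff₀ (by positivity) hR]
  nlinarith [mul_pos hM hR]

/-- Zeros can be factored out on closed balls -/
lemma exists_factor {f : ℂ → ℂ} (hf : Differentiable ℂ f) {R : ℝ} (hR : 0 < R)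
    (h0 : f 0 ≠ 0) : ∃ (s : Finset ℂ) (D : ℂ → ℕ) (g : ℂ → ℂ),
      (∀ u ∈ s, u ∈ closedBall (0 : ℂ) R ∧ f u = 0) ∧
      (∀ u ∈ closedBall (0 : ℂ) R, f u = 0 → u ∈ s ∧ 1 ≤ D u) ∧
      AnalyticOnNhd ℂ g (closedBall 0 R) ∧ (∀ z ∈ closedBall (0 : ℂ) R, g z ≠ 0) ∧
      ∀ z ∈ closedBall (0 : ℂ) R, f z = (∏ u ∈ s, (z - u) ^ D u) * g z := by
  classical
  set U := closedBall (0 : ℂ) R with hU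
  have hfa : AnalyticOnNhd ℂ f U := fun z _ => hf.analyticAt z
  have h0U : (0 : ℂ) ∈ U := by simp [hU, hR.le]
  have hm : MeromorphicOn f U := hfa.meromorphicOn
  have hpc : IsPreconnected U := (convex_closedBall 0 R).isPreconnected
  have hord : ∀ u : U, meromorphicOrderAt f u ≠ ⊤ := by
    have : ∃ u : U, meromorphicOrderAt f u ≠ ⊤ := by
      refine ⟨⟨0, h0U⟩, ?_⟩
      rw [(hfa 0 h0U).meromorphicOrderAt_eq, (hfa 0 h0U).analyticOrderAt_eq_zero.2 h0]
      simp
    exact (hm.exists_meromorphicOrderAt_ne_top_iff_forall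
      ⟨⟨0, h0U⟩, hpc⟩).1 this
  have hfin : (MeromorphicOn.divisor f U).support.Finite :=
    (MeromorphicOn.divisor f U).finiteSupport (isCompact_closedBall 0 R)
  obtain ⟨g, hga, hg0, hfg⟩ := hm.extract_zeros_poles hord hfin
  have hnn : ∀ u, 0 ≤ MeromorphicOn.divisor f U u := fun u => MeromorphicOn.AnalyticOnNhd.divisor_nonneg hfa u
  have hprod : (∏ᶠ u, ((· - u) : ℂ → ℂ) ^ MeromorphicOn.divisor f U u) =
      fun z => ∏ u ∈ hfin.toFinset, (z - u) ^ (MeromorphicOn.divisor f U u).toNat := by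
    rw [finprod_eq_prod_of_mulSupport_subset (s := hfin.toFinset)]
    · ext z
      rw [Finset.prod_apply]
      refine Finset.prod_congr rfl fun u _ => ?_
      rw [Pi.pow_apply, ← zpow_natCast, Int.toNat_of_nonneg (hnn u)]
    · intro u hu
      simp only [Function.mem_mulSupport] at hu
      simp only [Set.Finite.coe_toFinset, Function.mem_support]
      intro h; apply hu; rw [h]; simp
  rw [hprod] at hfg
  have heq : ∀ z ∈ U, f z = (∏ u ∈ hfin.toFinset, (z - u) ^ (MeromorphicOn.divisor f U u).toNat) * g z := by
    set G : ℂ → ℂ := fun z => (∏ u ∈ hfin.toFinset, (z - u) ^ (MeromorphicOn.divisor f U u).toNat) * g z with hG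
    have hGa : AnalyticOnNhd ℂ G U := by
      intro z hz
      exact (Finset.analyticAt_fun_prod _ (fun u _ => by fun_prop)).mul (hga z hz)
    have hball : Set.EqOn f G (ball 0 R) := by
      intro z hz
      have hzU : z ∈ U := ball_subset_closedBall hz
      have h1 := mem_codiscreteWithin.1 hfg z hzU
      rw [Filter.disjoint_principal_right] at h1
      have h2 : ∀ᶠ w in 𝓝[≠] z, f w = G w := by
        have h3 : ∀ᶠ w in 𝓝[≠] z, w ∈ U :=
          mem_nhdsWithin_of_mem_nhds (mem_of_superset (isOpen_ball.mem_nhds hz) ball_subset_closedBall)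
        filter_upwards [h1, h3] with w hw hwU
        by_contra hcon
        exact hw ⟨hwU, fun h => hcon (by simpa [hG] using h)⟩
      have h4 := (hf.continuous.continuousAt (x := z)).eventuallyEq_nhds_iff_eventuallyEq_nhdsNE
        (hGa z hzU).continuousAt
      exact (h4.1 h2).eq_of_nhds
    have hc : U ⊆ closure (ball (0 : ℂ) R) := by rw [closure_ball 0 hR.ne']
    exact hball.of_subset_closure (hf.continuous.continuousOn)
      (hGa.continuousOn) ball_subset_closedBall hc
  have hmem : ∀ u ∈ U, f u = 0 → MeromorphicOn.divisor f U u ≠ 0 := by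
    intro u hu hfu hd
    rw [heq u hu] at hfu
    rcases mul_eq_zero.1 hfu with h | h
    · obtain ⟨w, hw, hw2⟩ := Finset.prod_eq_zero_iff.1 h
      rcases Nat.eq_zero_or_pos (MeromorphicOn.divisor f U w).toNat with h4 | h4
      · rw [h4] at hw2; simp at hw2
      · have : u = w := sub_eq_zero.1 ((pow_eq_zero_iff h4.ne').1 hw2)
        subst this; rw [hd] at h4; simp at h4
    · exact hg0 ⟨u, hu⟩ h
  refine ⟨hfin.toFinset, fun u => (MeromorphicOn.divisor f U u).toNat, g, ?_, ?_, hga,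
    fun z hz => hg0 ⟨z, hz⟩, heq⟩
  · intro u hu
    have hu' : MeromorphicOn.divisor f U u ≠ 0 := by simpa using hu
    have huU : u ∈ U := by
      by_contra hcon
      exact hu' ((MeromorphicOn.divisor f U).apply_eq_zero_of_notMem hcon)
    refine ⟨huU, ?_⟩
    rw [heq u huU, Finset.prod_eq_zero hu, zero_mul]
    rw [sub_self]
    apply zero_pow
    show (MeromorphicOn.divisor f U u).toNat ≠ 0
    have := hnn u
    omega
  · intro u hu hfu
    have := hmem u hu hfu
    refine ⟨by simpa using this, ?_⟩
    show 1 ≤ (MeromorphicOn.divisor f U u).toNat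
    have := hnn u
    omega

end SW


open MeasureTheory Finset

namespace SW

open Complex Metric Filter Topology
open scoped ComplexConjugate

lemma norm_sub_eq_of_norm_eq {R : ℝ} (hR : 0 < R) {z u : ℂ} (hz : ‖z‖ = R) :
    ‖((R : ℂ) ^ 2 - conj u * z) / R‖ = ‖z - u‖ := by
  have h1 : (R : ℂ) ^ 2 = z * conj z := by
    rw [Complex.mul_conj, Complex.normSq_eq_norm_sq, hz]; push_cast; ring
  rw [h1, show z * conj z - conj u * z = z * conj (z - u) by rw [map_sub]; ring]
  rw [norm_div, norm_mul, RCLike.norm_conj, hz, Complex.norm_real, Real.norm_eq_abs, abs_of_pos hR]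
  field_simp

lemma landau_zero {f : ℂ → ℂ} (hf : Differentiable ℂ f) {R M : ℝ} (hR : 0 < R) (hM : 0 < M)
    (h0 : f 0 ≠ 0) (hb : ∀ z ∈ closedBall (0 : ℂ) R, ‖f z‖ ≤ Real.exp M * ‖f 0‖)
    (hre : ∀ z ∈ closedBall (0 : ℂ) R, f z = 0 → z.re ≤ 0)
    (Z : Finset ℂ) (hZ : ∀ z ∈ Z, z ∈ closedBall (0 : ℂ) R ∧ f z = 0) :
    -(deriv f 0 / f 0).re ≤ 40 * M / R - ∑ u ∈ Z, (-u⁻¹ + conj u / (R : ℂ) ^ 2).re := by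
  classical
  obtain ⟨s, D, g, hs, hs2, hga, hg0, hfg⟩ := exists_factor hf hR h0
  have hRC : (R : ℂ) ≠ 0 := by exact_mod_cast hR.ne'
  set B : ℂ → ℂ := fun z => ∏ u ∈ s, (((R : ℂ) ^ 2 - conj u * z) / R) ^ D u with hB
  set G : ℂ → ℂ := fun z => B z * g z with hG
  have hBd : Differentiable ℂ B := by
    intro z
    simp only [hB]
    refine DifferentiableAt.fun_finsetProd fun u _ => ?_
    fun_prop
  have hs0 : ∀ u ∈ s, u ≠ 0 := by
    intro u hu h; exact h0 (h ▸ (hs u hu).2)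
  have hGd : DifferentiableOn ℂ G (closedBall 0 R) :=
    hBd.differentiableOn.mul hga.differentiableOn
  have h0c : (0 : ℂ) ∈ closedBall (0 : ℂ) R := by simp [hR.le]
  have hfG0 : ‖f 0‖ ≤ ‖G 0‖ := by
    rw [hfg 0 h0c, hG, norm_mul, norm_mul]
    gcongr
    simp only [hB, norm_prod, norm_pow]
    gcongr with u hu
    have : ‖u‖ ≤ R := by simpa using (hs u hu).1
    simpa [norm_div, pow_two, abs_of_pos hR] using this
  have hsph : ∀ z ∈ sphere (0 : ℂ) R, ‖G z‖ = ‖f z‖ := by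
    intro z hz
    have hz' : ‖z‖ = R := by simpa using hz
    rw [hfg z (sphere_subset_closedBall hz), hG, norm_mul, norm_mul]
    congr 1
    simp only [hB, norm_prod, norm_pow]
    refine Finset.prod_congr rfl fun u _ => ?_
    rw [norm_sub_eq_of_norm_eq hR hz']
  have hGb : ∀ z ∈ ball (0 : ℂ) R, ‖G z‖ ≤ Real.exp M * ‖G 0‖ := by
    intro z hz
    have hdc : DiffContOnCl ℂ G (ball 0 R) :=
      DifferentiableOn.diffContOnCl (by rwa [closure_ball 0 hR.ne'])
    refine (Complex.norm_le_of_forall_mem_frontier_norm_le isBounded_ball hdc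
      (C := Real.exp M * ‖f 0‖) ?_ (subset_closure hz)).trans (by gcongr)
    intro w hw
    rw [frontier_ball 0 hR.ne'] at hw
    rw [hsph w hw]
    exact hb w (sphere_subset_closedBall hw)
  have hfac : ∀ u ∈ s, ∀ z ∈ ball (0 : ℂ) R, ((R : ℂ) ^ 2 - conj u * z) / R ≠ 0 := by
    intro u hu z hz h
    rw [div_eq_zero_iff] at h
    rcases h with h | h
    · have h1 : ‖(R : ℂ) ^ 2‖ = ‖conj u * z‖ := by rw [sub_eq_zero.1 h]
      rw [norm_mul, RCLike.norm_conj, norm_pow, Complex.norm_real, Real.norm_eq_abs,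
        abs_of_pos hR] at h1
      have h2 : ‖u‖ ≤ R := by simpa using (hs u hu).1
      have h3 : ‖z‖ < R := by simpa using hz
      nlinarith [norm_nonneg u, norm_nonneg z]
    · exact hRC h
  have hGne : ∀ z ∈ ball (0 : ℂ) R, G z ≠ 0 := by
    intro z hz
    refine mul_ne_zero ?_ (hg0 z (ball_subset_closedBall hz))
    exact Finset.prod_ne_zero_iff.2 fun u hu => pow_ne_zero _ (hfac u hu z hz)
  have hbd := logDeriv_bound hR hM (hGd.mono ball_subset_closedBall) hGne hGb (z := 0)
    (by simp; positivity)
  have h0b : (0 : ℂ) ∈ ball (0 : ℂ) R := mem_ball_self hR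
  have hgd : DifferentiableAt ℂ g 0 := (hga 0 h0c).differentiableAt
  have e1 : logDeriv G 0 = ∑ u ∈ s, (D u : ℂ) * (-(conj u) / (R : ℂ) ^ 2) + logDeriv g 0 := by
    rw [hG, logDeriv_mul (f := B) (g := g) 0 ?_ (hg0 0 h0c) (hBd 0) hgd]
    · congr 1
      rw [hB, logDeriv_prod ?_ ?_]
      · refine Finset.sum_congr rfl fun u hu => ?_
        rw [logDeriv_fun_pow (by fun_prop)]
        congr 1
        rw [logDeriv_apply]
        have : deriv (fun z : ℂ => ((R : ℂ) ^ 2 - conj u * z) / R) 0 = -(conj u) / R := by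
          have h1 : HasDerivAt (fun z : ℂ => ((R : ℂ) ^ 2 - conj u * z) / R) ((0 - conj u * 1) / R) 0 :=
            ((hasDerivAt_const _ _).sub ((hasDerivAt_id (0 : ℂ)).const_mul _)).div_const _
          rw [h1.deriv]; ring
        rw [this]
        simp only [mul_zero, sub_zero]
        field_simp
      · intro u hu; exact pow_ne_zero _ (hfac u hu 0 h0b)
      · intro u hu; fun_prop
    · exact Finset.prod_ne_zero_iff.2 fun u hu => pow_ne_zero _ (hfac u hu 0 h0b)
  have e2 : logDeriv f 0 = ∑ u ∈ s, (D u : ℂ) * (-u⁻¹) + logDeriv g 0 := by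
    have hev : f =ᶠ[𝓝 0] fun z => (∏ u ∈ s, (z - u) ^ D u) * g z := by
      filter_upwards [isOpen_ball.mem_nhds h0b] with z hz using hfg z (ball_subset_closedBall hz)
    rw [logDeriv_apply, hev.deriv_eq, hfg 0 h0c, ← logDeriv_apply (f := fun z => (∏ u ∈ s, (z - u) ^ D u) * g z)]
    rw [logDeriv_mul (f := fun z => ∏ u ∈ s, (z - u) ^ D u) (g := g) 0 ?_ (hg0 0 h0c) ?_ hgd]
    · congr 1
      rw [logDeriv_prod ?_ ?_]
      · refine Finset.sum_congr rfl fun u hu => ?_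
        rw [logDeriv_fun_pow (by fun_prop)]
        congr 1
        rw [logDeriv_apply]
        have : deriv (fun z : ℂ => z - u) 0 = 1 := ((hasDerivAt_id (0 : ℂ)).sub_const u).deriv
        rw [this, zero_sub, one_div, inv_neg]
      · intro u hu; exact pow_ne_zero _ (by simpa using hs0 u hu)
      · intro u hu; fun_prop
    · exact Finset.prod_ne_zero_iff.2 fun u hu => pow_ne_zero _ (by simpa using hs0 u hu)
    · refine DifferentiableAt.fun_finsetProd fun u _ => ?_
      fun_prop
  have hterm : ∀ u ∈ s, 0 ≤ (-u⁻¹ + conj u / (R : ℂ) ^ 2).re := by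
    intro u hu
    have hu0 : 0 < normSq u := normSq_pos.2 (hs0 u hu)
    have h2 : ‖u‖ ≤ R := by simpa using (hs u hu).1
    have h3 : normSq u ≤ R ^ 2 := by
      rw [normSq_eq_norm_sq]; gcongr
    have h4 := hre u (hs u hu).1 (hs u hu).2
    have : (-u⁻¹ + conj u / (R : ℂ) ^ 2).re = (-u.re) * (1 / normSq u - 1 / R ^ 2) := by
      rw [← ofReal_pow, add_re, neg_re, inv_re, div_ofReal_re, conj_re]; ring
    rw [this]
    refine mul_nonneg (by linarith) (sub_nonneg.2 ?_)
    exact one_div_le_one_div_of_le hu0 h3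
  have hsum : ∑ u ∈ Z, (-u⁻¹ + conj u / (R : ℂ) ^ 2).re ≤
      ∑ u ∈ s, (D u : ℝ) * (-u⁻¹ + conj u / (R : ℂ) ^ 2).re := by
    have hZs : Z ⊆ s := fun u hu => (hs2 u (hZ u hu).1 (hZ u hu).2).1
    calc ∑ u ∈ Z, (-u⁻¹ + conj u / (R : ℂ) ^ 2).re
        ≤ ∑ u ∈ Z, (D u : ℝ) * (-u⁻¹ + conj u / (R : ℂ) ^ 2).re := by
          refine Finset.sum_le_sum fun u hu => ?_
          have h1 : (1 : ℝ) ≤ D u := by exact_mod_cast (hs2 u (hZ u hu).1 (hZ u hu).2).2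
          nlinarith [hterm u (hZs hu)]
      _ ≤ _ := Finset.sum_le_sum_of_subset_of_nonneg hZs
          fun u hu _ => mul_nonneg (by positivity) (hterm u hu)
  have e3 : logDeriv f 0 = logDeriv G 0 + ∑ u ∈ s, (D u : ℂ) * (-u⁻¹ + conj u / (R : ℂ) ^ 2) := by
    rw [e1, e2]
    simp only [mul_add, Finset.sum_add_distrib, neg_div, mul_neg, Finset.sum_neg_distrib]
    ring
  have e4 := congrArg Complex.re e3
  rw [add_re, re_sum] at e4
  simp only [← ofReal_natCast, re_ofReal_mul] at e4
  rw [logDeriv_apply] at e4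
  rw [e4]
  have : -(logDeriv G 0).re ≤ 40 * M / R := by
    refine le_trans ?_ hbd
    rw [← logDeriv_apply]
    exact (neg_le_abs _).trans (abs_re_le_norm _)
  linarith

/-- Landau's lemma at a general center. -/
lemma landau {f : ℂ → ℂ} (hf : Differentiable ℂ f) {c : ℂ} {R M : ℝ} (hR : 0 < R) (hM : 0 < M)
    (h0 : f c ≠ 0) (hb : ∀ z ∈ closedBall c R, ‖f z‖ ≤ Real.exp M * ‖f c‖)
    (hre : ∀ z ∈ closedBall c R, f z = 0 → z.re ≤ c.re)
    (Z : Finset ℂ) (hZ : ∀ z ∈ Z, z ∈ closedBall c R ∧ f z = 0) :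
    -(deriv f c / f c).re ≤ 40 * M / R - ∑ u ∈ Z, (((c - u)⁻¹).re - 1 / R) := by
  classical
  have key := landau_zero (f := fun z => f (c + z)) (hf.comp (by fun_prop : Differentiable ℂ fun z => c + z))
    hR hM (by simpa using h0)
    (by
      intro z hz
      simpa using hb (c + z) (by simpa using hz))
    (by
      intro z hz h
      have := hre (c + z) (by simpa using hz) h
      simpa using this)
    (Z.image fun u => u - c)
    (by
      intro z hz
      obtain ⟨u, hu, rfl⟩ := Finset.mem_image.1 hz
      have := hZ u hu
      refine ⟨by simpa [dist_eq_norm] using this.1, by simpa using this.2⟩)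
  rw [deriv_comp_const_add] at key
  simp only [add_zero] at key
  refine key.trans ?_
  rw [Finset.sum_image (by intro a _ b _ h; simpa using h)]
  gcongr with u hu
  have h1 : ‖u - c‖ ≤ R := by simpa [dist_eq_norm] using (hZ u hu).1
  have h2 : -(u - c)⁻¹ = (c - u)⁻¹ := by rw [← inv_neg]; ring_nf
  rw [h2, add_re, ← ofReal_pow, div_ofReal_re, conj_re]
  have h3 : -R ≤ (u - c).re := by
    have := (neg_le_abs (u-c).re).trans (abs_re_le_norm (u - c)); linarith
  have : - (1 / R) ≤ (u - c).re / R ^ 2 := by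
    rw [le_div_iff₀ (by positivity)]
    have : -(1 / R) * R ^ 2 = -R := by field_simp
    linarith
  linarith

end SW


open MeasureTheory Finset

namespace SW

open Complex Metric Filter Topology

/-- continuation of a Dirichlet series with controlled partial sums -/
lemma lseries_cont (a : ℕ → ℂ) (m : ℂ) {K r : ℝ} (hr : 0 ≤ r) (hr1 : r < 1)
    (hS : ∀ s : ℂ, 1 < s.re → LSeriesSummable a s)
    (hA : ∀ t : ℝ, 1 ≤ t → ‖∑ k ∈ Finset.Icc 1 ⌊t⌋₊, a k - m * t‖ ≤ K * t ^ r) :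
    ∃ H : ℂ → ℂ, DifferentiableOn ℂ H {s | r < s.re} ∧
      (∀ s : ℂ, r < s.re → ‖H s‖ ≤ K / (s.re - r)) ∧
      ∀ s : ℂ, 1 < s.re → LSeries a s = m * s / (s - 1) + s * H s := by
  classical
  set E : ℝ → ℂ := (Set.Ioi (1:ℝ)).indicator
    (fun t : ℝ => ∑ k ∈ Finset.Icc 1 ⌊t⌋₊, a k - m * t) with hE
  have hK : 0 ≤ K := by
    have := (norm_nonneg _).trans (hA 1 le_rfl)
    simpa using this
  have hmeas : Measurable (fun t : ℝ => ∑ k ∈ Finset.Icc 1 ⌊t⌋₊, a k - m * t) := by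
    have h1 : Measurable (fun t : ℝ => ∑ k ∈ Finset.Icc 1 ⌊t⌋₊, a k) :=
      (measurable_from_nat (f := fun n => ∑ k ∈ Finset.Icc 1 n, a k)).comp Nat.measurable_floor
    exact h1.sub (by fun_prop)
  have hEm : Measurable E := hmeas.indicator measurableSet_Ioi
  have hEb : ∀ t : ℝ, 0 < t → ‖E t‖ ≤ K * t ^ r := by
    intro t ht
    by_cases h : 1 < t
    · simp only [hE, Set.indicator_of_mem (Set.mem_Ioi.2 h)]
      exact hA t h.le
    · simp only [hE, Set.indicator_of_notMem (fun h' => h (Set.mem_Ioi.1 h')), norm_zero]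
      positivity
  have hloc : LocallyIntegrableOn E (Set.Ioi 0) := by
    have hc : ContinuousOn (fun t : ℝ => K * t ^ r) (Set.Ioi 0) := by
      intro t ht
      exact ((Real.continuousAt_rpow_const t r (Or.inl (ne_of_gt ht))).const_mul K).continuousWithinAt
    have hl := hc.locallyIntegrableOn (μ := volume) measurableSet_Ioi
    intro t ht
    obtain ⟨U, hU, hi⟩ := hl t ht
    refine ⟨U ∩ Set.Ioi 0, inter_mem hU self_mem_nhdsWithin, ?_⟩
    have hi2 : IntegrableOn (fun t : ℝ => K * t ^ r) (U ∩ Set.Ioi 0) := hi.mono_set Set.inter_subset_left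
    refine Integrable.mono' hi2 hEm.aestronglyMeasurable ?_
    have := ae_restrict_mem (μ := (volume : Measure ℝ)) (measurableSet_Ioi (a := (0:ℝ)))
    have h2 : ∀ᵐ x ∂(volume.restrict (U ∩ Set.Ioi (0:ℝ))), x ∈ Set.Ioi (0:ℝ) :=
      ae_mono (Measure.restrict_mono Set.inter_subset_right le_rfl) this
    filter_upwards [h2] with x hx using hEb x hx
  have htop : E =O[atTop] (fun t : ℝ => t ^ (-(-r))) := by
    refine Asymptotics.IsBigO.of_bound K ?_
    filter_upwards [eventually_gt_atTop 0] with t ht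
    rw [neg_neg, Real.norm_of_nonneg (Real.rpow_nonneg ht.le r)]
    exact hEb t ht
  have hbot : ∀ b : ℝ, E =O[𝓝[>] 0] (fun t : ℝ => t ^ (-b)) := by
    intro b
    have : E =ᶠ[𝓝[>] 0] fun _ => (0 : ℂ) := by
      have h1 : ∀ᶠ t : ℝ in 𝓝[>] 0, t < 1 := nhdsWithin_le_nhds (Iio_mem_nhds one_pos)
      filter_upwards [h1] with t ht
      simp only [hE]
      rw [Set.indicator_of_notMem]
      simp [ht.le]
    exact this.trans_isBigO (Asymptotics.isBigO_zero _ _)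
  have hind : ∀ s : ℂ, mellin E (-s) = ∫ t in Set.Ioi (1:ℝ), 
      (t : ℂ) ^ (-(s + 1)) * (∑ k ∈ Finset.Icc 1 ⌊t⌋₊, a k - m * t) := by
    intro s
    rw [mellin]
    have h1 : ∀ t : ℝ, (t : ℂ) ^ (-s - 1) • E t = (Set.Ioi (1:ℝ)).indicator
        (fun t : ℝ => (t : ℂ) ^ (-(s + 1)) * (∑ k ∈ Finset.Icc 1 ⌊t⌋₊, a k - m * t)) t := by
      intro t
      rw [show -s - 1 = -(s + 1) by ring]
      simp only [hE, Set.indicator_apply]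
      split_ifs <;> simp
    simp_rw [h1]
    rw [setIntegral_indicator measurableSet_Ioi]
    congr 2
    ext t; simp only [Set.mem_inter_iff, Set.mem_Ioi]; constructor
    · exact fun h => h.2
    · exact fun h => ⟨by linarith, h⟩
  have hnorm : ∀ s : ℂ, ∀ t ∈ Set.Ioi (1:ℝ),
      ‖(t : ℂ) ^ (-(s + 1)) * (∑ k ∈ Finset.Icc 1 ⌊t⌋₊, a k - m * t)‖ ≤ K * t ^ (r - s.re - 1) := by
    intro s t ht
    have ht0 : 0 < t := by have := Set.mem_Ioi.1 ht; linarith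
    rw [norm_mul, norm_cpow_eq_rpow_re_of_pos ht0]
    calc _ ≤ t ^ (-(s+1)).re * (K * t ^ r) := by
          gcongr; exact hA t (le_of_lt ht)
      _ = K * t ^ (r - s.re - 1) := by
          rw [mul_left_comm, ← Real.rpow_add ht0]; simp; ring_nf; simp
  have hIntg : ∀ s : ℂ, r < s.re → IntegrableOn (fun t : ℝ => (t : ℂ) ^ (-(s + 1)) * 
      (∑ k ∈ Finset.Icc 1 ⌊t⌋₊, a k - m * t)) (Set.Ioi (1:ℝ)) := by
    intro s hs
    have h1 : IntegrableOn (fun t : ℝ => K * t ^ (r - s.re - 1)) (Set.Ioi (1:ℝ)) :=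
      (integrableOn_Ioi_rpow_of_lt (by linarith) one_pos).const_mul K
    refine Integrable.mono' h1 ?_ ?_
    · refine AEStronglyMeasurable.mul ?_ hmeas.aestronglyMeasurable
      have : Measurable (fun t : ℝ => (t : ℂ) ^ (-(s + 1))) := by fun_prop
      exact this.aestronglyMeasurable
    · filter_upwards [ae_restrict_mem measurableSet_Ioi] with t ht using hnorm s t ht
  refine ⟨fun s => mellin E (-s), ?_, ?_, ?_⟩
  · intro s hs
    have h1 := mellin_differentiableAt_of_isBigO_rpow (s := -s) (a := -r) (b := (-s).re - 1) hloc htop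
      (by simpa using hs) (hbot _) (by linarith)
    exact (h1.comp s (differentiableAt_id.neg)).differentiableWithinAt
  · intro s hs
    show ‖mellin E (-s)‖ ≤ _
    rw [hind]
    have h1 : IntegrableOn (fun t : ℝ => K * t ^ (r - s.re - 1)) (Set.Ioi (1:ℝ)) :=
      (integrableOn_Ioi_rpow_of_lt (by linarith) one_pos).const_mul K
    refine (norm_integral_le_of_norm_le h1 ?_).trans ?_
    · filter_upwards [ae_restrict_mem measurableSet_Ioi] with t ht using hnorm s t ht
    · rw [integral_const_mul, integral_Ioi_rpow_of_lt (by linarith) one_pos, Real.one_rpow]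
      apply le_of_eq
      have : s.re - r ≠ 0 := by linarith [sub_pos.2 hs]
      rw [show r - s.re - 1 + 1 = -(s.re - r) by ring]
      field_simp
  · intro s hs
    show _ = _ + s * mellin E (-s)
    have hO : (fun n : ℕ => ∑ k ∈ Finset.Icc 1 n, a k) =O[atTop] fun n : ℕ => (n : ℝ) ^ (1:ℝ) := by
      refine Asymptotics.IsBigO.of_bound (K + ‖m‖) ?_
      filter_upwards [eventually_ge_atTop 1] with n hn
      have h1 := hA n (by exact_mod_cast hn)
      rw [Nat.floor_natCast] at h1
      have hn1 : (1:ℝ) ≤ n := by exact_mod_cast hn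
      have h2 : (n:ℝ) ^ r ≤ n := by
        calc (n:ℝ) ^ r ≤ (n:ℝ) ^ (1:ℝ) := Real.rpow_le_rpow_of_exponent_le hn1 hr1.le
          _ = n := Real.rpow_one _
      rw [Real.rpow_one, Real.norm_of_nonneg (by positivity)]
      have h3 : ‖m * ((n:ℝ):ℂ)‖ = ‖m‖ * n := by
        rw [norm_mul]; simp
      have h4 := norm_le_norm_sub_add (∑ k ∈ Finset.Icc 1 n, a k) (m * ((n:ℝ):ℂ))
      rw [h3] at h4
      nlinarith
    rw [LSeries_eq_mul_integral a zero_le_one (by simpa using hs) (hS s hs) hO, hind]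
    have hs1 : s - 1 ≠ 0 := by
      intro h
      have : (s - 1).re = 0 := by rw [h]; simp
      simp at this; linarith
    have h5 : IntegrableOn (fun t : ℝ => m * (t : ℂ) ^ (-s)) (Set.Ioi (1:ℝ)) :=
      (integrableOn_Ioi_cpow_of_lt (by simpa using hs) one_pos).const_mul m
    have h6 : ∫ t in Set.Ioi (1:ℝ), m * (t : ℂ) ^ (-s) = m / (s - 1) := by
      rw [integral_const_mul, integral_Ioi_cpow_of_lt (by simpa using hs) one_pos]
      simp only [ofReal_one, one_cpow]
      rw [show -s + 1 = -(s - 1) by ring, neg_div_neg_eq]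
      ring
    have h7 : ∫ t in Set.Ioi (1:ℝ), (∑ k ∈ Finset.Icc 1 ⌊t⌋₊, a k) * (t:ℂ) ^ (-(s + 1)) =
        ∫ t in Set.Ioi (1:ℝ), (m * (t : ℂ) ^ (-s) + (t : ℂ) ^ (-(s + 1)) * 
          (∑ k ∈ Finset.Icc 1 ⌊t⌋₊, a k - m * t)) := by
      refine setIntegral_congr_fun measurableSet_Ioi fun t ht => ?_
      have ht0 : (t : ℂ) ≠ 0 := by
        have : (0:ℝ) < t := by have := Set.mem_Ioi.1 ht; linarith
        exact_mod_cast this.ne'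
      have : (t : ℂ) ^ (-s) = (t : ℂ) ^ (-(s+1)) * t := by
        rw [show -s = -(s+1) + 1 by ring, cpow_add _ _ ht0, cpow_one]
      simp only [this]; ring
    rw [h7, integral_add h5 (hIntg s (by linarith)), h6]
    ring

end SW


open MeasureTheory Finset

namespace SW

open Complex Metric Filter Topology DirichletCharacter

lemma halfplane_preconn (r : ℝ) : IsPreconnected {s : ℂ | r < s.re} :=
  (convex_halfSpace_re_gt r).isPreconnected

lemma halfplane_open (r : ℝ) : IsOpen {s : ℂ | r < s.re} :=
  isOpen_lt continuous_const continuous_re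

/-- identity theorem on a half plane -/
lemma halfplane_eq {r : ℝ} (hr : r < 2) {f g : ℂ → ℂ} (hf : DifferentiableOn ℂ f {s | r < s.re})
    (hg : DifferentiableOn ℂ g {s | r < s.re}) (h : ∀ s : ℂ, 1 < s.re → f s = g s) :
    ∀ s : ℂ, r < s.re → f s = g s := by
  have := (hf.analyticOnNhd (halfplane_open r)).eqOn_of_preconnected_of_eventuallyEq
    (hg.analyticOnNhd (halfplane_open r)) (halfplane_preconn r) (z₀ := 2) (by simpa using hr) (by
      filter_upwards [(halfplane_open 1).mem_nhds (show (2:ℂ) ∈ {s : ℂ | 1 < s.re} by simp)] with s hs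
      exact h s hs)
  exact fun s hs => this hs

lemma charSum_period {q : ℕ} [NeZero q] {χ : DirichletCharacter ℂ q} (hχ : χ ≠ 1) (N : ℕ) :
    ∑ k ∈ Finset.range q, χ ((N + k : ℕ) : ZMod q) = 0 := by
  rw [← χ.sum_eq_zero_of_ne_one hχ]
  refine Finset.sum_bij' (fun k _ => ((N + k : ℕ) : ZMod q)) (fun a _ => (a - N : ZMod q).val)
    (by simp) ?_ ?_ ?_ ?_
  · intro a _; simp [ZMod.val_lt]
  · intro k hk
    simp only [Nat.cast_add, add_sub_cancel_left]
    exact ZMod.val_cast_of_lt (Finset.mem_range.1 hk)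
  · intro a _; simp
  · intro k _; rfl

lemma charSum_shift {q : ℕ} [NeZero q] {χ : DirichletCharacter ℂ q} (hχ : χ ≠ 1) (N : ℕ) :
    ∀ j : ℕ, ∑ k ∈ Finset.range (N + q * j), χ ((k + 1 : ℕ) : ZMod q) =
      ∑ k ∈ Finset.range N, χ ((k + 1 : ℕ) : ZMod q) := by
  intro j
  induction j with
  | zero => simp
  | succ j ih =>
    rw [mul_add, mul_one, ← add_assoc, Finset.sum_range_add, ih]
    have := charSum_period hχ (N + q * j + 1)
    have h2 : ∑ x ∈ Finset.range q, χ ((N + q * j + x + 1 : ℕ) : ZMod q) = 0 := by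
      rw [← this]
      refine Finset.sum_congr rfl fun k _ => ?_
      congr 2; ring
    rw [h2, add_zero]

lemma charSum_eq_range {q : ℕ} (χ : DirichletCharacter ℂ q) (N : ℕ) :
    ∑ k ∈ Finset.Icc 1 N, χ (k : ZMod q) = ∑ k ∈ Finset.range N, χ ((k + 1 : ℕ) : ZMod q) := by
  rw [Finset.range_eq_Ico, Finset.sum_Ico_add' (fun k : ℕ => χ (k : ZMod q)) 0 N 1]
  rfl

lemma charSum_le_N {q : ℕ} (χ : DirichletCharacter ℂ q) (N : ℕ) :
    ‖∑ k ∈ Finset.Icc 1 N, χ (k : ZMod q)‖ ≤ N := by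
  refine (norm_sum_le_of_le (Finset.Icc 1 N) (fun k _ => χ.norm_le_one _)).trans ?_
  simp

lemma charSum_le_q {q : ℕ} [NeZero q] {χ : DirichletCharacter ℂ q} (hχ : χ ≠ 1) (N : ℕ) :
    ‖∑ k ∈ Finset.Icc 1 N, χ (k : ZMod q)‖ ≤ q := by
  have h : ∑ k ∈ Finset.Icc 1 N, χ (k : ZMod q) = ∑ k ∈ Finset.Icc 1 (N % q), χ (k : ZMod q) := by
    rw [charSum_eq_range, charSum_eq_range, ← charSum_shift hχ (N % q) (N / q), Nat.mod_add_div]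
  rw [h]
  refine (charSum_le_N χ _).trans ?_
  exact_mod_cast (Nat.mod_lt _ (NeZero.pos q)).le

/-- bound for nonprincipal `L`-functions -/
lemma LFunction_bound {q : ℕ} [NeZero q] {χ : DirichletCharacter ℂ q} (hχ : χ ≠ 1) {r : ℝ}
    (hr : 0 ≤ r) (hr1 : r < 1) {s : ℂ} (hs : r < s.re) :
    ‖LFunction χ s‖ ≤ ‖s‖ * ((q : ℝ) ^ (1 - r) / (s.re - r)) := by
  obtain ⟨H, hd, hb, he⟩ := lseries_cont (fun n => χ n) 0 (K := (q:ℝ) ^ (1 - r)) hr hr1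
    (fun s hs => LSeriesSummable_of_one_lt_re χ hs) (by
      intro t ht
      rw [zero_mul, sub_zero]
      have h1 := charSum_le_q hχ ⌊t⌋₊
      have h2 := charSum_le_N χ ⌊t⌋₊
      have h3 : (⌊t⌋₊ : ℝ) ≤ t := Nat.floor_le (by linarith)
      set y := ‖∑ k ∈ Finset.Icc 1 ⌊t⌋₊, χ (k : ZMod q)‖
      have hy : 0 ≤ y := norm_nonneg _
      calc y = y ^ (1 - r) * y ^ r := by
            rcases hy.eq_or_lt with h | h
            · rw [← h, Real.zero_rpow (by linarith : 1 - r ≠ 0), zero_mul]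
            · rw [← Real.rpow_add h]; simp
        _ ≤ (q : ℝ) ^ (1 - r) * t ^ r := by
            gcongr
            exact h2.trans h3)
  have := halfplane_eq (f := LFunction χ) (g := fun s => s * H s) (r := r) (by linarith)
    (differentiable_LFunction hχ).differentiableOn (differentiableOn_id.mul hd) (by
      intro s hs
      rw [LFunction_eq_LSeries χ hs, he s hs]; simp) s hs
  rw [this, norm_mul]
  gcongr
  exact hb s hs

lemma zeta_cont : ∃ H : ℂ → ℂ, DifferentiableOn ℂ H {s | 0 < s.re} ∧
      (∀ s : ℂ, 0 < s.re → ‖H s‖ ≤ 1 / s.re) ∧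
      ∀ s : ℂ, 0 < s.re → s ≠ 1 → riemannZeta s = s / (s - 1) + s * H s := by
  obtain ⟨H, hd, hb, he⟩ := lseries_cont 1 1 (K := 1) (r := 0) le_rfl one_pos
    (fun s hs => (LSeriesSummable_one_iff).2 hs) (by
      intro t ht
      simp only [Pi.one_apply, Finset.sum_const, Nat.card_Icc, add_tsub_cancel_right, nsmul_eq_mul,
        mul_one, one_mul, Real.rpow_zero]
      rw [← ofReal_natCast, ← ofReal_sub, norm_real, Real.norm_eq_abs, abs_le]
      have h3 : (⌊t⌋₊ : ℝ) ≤ t := Nat.floor_le (by linarith)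
      have h4 := Nat.lt_floor_add_one t
      constructor <;> linarith)
  refine ⟨H, hd, fun s hs => by simpa using hb s hs, ?_⟩
  have hev := halfplane_eq (f := LFunctionTrivChar₁ 1) (g := fun s => s + (s - 1) * (s * H s)) (r := 0)
    (by norm_num) (differentiable_LFunctionTrivChar₁ 1).differentiableOn
    (differentiableOn_id.add ((differentiableOn_id.sub_const 1).mul (differentiableOn_id.mul hd))) (by
      intro s hs
      have hs1 : s ≠ 1 := by rintro rfl; simp at hs
      rw [LFunctionTrivChar₁, Function.update_of_ne hs1, LFunctionTrivChar_eq_mul_riemannZeta hs1,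
        ← LSeries_one_eq_riemannZeta hs, he s hs]
      have : s - 1 ≠ 0 := sub_ne_zero.2 hs1
      simp
      field_simp)
  intro s hs hs1
  have := hev s hs
  rw [LFunctionTrivChar₁, Function.update_of_ne hs1, LFunctionTrivChar_eq_mul_riemannZeta hs1] at this
  have h1 : s - 1 ≠ 0 := sub_ne_zero.2 hs1
  simp at this
  field_simp
  linear_combination this

lemma norm_zeta_real {σ : ℝ} (h : 1 < σ) : ∑' n : ℕ, 1 / (n : ℝ) ^ σ ≤ σ / (σ - 1) + 1 := by
  obtain ⟨H, hd, hb, he⟩ := zeta_cont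
  have h1 : ((∑' n : ℕ, 1 / (n : ℝ) ^ σ : ℝ) : ℂ) = riemannZeta σ := by
    rw [zeta_eq_tsum_one_div_nat_cpow (by simpa using h), ofReal_tsum]
    congr 1; ext n
    rw [ofReal_div, ofReal_one, ofReal_cpow (by positivity)]; simp
  have h2 := he σ (by simp; linarith) (by norm_cast; linarith)
  have h3 : ‖((∑' n : ℕ, 1 / (n : ℝ) ^ σ : ℝ) : ℂ)‖ ≤ σ / (σ - 1) + 1 := by
    rw [h1, h2]
    refine (norm_add_le _ _).trans ?_
    have h4 := hb σ (by simp; linarith)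
    rw [norm_mul, norm_div, ← ofReal_one, ← ofReal_sub, norm_real, norm_real, Real.norm_of_nonneg (by linarith),
      Real.norm_of_nonneg (by linarith)]
    gcongr
    calc σ * ‖H σ‖ ≤ σ * (1 / σ) := by
          gcongr; simpa using h4
      _ = 1 := by field_simp
  rw [norm_real] at h3
  exact (Real.le_norm_self _).trans h3

lemma norm_LSeries_le {a : ℕ → ℂ} (ha : ∀ n, ‖a n‖ ≤ 1) {s : ℂ} (hs : 1 < s.re) :
    ‖LSeries a s‖ ≤ s.re / (s.re - 1) + 1 := by
  refine le_trans ?_ (norm_zeta_real hs)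
  have hsum := Real.summable_one_div_nat_rpow.2 hs
  have hb : ∀ n, ‖LSeries.term a s n‖ ≤ 1 / (n : ℝ) ^ s.re := by
    intro n
    rw [LSeries.norm_term_eq]
    split_ifs
    · positivity
    · gcongr; exact ha n
  exact tsum_of_norm_bounded hsum.hasSum hb

lemma LFunction_lower {q : ℕ} [NeZero q] (χ : DirichletCharacter ℂ q) {s : ℂ} (hs : 1 < s.re)
    (hs2 : s.re ≤ 2) : (s.re - 1) / 4 ≤ ‖LFunction χ s‖ := by
  have h1 := LSeries.mul_mu_eq_one χ hs
  have h2 := norm_LSeries_le (a := ((fun n : ℕ => χ n) * fun n : ℕ => (ArithmeticFunction.moebius n : ℂ))) (by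
    intro n
    rw [Pi.mul_apply, norm_mul]
    have : ‖(ArithmeticFunction.moebius n : ℂ)‖ ≤ 1 := by
      rw [Complex.norm_intCast]; exact_mod_cast ArithmeticFunction.abs_moebius_le_one
    nlinarith [χ.norm_le_one n, norm_nonneg (χ n)]) hs
  rw [LFunction_eq_LSeries χ hs]
  have h3 := congrArg norm h1
  rw [norm_mul, norm_one] at h3
  have h4 : s.re / (s.re - 1) + 1 ≤ 4 / (s.re - 1) := by
    have : 0 < s.re - 1 := by linarith
    rw [div_add_one this.ne']
    gcongr; linarith
  set x := ‖LSeries (fun n : ℕ => χ n) s‖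
  have hx : 0 ≤ x := norm_nonneg _
  have h5 : 1 ≤ x * (4 / (s.re - 1)) := by
    exact h3.symm.le.trans (by gcongr; exact h2.trans h4)
  have : 0 < s.re - 1 := by linarith
  rw [mul_div_assoc', le_div_iff₀ this] at h5
  linarith

end SW


open MeasureTheory Finset

namespace SW

open Complex Metric Filter Topology DirichletCharacter

noncomputable def Hz : ℂ → ℂ := Classical.choose zeta_cont

lemma Hz_diff : DifferentiableOn ℂ Hz {s | 0 < s.re} := (Classical.choose_spec zeta_cont).1

lemma Hz_bound {s : ℂ} (hs : 0 < s.re) : ‖Hz s‖ ≤ 1 / s.re := (Classical.choose_spec zeta_cont).2.1 s hs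

lemma Hz_eq {s : ℂ} (hs : 0 < s.re) (h1 : s ≠ 1) : riemannZeta s = s / (s - 1) + s * Hz s :=
  (Classical.choose_spec zeta_cont).2.2 s hs h1

open Classical in
/-- the entire function attached to a character: `L` itself, or `(s-1) L` for the trivial one -/
noncomputable def FF {q : ℕ} [NeZero q] (χ : DirichletCharacter ℂ q) (s : ℂ) : ℂ :=
  if χ = 1 then LFunctionTrivChar₁ q s else LFunction χ s

open Classical in
/-- indicator of the trivial character -/
noncomputable def dl {q : ℕ} (χ : DirichletCharacter ℂ q) : ℝ := if χ = 1 then 1 else 0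

section
variable {q : ℕ} [NeZero q]

lemma FF_one : FF (1 : DirichletCharacter ℂ q) = LFunctionTrivChar₁ q := by
  ext s; simp [FF]

lemma FF_ne {χ : DirichletCharacter ℂ q} (hχ : χ ≠ 1) : FF χ = LFunction χ := by
  ext s; simp [FF, hχ]

lemma dl_one : dl (1 : DirichletCharacter ℂ q) = 1 := by simp [dl]

lemma dl_ne {χ : DirichletCharacter ℂ q} (hχ : χ ≠ 1) : dl χ = 0 := by simp [dl, hχ]

lemma FF_diff (χ : DirichletCharacter ℂ q) : Differentiable ℂ (FF χ) := by
  by_cases h : χ = 1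
  · subst h; rw [FF_one]; exact differentiable_LFunctionTrivChar₁ q
  · rw [FF_ne h]; exact differentiable_LFunction h

lemma FF_ne_zero (χ : DirichletCharacter ℂ q) {s : ℂ} (hs : 1 ≤ s.re) : FF χ s ≠ 0 := by
  by_cases h : χ = 1
  · subst h
    rw [FF_one]
    by_cases h1 : s = 1
    · subst h1; exact LFunctionTrivChar₁_apply_one_ne_zero q
    · rw [LFunctionTrivChar₁, Function.update_of_ne h1]
      exact mul_ne_zero (sub_ne_zero.2 h1) (LFunction_ne_zero_of_one_le_re _ (Or.inr h1) hs)
  · rw [FF_ne h]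
    exact LFunction_ne_zero_of_one_le_re _ (Or.inl h) hs

lemma FF_one_eq {s : ℂ} (hs : 0 < s.re) : FF (1 : DirichletCharacter ℂ q) s =
    (∏ p ∈ q.primeFactors, (1 - (p : ℂ) ^ (-s))) * (s + (s - 1) * (s * Hz s)) := by
  rw [FF_one]
  by_cases h1 : s = 1
  · subst h1
    simp [LFunctionTrivChar₁, cpow_neg_one]
  · rw [LFunctionTrivChar₁, Function.update_of_ne h1, LFunctionTrivChar_eq_mul_riemannZeta h1, Hz_eq hs h1]
    have : s - 1 ≠ 0 := sub_ne_zero.2 h1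
    field_simp

lemma norm_eulerfac_le {s : ℂ} (hs : 0 < s.re) :
    ‖∏ p ∈ q.primeFactors, (1 - (p : ℂ) ^ (-s))‖ ≤ q := by
  rw [norm_prod]
  calc ∏ p ∈ q.primeFactors, ‖1 - (p : ℂ) ^ (-s)‖ ≤ ∏ p ∈ q.primeFactors, (p : ℝ) := by
        refine Finset.prod_le_prod (fun _ _ => norm_nonneg _) fun p hp => ?_
        have hp' := Nat.prime_of_mem_primeFactors hp
        have h2 : (2:ℝ) ≤ p := by exact_mod_cast hp'.two_le
        refine (norm_sub_le _ _).trans ?_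
        rw [norm_one, norm_natCast_cpow_of_pos hp'.pos]
        have : (p:ℝ) ^ (-s).re ≤ 1 := Real.rpow_le_one_of_one_le_of_nonpos (by linarith) (by simp; linarith)
        linarith
    _ ≤ q := by
        rw [← Nat.cast_prod]
        exact_mod_cast Nat.le_of_dvd (NeZero.pos q) (Nat.prod_primeFactors_dvd q)

lemma eulerfac_ne_zero {s : ℂ} (hs : 0 < s.re) {χ : ℕ → ℂ} (hχ : ∀ p, ‖χ p‖ ≤ 1) (S : Finset ℕ)
    (hS : ∀ p ∈ S, p.Prime) :
    ∏ p ∈ S, (1 - χ p * (p : ℂ) ^ (-s)) ≠ 0 := by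
  refine Finset.prod_ne_zero_iff.2 fun p hp h => ?_
  have hp' := hS p hp
  have h2 : (1:ℝ) < p := by exact_mod_cast hp'.one_lt
  have h3 : ‖χ p * (p : ℂ) ^ (-s)‖ < 1 := by
    rw [norm_mul, norm_natCast_cpow_of_pos hp'.pos]
    have : (p:ℝ) ^ (-s).re < 1 := Real.rpow_lt_one_of_one_lt_of_neg h2 (by simpa using hs)
    have h0 : 0 ≤ (p:ℝ) ^ (-s).re := by positivity
    nlinarith [hχ p, norm_nonneg (χ p)]
  rw [← sub_eq_zero.1 h, norm_one] at h3
  exact lt_irrefl _ h3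

lemma one_le_q : (1:ℝ) ≤ q := by exact_mod_cast (NeZero.pos q)

lemma FF_growth (χ : DirichletCharacter ℂ q) {s : ℂ} (hs : 1 / 2 ≤ s.re) :
    ‖FF χ s‖ ≤ 5 * q * (1 + ‖s‖) ^ 2 := by
  have hq := one_le_q (q := q)
  have hn := norm_nonneg s
  by_cases h : χ = 1
  · subst h
    rw [FF_one_eq (by linarith), norm_mul]
    have h1 := norm_eulerfac_le (q := q) (s := s) (by linarith)
    have h2 : ‖Hz s‖ ≤ 2 := by
      refine (Hz_bound (by linarith)).trans ?_
      rw [div_le_iff₀ (by linarith)]; linarith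
    have h3 : ‖s + (s - 1) * (s * Hz s)‖ ≤ ‖s‖ + (‖s‖ + 1) * (‖s‖ * 2) := by
      refine (norm_add_le _ _).trans ?_
      rw [norm_mul, norm_mul]
      gcongr
      refine (norm_sub_le _ _).trans ?_
      simp
    calc _ ≤ (q:ℝ) * (‖s‖ + (‖s‖ + 1) * (‖s‖ * 2)) := by gcongr
      _ ≤ 5 * q * (1 + ‖s‖) ^ 2 := by
        rw [mul_comm (5:ℝ), mul_assoc]; gcongr; nlinarith
  · rw [FF_ne h]
    have h1 := LFunction_bound h le_rfl one_pos (s := s) (by linarith)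
    rw [sub_zero, Real.rpow_one, sub_zero] at h1
    refine h1.trans ?_
    have : (q:ℝ) / s.re ≤ q * 2 := by
      rw [div_le_iff₀ (by linarith)]; nlinarith
    calc _ ≤ ‖s‖ * (q * 2) := by gcongr
      _ ≤ 5 * q * (1 + ‖s‖) ^ 2 := by
        rw [mul_comm (5:ℝ), mul_assoc, mul_left_comm]
        have : ‖s‖ * 2 ≤ 5 * (1 + ‖s‖) ^ 2 := by nlinarith
        exact mul_le_mul_of_nonneg_left this (by linarith)

lemma FF_lower (χ : DirichletCharacter ℂ q) {s : ℂ} (hs : 1 < s.re)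
    (hs2 : s.re ≤ 2) : (s.re - 1) ^ 2 / 4 ≤ ‖FF χ s‖ := by
  have h0 := LFunction_lower χ hs hs2
  by_cases h : χ = 1
  · subst h
    have h1 : s ≠ 1 := by rintro rfl; simp at hs
    rw [FF_one, LFunctionTrivChar₁, Function.update_of_ne h1, norm_mul]
    have h2 : s.re - 1 ≤ ‖s - 1‖ := by
      have := Complex.abs_re_le_norm (s - 1)
      simp at this; exact (le_abs_self _).trans this
    have h3 : (s.re - 1) / 4 ≤ ‖LFunctionTrivChar q s‖ := h0
    calc _ = (s.re - 1) * ((s.re - 1) / 4) := by ring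
      _ ≤ _ := by gcongr
  · rw [FF_ne h]
    refine le_trans ?_ h0
    gcongr
    nlinarith

/-- the von Mangoldt series -/
noncomputable def LL (χ : DirichletCharacter ℂ q) (s : ℂ) : ℂ :=
  LSeries ((fun n : ℕ => χ n) * fun n : ℕ => (ArithmeticFunction.vonMangoldt n : ℂ)) s

lemma LL_eq (χ : DirichletCharacter ℂ q) {s : ℂ} (hs : 1 < s.re) :
    LL χ s = -(deriv (FF χ) s / FF χ s) + dl χ / (s - 1) := by
  have h1 : s ≠ 1 := by rintro rfl; simp at hs
  have hL : LFunction χ s ≠ 0 := LFunction_ne_zero_of_one_le_re _ (Or.inr h1) hs.le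
  rw [LL]
  rw [LSeries_twist_vonMangoldt_eq χ hs, ← LFunction_eq_LSeries χ hs,
    ← deriv_LFunction_eq_deriv_LSeries χ hs]
  by_cases h : χ = 1
  · subst h
    rw [FF_one, dl_one, deriv_LFunctionTrivChar₁_apply_of_ne_one q h1, LFunctionTrivChar₁,
      Function.update_of_ne h1, LFunctionTrivChar]
    have : s - 1 ≠ 0 := sub_ne_zero.2 h1
    simp only [ofReal_one]
    field_simp
    ring
  · rw [FF_ne h, dl_ne h]
    simp [neg_div]

end

end SW


open MeasureTheory Finset

namespace SW

open Complex Metric Filter Topology DirichletCharacter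

section
variable {q : ℕ} [NeZero q]

lemma star (χ : DirichletCharacter ℂ q) {ℒ : ℝ} (hℒ : 1 ≤ ℒ) (hq : (q:ℝ) ≤ Real.exp ℒ) {s : ℂ}
    (hs : 1 < s.re) (hs2 : s.re ≤ 2) (hs3 : Real.exp (-ℒ) ≤ s.re - 1)
    (ht : |s.im| + 4 ≤ Real.exp (2 * ℒ)) (Z : Finset ℂ) (hcard : Z.card ≤ 2)
    (hZ : ∀ z ∈ Z, z ∈ closedBall s (1 / 2) ∧ FF χ z = 0) :
    (-(deriv (FF χ) s / FF χ s)).re ≤ 1000 * ℒ - ∑ u ∈ Z, ((s - u)⁻¹).re := by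
  have hgrow : ∀ z ∈ closedBall s (1/2), ‖FF χ z‖ ≤ Real.exp (11 * ℒ) * ‖FF χ s‖ := by
    intro z hz
    rw [mem_closedBall, dist_eq_norm] at hz
    have h1 : 1 / 2 ≤ z.re := by
      have := (Complex.abs_re_le_norm (z - s)).trans hz
      rw [abs_le, sub_re] at this; linarith
    have h2 := FF_growth χ h1
    have h3 := FF_lower χ hs hs2
    have h4 : ‖s‖ ≤ 2 + |s.im| := by
      refine (Complex.norm_le_abs_re_add_abs_im s).trans ?_
      rw [abs_of_pos (by linarith)]; linarith
    have h5 : ‖z‖ ≤ ‖s‖ + 1 / 2 := by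
      have := norm_le_norm_sub_add z s; linarith
    have h6 : 1 + ‖z‖ ≤ Real.exp (2 * ℒ) := by linarith
    have h7 : Real.exp (-ℒ) ^ 2 / 4 ≤ ‖FF χ s‖ := by
      refine le_trans ?_ h3; gcongr
    have h8 : (20:ℝ) ≤ Real.exp (4 * ℒ) := by
      have : Real.exp 4 ≤ Real.exp (4 * ℒ) := Real.exp_le_exp.2 (by linarith)
      have h9 : (2.7:ℝ) ^ 4 ≤ Real.exp 1 ^ 4 := by
        gcongr; have := Real.exp_one_gt_d9; linarith
      have h10 : Real.exp 1 ^ 4 = Real.exp 4 := by rw [← Real.exp_nat_mul]; norm_num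
      norm_num at h9
      linarith
    calc ‖FF χ z‖ ≤ 5 * q * (1 + ‖z‖) ^ 2 := h2
      _ ≤ 5 * Real.exp ℒ * Real.exp (2 * ℒ) ^ 2 := by gcongr
      _ = 20 * Real.exp (7 * ℒ) * (Real.exp (-ℒ) ^ 2 / 4) := by
          rw [← Real.exp_nat_mul, ← Real.exp_nat_mul]
          have : 20 * Real.exp (7 * ℒ) * (Real.exp ((2:ℕ) * (-ℒ)) / 4) = 5 * (Real.exp (7 * ℒ) * Real.exp ((2:ℕ) * (-ℒ))) := by ring
          rw [this, ← Real.exp_add, mul_assoc, ← Real.exp_add]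
          congr 2; push_cast; ring
      _ ≤ Real.exp (4 * ℒ) * Real.exp (7 * ℒ) * ‖FF χ s‖ := by gcongr
      _ = _ := by rw [← Real.exp_add]; congr 2; ring
  have h := landau (FF_diff χ) (c := s) (R := 1/2) (M := 11 * ℒ) (by norm_num) (by linarith)
    (FF_ne_zero χ hs.le) hgrow (by
      intro z _ h0
      by_contra hcon
      exact FF_ne_zero χ (by linarith) h0) Z hZ
  rw [Finset.sum_sub_distrib, Finset.sum_const, nsmul_eq_mul] at h
  have hc : (Z.card : ℝ) ≤ 2 := by exact_mod_cast hcard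
  rw [neg_re]
  have e1 : 40 * (11 * ℒ) / (1 / 2) = 880 * ℒ := by ring
  rw [e1] at h
  rw [show (1:ℝ) / (1 / 2) = 2 by norm_num] at h
  linarith

lemma LL_le (χ : DirichletCharacter ℂ q) {ℒ : ℝ} (hℒ : 1 ≤ ℒ) (hq : (q:ℝ) ≤ Real.exp ℒ) {s : ℂ}
    (hs : 1 < s.re) (hs2 : s.re ≤ 2) (hs3 : Real.exp (-ℒ) ≤ s.re - 1)
    (ht : |s.im| + 4 ≤ Real.exp (2 * ℒ)) (Z : Finset ℂ) (hcard : Z.card ≤ 2)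
    (hZ : ∀ z ∈ Z, z ∈ closedBall s (1 / 2) ∧ FF χ z = 0) :
    (LL χ s).re ≤ 1000 * ℒ - ∑ u ∈ Z, ((s - u)⁻¹).re +
      dl χ * ((s.re - 1) / ((s.re - 1) ^ 2 + s.im ^ 2)) := by
  rw [LL_eq χ hs, add_re]
  have := star χ hℒ hq hs hs2 hs3 ht Z hcard hZ
  have h2 : ((dl χ : ℂ) / (s - 1)).re = dl χ * ((s.re - 1) / ((s.re - 1) ^ 2 + s.im ^ 2)) := by
    rw [div_eq_mul_inv, re_ofReal_mul, inv_re, normSq_apply]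
    simp [sq]
  rw [h2]; linarith

lemma LL_hasSum (χ : DirichletCharacter ℂ q) {s : ℂ} (hs : 1 < s.re) :
    HasSum (fun n => (LSeries.term ((fun n : ℕ => χ n) * fun n : ℕ => (ArithmeticFunction.vonMangoldt n : ℂ)) s n).re)
      (LL χ s).re :=
  Complex.hasSum_re (LSeriesSummable_twist_vonMangoldt χ hs).hasSum

lemma LL_term (χ : DirichletCharacter ℂ q) (σ t : ℝ) {n : ℕ} (hn : n ≠ 0) :
    LSeries.term ((fun n : ℕ => χ n) * fun n : ℕ => (ArithmeticFunction.vonMangoldt n : ℂ)) (σ + t * I) n =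
    ((ArithmeticFunction.vonMangoldt n * (n:ℝ) ^ (-σ) : ℝ) : ℂ) * (χ n * (n : ℂ) ^ (-(t * I))) := by
  rw [LSeries.term_of_ne_zero hn, Pi.mul_apply, div_eq_mul_inv, ← cpow_neg, neg_add,
    cpow_add _ _ (by exact_mod_cast hn)]
  rw [ofReal_mul, ofReal_cpow (by positivity)]
  push_cast
  ring

lemma norm_char_twist (χ : DirichletCharacter ℂ q) (t : ℝ) {n : ℕ} (hn : n ≠ 0) 
    (hu : IsUnit (n : ZMod q)) : ‖χ n * (n : ℂ) ^ (-(t * I))‖ = 1 := by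
  rw [norm_mul, norm_natCast_cpow_of_pos (Nat.pos_of_ne_zero hn)]
  simp
  obtain ⟨u, hu⟩ := hu
  rw [← hu]; exact χ.unit_norm_eq_one u

lemma three_four_one (χ : DirichletCharacter ℂ q) {σ : ℝ} (hσ : 1 < σ) (t : ℝ) :
    0 ≤ 3 * (LL (1 : DirichletCharacter ℂ q) σ).re + 4 * (LL χ (σ + t * I)).re +
      (LL (χ ^ 2) (σ + (2 * t : ℝ) * I)).re := by
  have h1 := (LL_hasSum (1 : DirichletCharacter ℂ q) (s := σ + (0:ℝ) * I) (by simpa using hσ)).mul_left 3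
  have h2 := (LL_hasSum χ (s := σ + t * I) (by simpa using hσ)).mul_left 4
  have h3 := LL_hasSum (χ ^ 2) (s := σ + (2 * t : ℝ) * I) (by simpa using hσ)
  have h := (h1.add h2).add h3
  simp only [ofReal_zero, zero_mul, add_zero] at h
  refine h.nonneg fun n => ?_
  by_cases hn : n = 0
  · subst hn; simp
  have e1 := LL_term (1 : DirichletCharacter ℂ q) σ 0 hn
  simp only [ofReal_zero, zero_mul, add_zero, neg_zero, cpow_zero, mul_one] at e1
  rw [e1, LL_term χ σ t hn, LL_term (χ^2) σ (2 * t) hn, re_ofReal_mul, re_ofReal_mul, re_ofReal_mul]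
  set A : ℝ := ArithmeticFunction.vonMangoldt n * (n:ℝ) ^ (-σ) with hA
  have hA0 : 0 ≤ A := mul_nonneg ArithmeticFunction.vonMangoldt_nonneg (by positivity)
  by_cases hu : IsUnit (n : ZMod q)
  · have hz := norm_char_twist χ t hn hu
    set z := χ n * (n : ℂ) ^ (-(t * I)) with hzdef
    have hz2 : (χ ^ 2) n * (n : ℂ) ^ (-((2 * t : ℝ) * I)) = z ^ 2 := by
      rw [hzdef, mul_pow, MulChar.pow_apply' χ two_ne_zero, ← cpow_nat_mul]
      congr 2; push_cast; ring
    rw [hz2, MulChar.one_apply hu]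
    have : z.re ^ 2 + z.im ^ 2 = 1 := by
      have := Complex.sq_norm z
      rw [hz, normSq_apply] at this; nlinarith
    have h5 : (z ^ 2).re = 2 * z.re ^ 2 - 1 := by
      rw [sq, mul_re]; nlinarith
    rw [h5, one_re]
    have : 3 * (A * 1) + 4 * (A * z.re) + A * (2 * z.re ^ 2 - 1) = A * (2 * (1 + z.re) ^ 2) := by ring
    rw [this]; positivity
  · rw [MulChar.map_nonunit _ hu, MulChar.map_nonunit _ hu, MulChar.map_nonunit _ hu]; simp

lemma two_term (χ : DirichletCharacter ℂ q) {σ : ℝ} (hσ : 1 < σ) :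
    0 ≤ (LL (1 : DirichletCharacter ℂ q) σ).re + (LL χ σ).re := by
  have h1 := (LL_hasSum (1 : DirichletCharacter ℂ q) (s := σ + (0:ℝ) * I) (by simpa using hσ))
  have h2 := (LL_hasSum χ (s := σ + (0:ℝ) * I) (by simpa using hσ))
  have h := (h1.add h2)
  simp only [ofReal_zero, zero_mul, add_zero] at h
  refine h.nonneg fun n => ?_
  by_cases hn : n = 0
  · subst hn; simp
  have e1 := LL_term (1 : DirichletCharacter ℂ q) σ 0 hn
  have e2 := LL_term χ σ 0 hn
  simp only [ofReal_zero, zero_mul, add_zero, neg_zero, cpow_zero, mul_one] at e1 e2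
  rw [e1, e2, re_ofReal_mul, re_ofReal_mul]
  set A : ℝ := ArithmeticFunction.vonMangoldt n * (n:ℝ) ^ (-σ) with hA
  have hA0 : 0 ≤ A := mul_nonneg ArithmeticFunction.vonMangoldt_nonneg (by positivity)
  by_cases hu : IsUnit (n : ZMod q)
  · rw [MulChar.one_apply hu, one_re]
    have h1 := (abs_le.1 ((abs_re_le_norm (χ n)).trans (χ.norm_le_one n))).1
    nlinarith
  · rw [MulChar.map_nonunit _ hu, MulChar.map_nonunit _ hu]; simp

end

end SW


open MeasureTheory Finset

namespace SW

open Complex Metric Filter Topology DirichletCharacter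
open scoped ComplexConjugate

section
variable {q : ℕ} [NeZero q]

lemma quad_conj {χ : DirichletCharacter ℂ q} (h2 : χ ^ 2 = 1) (a : ZMod q) : conj (χ a) = χ a := by
  by_cases hu : IsUnit a
  · have : (χ a) ^ 2 = 1 := by
      rw [← MulChar.pow_apply' χ two_ne_zero, h2, MulChar.one_apply hu]
    rcases mul_self_eq_one_iff.1 ((sq _).symm.trans this) with h | h <;> simp [h]
  · rw [MulChar.map_nonunit _ hu]; simp

lemma LFunction_conj {χ : DirichletCharacter ℂ q} (hχ : χ ≠ 1) (h2 : χ ^ 2 = 1) {s : ℂ} (hs : 0 < s.re) :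
    LFunction χ (conj s) = conj (LFunction χ s) := by
  have hd : Differentiable ℂ (conj ∘ LFunction χ ∘ conj) := by
    intro x
    have := (differentiable_LFunction hχ (conj x)).conj_conj
    simpa using this
  have := halfplane_eq (r := 0) (by norm_num) (differentiable_LFunction hχ).differentiableOn
    hd.differentiableOn (by
      intro s hs
      simp only [Function.comp]
      rw [LFunction_eq_LSeries χ hs, LFunction_eq_LSeries χ (by simpa using hs), LSeries, LSeries,
        Complex.conj_tsum]
      congr 1; ext n
      by_cases hn : n = 0
      · subst hn; simp
      rw [LSeries.term_of_ne_zero hn, LSeries.term_of_ne_zero hn, map_div₀, quad_conj h2]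
      congr 1
      rw [cpow_conj]
      · simp
      · rw [natCast_arg]; exact Real.pi_ne_zero.symm) s hs
  rw [this]; simp

end

lemma FF_one_near : ∃ δ > 0, ∀ (q : ℕ) [NeZero q] (s : ℂ), 0 < s.re → ‖s - 1‖ < δ →
    FF (1 : DirichletCharacter ℂ q) s ≠ 0 := by
  have hc : ContinuousAt (FF (1 : DirichletCharacter ℂ 1)) 1 := (FF_diff _).continuous.continuousAt
  have h := hc.eventually_ne (FF_ne_zero (1 : DirichletCharacter ℂ 1) (s := 1) (by simp))
  obtain ⟨δ, hδ, hball⟩ := Metric.eventually_nhds_iff.1 h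
  refine ⟨δ, hδ, fun q _ s hs hs1 => ?_⟩
  have h1 := hball (y := s) (by rwa [dist_eq_norm])
  rw [FF_one_eq hs] at h1 ⊢
  simp only [Nat.primeFactors_one, Finset.prod_empty, one_mul] at h1
  refine mul_ne_zero ?_ h1
  have := eulerfac_ne_zero hs (χ := fun _ => 1) (by simp) q.primeFactors
    (fun p hp => Nat.prime_of_mem_primeFactors hp)
  simpa using this

lemma real_frac {x y η : ℝ} (hx : 0 < x) : ((((x : ℝ) : ℂ) + y * I)⁻¹).re = x / (x ^ 2 + y ^ 2) := by
  rw [inv_re, normSq_apply]; simp [sq]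

set_option maxHeartbeats 1600000 in
theorem zero_free : ∃ κ > 0, ∃ ℒ₀ : ℝ, 1 ≤ ℒ₀ ∧ ∀ ℒ : ℝ, ℒ₀ ≤ ℒ → ∀ (q : ℕ) [NeZero q]
    (χ : DirichletCharacter ℂ q) (ρ : ℂ), (q:ℝ) ≤ Real.exp ℒ → FF χ ρ = 0 → |ρ.im| ≤ Real.exp ℒ →
    1 - κ / ℒ < ρ.re → χ ≠ 1 ∧ χ ^ 2 = 1 ∧ ρ.im = 0 := by
  obtain ⟨δ, hδ, hnear⟩ := FF_one_near
  refine ⟨1 / 20000000, by norm_num, max 2000000 (1 / δ), le_max_of_le_left (by norm_num), ?_⟩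
  intro ℒ hℒ q _ χ ρ hq hρ him hre
  have hℒ1 : 2000000 ≤ ℒ := le_of_max_le_left hℒ
  have hℒδ : 1 / δ ≤ ℒ := le_of_max_le_right hℒ
  have hℒ0 : 0 < ℒ := by linarith
  obtain ⟨η, hη⟩ : ∃ η : ℝ, η = 1 / (1000000 * ℒ) := ⟨_, rfl⟩
  have hη0 : 0 < η := by rw [hη]; positivity
  have hηL : η * ℒ = 1 / 1000000 := by rw [hη]; field_simp
  have hη1 : η ≤ 1 / 100 := by nlinarith
  have hηδ : 20 * η < δ := by
    have : 1 ≤ ℒ * δ := by rwa [div_le_iff₀ hδ] at hℒδ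
    have : η ≤ η * ℒ * δ := by nlinarith
    rw [hηL] at this; linarith
  have hb1 : 1 - ρ.re < η / 20 := by
    have : 1 / 20000000 / ℒ = η / 20 := by rw [hη]; field_simp; norm_num
    rw [this] at hre; linarith
  have hb0 : ρ.re < 1 := by
    by_contra h
    exact FF_ne_zero χ (by linarith) hρ
  have hexp2 : ℒ ^ 2 / 2 ≤ Real.exp ℒ := by
    have := Real.quadratic_le_exp_of_nonneg hℒ0.le; linarith
  have hexpη : Real.exp (-ℒ) ≤ η := by
    rw [Real.exp_neg, hη, one_div]
    gcongr
    nlinarith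
  have hexpL : 4 + 2 * Real.exp ℒ ≤ Real.exp (2 * ℒ) := by
    have h4 : 4 ≤ Real.exp ℒ := by
      have := Real.add_one_le_exp ℒ; linarith
    rw [two_mul ℒ, Real.exp_add]
    have := mul_le_mul_of_nonneg_right h4 (Real.exp_pos ℒ).le
    linarith
  set γ := ρ.im with hγ
  set x := 1 + η - ρ.re with hx
  have hx0 : 0 < x := by linarith
  have hx1 : x < 1.05 * η := by linarith
  have hxη : η < x := by linarith
  -- bound for trivial character
  have hL1 : (LL (1 : DirichletCharacter ℂ q) ((1 + η : ℝ) : ℂ)).re ≤ 1000 * ℒ + 1 / η := by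
    have := LL_le (1 : DirichletCharacter ℂ q) (ℒ := ℒ) (by linarith) hq (s := ((1 + η : ℝ) : ℂ))
      (by rw [ofReal_re]; linarith) (by rw [ofReal_re]; linarith) (by rw [ofReal_re]; linarith)
      (by rw [ofReal_im, abs_zero]; have := Real.exp_pos ℒ; linarith) ∅ (by simp) (by simp)
    rw [dl_one, ofReal_re, ofReal_im] at this
    refine this.trans (le_of_eq ?_)
    simp; field_simp
  have h341 := three_four_one χ (σ := 1 + η) (by linarith) γ
  have hL2 : (LL χ (((1 + η : ℝ) : ℂ) + γ * I)).re ≤ 1000 * ℒ - 1 / x + dl χ * (η / (η ^ 2 + γ ^ 2)) := by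
    have := LL_le χ (ℒ := ℒ) (by linarith) hq (s := ((1 + η : ℝ) : ℂ) + γ * I)
      (by simp; linarith) (by simp; linarith) (by simp; linarith)
      (by simp; have := Real.exp_pos ℒ; linarith) {ρ} (by simp) (by
        intro z hz
        rw [Finset.mem_singleton] at hz
        subst hz
        refine ⟨?_, hρ⟩
        rw [mem_closedBall', dist_eq_norm]
        have : ((1 + η : ℝ) : ℂ) + γ * I - z = (x : ℂ) := by
          apply Complex.ext <;> simp [hx, hγ]
        rw [this, norm_real, Real.norm_of_nonneg hx0.le]; linarith)
    have e1 : ((1 + η : ℝ) : ℂ) + γ * I - ρ = (x : ℂ) := by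
      apply Complex.ext <;> simp [hx, hγ]
    rw [Finset.sum_singleton, e1, ← ofReal_inv, ofReal_re] at this
    simpa using this
  have hL3 : (LL (χ ^ 2) (((1 + η : ℝ) : ℂ) + (2 * γ : ℝ) * I)).re ≤
      1000 * ℒ + dl (χ ^ 2) * (η / (η ^ 2 + (2 * γ) ^ 2)) := by
    have := LL_le (χ ^ 2) (ℒ := ℒ) (by linarith) hq (s := ((1 + η : ℝ) : ℂ) + (2 * γ : ℝ) * I)
      (by simp; linarith) (by simp; linarith) (by simp; linarith)
      (by 
        simp only [add_im, ofReal_im, mul_im, ofReal_re, I_im, mul_one, I_re, mul_zero, add_zero, zero_add, abs_mul]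
        simp
        have := Real.exp_pos ℒ; linarith) ∅ (by simp) (by simp)
    simpa using this
  have hmain : 4 * (η / x) ≤ 3.008 + 4 * dl χ * (η ^ 2 / (η ^ 2 + γ ^ 2)) +
      dl (χ ^ 2) * (η ^ 2 / (η ^ 2 + (2 * γ) ^ 2)) := by
    have h := add_le_add (add_le_add (mul_le_mul_of_nonneg_left hL1 (by norm_num : (0:ℝ) ≤ 3))
      (mul_le_mul_of_nonneg_left hL2 (by norm_num : (0:ℝ) ≤ 4))) hL3
    have h' := mul_le_mul_of_nonneg_left (h341.trans h) hη0.le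
    have e : η * (3 * (1000 * ℒ + 1 / η) + 4 * (1000 * ℒ - 1 / x + dl χ * (η / (η ^ 2 + γ ^ 2))) +
        (1000 * ℒ + dl (χ ^ 2) * (η / (η ^ 2 + (2 * γ) ^ 2)))) = 8000 * (η * ℒ) + 3 * (η * (1 / η)) - 4 * (η / x) +
        4 * dl χ * (η ^ 2 / (η ^ 2 + γ ^ 2)) + dl (χ ^ 2) * (η ^ 2 / (η ^ 2 + (2 * γ) ^ 2)) := by ring
    rw [e, hηL, mul_one_div_cancel hη0.ne', mul_zero] at h'
    linarith
  have hlow : 3.809 < 4 * (η / x) := by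
    rw [mul_div_assoc', lt_div_iff₀ hx0]; linarith
  by_cases hχ : χ = 1
  · exfalso
    subst hχ
    rw [one_pow, dl_one] at hmain
    by_cases hγ10 : |γ| < 10 * η
    · refine hnear q ρ (by linarith) ?_ hρ
      refine (Complex.norm_le_abs_re_add_abs_im _).trans_lt ?_
      rw [sub_re, sub_im, one_re, one_im, sub_zero, abs_of_neg (by linarith : ρ.re - 1 < 0)]
      linarith
    · push Not at hγ10
      have hg : 100 * η ^ 2 ≤ γ ^ 2 := by
        rw [← sq_abs γ]; nlinarith
      have h1 : η ^ 2 / (η ^ 2 + γ ^ 2) ≤ 1 / 100 := by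
        rw [div_le_iff₀ (by positivity)]; nlinarith
      have h2 : η ^ 2 / (η ^ 2 + (2 * γ) ^ 2) ≤ 1 / 100 := by
        rw [div_le_iff₀ (by positivity)]; nlinarith
      linarith
  refine ⟨hχ, ?_⟩
  rw [dl_ne hχ] at hmain
  by_cases h2 : χ ^ 2 = 1
  swap
  · exfalso
    rw [dl_ne h2] at hmain
    linarith
  refine ⟨h2, ?_⟩
  rw [h2, dl_one] at hmain
  have hγs : 4 * γ ^ 2 < η ^ 2 := by
    by_contra hcon
    push Not at hcon
    have h2 : η ^ 2 / (η ^ 2 + (2 * γ) ^ 2) ≤ 1 / 2 := by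
      rw [div_le_iff₀ (by positivity), mul_pow]; linarith
    linarith
  by_contra hγ0
  have hneq : ρ ≠ conj ρ := by
    intro h
    have := congrArg Complex.im h
    rw [conj_im] at this
    apply hγ0; linarith
  have hγs2 : |γ| < η := by
    rw [← abs_of_pos hη0]; apply sq_lt_sq.1; linarith [sq_nonneg γ]
  have hcj : FF χ (conj ρ) = 0 := by
    rw [FF_ne hχ] at hρ ⊢
    rw [LFunction_conj hχ h2 (by linarith), hρ, map_zero]
  have hpair : (LL χ ((1 + η : ℝ) : ℂ)).re ≤ 1000 * ℒ - 2 * (x / (x ^ 2 + γ ^ 2)) := by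
    have hdist : ∀ z : ℂ, z.re = ρ.re → |z.im| = |γ| → z ∈ closedBall ((1 + η : ℝ) : ℂ) (1/2) := by
      intro z h1 h2
      rw [mem_closedBall', dist_eq_norm]
      refine (Complex.norm_le_abs_re_add_abs_im _).trans ?_
      rw [sub_re, sub_im, ofReal_re, ofReal_im, zero_sub, abs_neg, h1, h2, ← hx, abs_of_pos hx0]
      linarith
    have := LL_le χ (ℒ := ℒ) (by linarith) hq (s := ((1 + η : ℝ) : ℂ))
      (by rw [ofReal_re]; linarith) (by rw [ofReal_re]; linarith) (by rw [ofReal_re]; linarith)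
      (by rw [ofReal_im, abs_zero]; have := Real.exp_pos ℒ; linarith) {ρ, conj ρ} (Finset.card_le_two) (by
        intro z hz
        rw [Finset.mem_insert, Finset.mem_singleton] at hz
        rcases hz with rfl | rfl
        · exact ⟨hdist _ rfl rfl, hρ⟩
        · exact ⟨hdist _ (conj_re _) (by rw [conj_im, abs_neg]), hcj⟩)
    rw [Finset.sum_pair hneq, dl_ne hχ] at this
    have e1 : ((1 + η : ℝ) : ℂ) - ρ = (x : ℂ) + ((-γ : ℝ) : ℂ) * I := by
      apply Complex.ext <;> simp [hx, hγ]
    have e2 : ((1 + η : ℝ) : ℂ) - conj ρ = (x : ℂ) + (γ : ℂ) * I := by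
      apply Complex.ext <;> simp [hx, hγ]
    rw [e1, e2, real_frac (η := η) hx0, real_frac (η := η) hx0, neg_sq] at this
    linarith
  have htwo := two_term χ (σ := 1 + η) (by linarith)
  have h' := mul_le_mul_of_nonneg_left (htwo.trans (add_le_add hL1 hpair)) hη0.le
  have e : η * (1000 * ℒ + 1 / η + (1000 * ℒ - 2 * (x / (x ^ 2 + γ ^ 2)))) =
      2000 * (η * ℒ) + η * (1 / η) - 2 * (η * x / (x ^ 2 + γ ^ 2)) := by ring
  rw [e, hηL, mul_one_div_cancel hη0.ne', mul_zero] at h'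
  have h8 : 0.7 ≤ η * x / (x ^ 2 + γ ^ 2) := by
    rw [le_div_iff₀ (by positivity)]
    have g1 := mul_le_mul_of_nonneg_right hx1.le hx0.le
    have g2 := mul_le_mul_of_nonneg_left hxη.le hη0.le
    have g3 : 0 < η * x := by positivity
    rw [sq] at hγs ⊢
    rw [sq] at hγs ⊢
    linarith
  linarith

end SW


open MeasureTheory Finset

namespace SW

open Complex Metric Filter Topology DirichletCharacter
open scoped ComplexOrder

lemma est_real {h : ℕ → ℝ} {l b A x : ℝ} (hx : 1 < x) (hx2 : x ≤ 9 / 8) (h1 : ∀ m, 0 ≤ h m + l)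
    (hb : b ≤ h 0 + l) (hA : ∀ m, |h m| ≤ A * (2 / 3) ^ m)
    (hs : HasSum (fun m => h m * x ^ m) (l / (x - 1))) (M : ℕ) (hM : 1 ≤ M) :
    b - 4 * A * (3 / 4) ^ M ≤ l * x ^ M / (x - 1) := by
  have hx1 : 0 < x - 1 := by linarith
  have hx0 : 0 < x := by linarith
  have hA0 : 0 ≤ A := by have := (abs_nonneg _).trans (hA 0); simpa using this
  have hsplit := hs.summable.sum_add_tsum_nat_add M
  rw [hs.tsum_eq] at hsplit
  have hterm : ∀ m, ‖h m * x ^ m‖ ≤ A * (3 / 4) ^ m := by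
    intro m
    rw [norm_mul, Real.norm_eq_abs, Real.norm_of_nonneg (by positivity)]
    calc |h m| * x ^ m ≤ (A * (2 / 3) ^ m) * (9 / 8) ^ m := by gcongr; exact hA m
      _ = A * (3 / 4) ^ m := by rw [mul_assoc, ← mul_pow]; norm_num
  have htail : ‖∑' m, h (m + M) * x ^ (m + M)‖ ≤ 4 * A * (3 / 4) ^ M := by
    have hg : HasSum (fun m : ℕ => A * (3 / 4 : ℝ) ^ M * (3 / 4 : ℝ) ^ m) (A * (3 / 4) ^ M * (1 - 3 / 4)⁻¹) :=
      (hasSum_geometric_of_lt_one (by norm_num) (by norm_num)).mul_left _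
    refine (tsum_of_norm_bounded hg fun m => ?_).trans (le_of_eq (by norm_num; ring))
    refine (hterm (m + M)).trans (le_of_eq ?_)
    rw [pow_add]; ring
  have hfin : b - l * ((x ^ M - 1) / (x - 1)) ≤ ∑ m ∈ Finset.range M, h m * x ^ m := by
    rw [← geom_sum_eq hx.ne', Finset.mul_sum, sub_le_iff_le_add, ← Finset.sum_add_distrib]
    have : (h 0 + l) * x ^ 0 ≤ ∑ m ∈ Finset.range M, (h m + l) * x ^ m :=
      Finset.single_le_sum (f := fun m => (h m + l) * x ^ m)
        (fun i _ => mul_nonneg (h1 i) (by positivity)) (Finset.mem_range.2 hM)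
    simp only [add_mul] at this
    simp only [pow_zero, mul_one] at this
    linarith
  have ht := (abs_le.1 htail).1
  have e : l * x ^ M / (x - 1) = l / (x - 1) + l * ((x ^ M - 1) / (x - 1)) := by
    field_simp; ring
  rw [e]; linarith

lemma taylor_nonneg {Φ K : ℂ → ℂ} (hΦ : DifferentiableOn ℂ Φ {s | 1 < s.re})
    (hKd : DifferentiableOn ℂ K {s | 1 < s.re}) (hd : ∀ s : ℂ, 1 < s.re → deriv Φ s = -(Φ s * K s))
    (h0 : 0 ≤ Φ 2) (hK : ∀ n, 0 ≤ (-1) ^ n * iteratedDeriv n K 2) (n : ℕ) :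
    0 ≤ (-1) ^ n * iteratedDeriv n Φ 2 := by
  have hmem : {s : ℂ | 1 < s.re} ∈ 𝓝 (2:ℂ) := (halfplane_open 1).mem_nhds (by simp)
  have hcΦ : ∀ n : ℕ, ContDiffAt ℂ n Φ 2 := fun n => (hΦ.analyticAt hmem).contDiffAt
  have hcK : ∀ n : ℕ, ContDiffAt ℂ n K 2 := fun n => (hKd.analyticAt hmem).contDiffAt
  induction n using Nat.strong_induction_on with
  | _ n ih =>
    cases n with
    | zero => simpa using h0
    | succ n =>
      have hev : deriv Φ =ᶠ[𝓝 2] -(Φ * K) := by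
        filter_upwards [hmem] with s hs
        simpa using hd s hs
      rw [iteratedDeriv_succ', hev.iteratedDeriv_eq, iteratedDeriv_neg, iteratedDeriv_mul (hcΦ n) (hcK n),
        pow_succ, mul_assoc, neg_one_mul, neg_neg, Finset.mul_sum]
      refine Finset.sum_nonneg fun i hi => ?_
      have hi' : i ≤ n := by simpa [Nat.lt_succ_iff] using hi
      have e : (-1 : ℂ) ^ n * (n.choose i * iteratedDeriv i Φ 2 * iteratedDeriv (n - i) K 2) =
          n.choose i * ((-1) ^ i * iteratedDeriv i Φ 2) * ((-1) ^ (n - i) * iteratedDeriv (n - i) K 2) := by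
        have : (-1 : ℂ) ^ n = (-1) ^ i * (-1) ^ (n - i) := by rw [← pow_add]; congr 1; omega
        rw [this]; ring
      rw [e]
      exact mul_nonneg (mul_nonneg (Nat.cast_nonneg _) (ih i (by omega))) (hK _)

lemma estermann {G K : ℂ → ℂ} (hG : Differentiable ℂ G)
    (hKd : DifferentiableOn ℂ K {s | 1 < s.re})
    (hlog : ∀ s : ℂ, 1 < s.re → deriv G s = G s * ((s - 1)⁻¹ - K s))
    (hK : ∀ n, 0 ≤ (-1) ^ n * iteratedDeriv n K 2) (h2 : 0 ≤ G 2) {M0 : ℝ}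
    (hM0 : ∀ z ∈ sphere (2:ℂ) (3/2), ‖G z‖ ≤ M0) (hM1 : ‖G 1‖ ≤ M0) {β : ℝ} (hβ : 7 / 8 ≤ β) (hβ1 : β < 1)
    (hz : G β = 0) (M : ℕ) (hM : 1 ≤ M) :
    (G 2).re - 16 * M0 * (3 / 4) ^ M ≤ ‖G 1‖ * (2 - β) ^ M / (1 - β) := by
  set H : ℂ → ℂ := dslope G 1 with hH
  have hHd : Differentiable ℂ H := by
    have := (Complex.differentiableOn_dslope (c := (1:ℂ)) (s := Set.univ) (f := G) univ_mem).2 hG.differentiableOn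
    exact differentiableOn_univ.1 this
  have hHne : ∀ s : ℂ, s ≠ 1 → H s = (G s - G 1) / (s - 1) := by
    intro s hs
    rw [hH, dslope_of_ne _ hs, slope_def_field]
  set Φ : ℂ → ℂ := H + fun s => G 1 * (1 * s - 1)⁻¹ with hΦ
  have hΦne : ∀ s : ℂ, s ≠ 1 → Φ s = G s / (s - 1) := by
    intro s hs
    have : s - 1 ≠ 0 := sub_ne_zero.2 hs
    simp only [hΦ, Pi.add_apply, hHne s hs, one_mul]; field_simp; ring
  have hne : ∀ s : ℂ, 1 < s.re → s ≠ 1 := by rintro s hs rfl; simp at hs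
  have hΦd' : ∀ s : ℂ, 1 < s.re → HasDerivAt Φ (-(Φ s * K s)) s := by
    intro s hs
    have hs1 := hne s hs
    have hs0 : s - 1 ≠ 0 := sub_ne_zero.2 hs1
    have hd : HasDerivAt (fun s => G s / (s - 1)) ((deriv G s * (s - 1) - G s * 1) / (s - 1) ^ 2) s :=
      (hG s).hasDerivAt.div ((hasDerivAt_id s).sub_const 1) hs0
    have hev : Φ =ᶠ[𝓝 s] fun s => G s / (s - 1) := by
      filter_upwards [isOpen_ne.mem_nhds hs1] with z hz using hΦne z hz
    refine (hd.congr_of_eventuallyEq hev).congr_deriv ?_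
    rw [hlog s hs, hΦne s hs1]; field_simp; ring
  have hΦpos := taylor_nonneg (Φ := Φ) (K := K) (fun s hs => (hΦd' s hs).differentiableAt.differentiableWithinAt) hKd
    (fun s hs => (hΦd' s hs).deriv) (by rw [hΦne 2 (by norm_num)]; norm_num; exact h2) hK
  have hiter : ∀ n : ℕ, iteratedDeriv n Φ 2 = iteratedDeriv n H 2 + G 1 * ((-1) ^ n * n.factorial) := by
    intro n
    have hmem : {s : ℂ | 1 < s.re} ∈ 𝓝 (2:ℂ) := (halfplane_open 1).mem_nhds (by simp)
    have hdi : DifferentiableOn ℂ (fun s : ℂ => (1 * s - 1)⁻¹) {s : ℂ | 1 < s.re} := by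
      intro s hs
      have hs0 : 1 * s - 1 ≠ 0 := by rw [one_mul]; exact sub_ne_zero.2 (hne s hs)
      fun_prop (disch := assumption)
    have hci : ContDiffAt ℂ n (fun s : ℂ => G 1 * (1 * s - 1)⁻¹) 2 :=
      ((hdi.const_mul (G 1)).analyticAt hmem).contDiffAt
    rw [hΦ, iteratedDeriv_add (hHd.analyticAt 2).contDiffAt hci, iteratedDeriv_const_mul_field]
    congr 2
    rw [iteratedDeriv_eq_iterate, iter_deriv_inv_linear_sub]
    norm_num
  have hcauchy : ∀ n : ℕ, ‖iteratedDeriv n H 2‖ ≤ n.factorial * (4 * M0) / (3 / 2) ^ n := by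
    intro n
    refine norm_iteratedDeriv_le_of_forall_mem_sphere_norm_le n (by norm_num) hHd.diffContOnCl fun z hz => ?_
    have hz' : ‖z - 2‖ = 3 / 2 := mem_sphere_iff_norm.1 hz
    have hz1 : 1 / 2 ≤ ‖z - 1‖ := by
      have : ‖z - 2‖ ≤ ‖z - 1‖ + ‖(1:ℂ)‖ := by
        have : z - 2 = (z - 1) - 1 := by ring
        rw [this]; exact norm_sub_le _ _
      rw [norm_one] at this; linarith
    have hzne : z ≠ 1 := by rintro rfl; norm_num at hz1
    rw [hHne z hzne, norm_div, div_le_iff₀ (by linarith)]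
    have h3 := norm_sub_le (G z) (G 1)
    have h4 := hM0 z hz
    have h5 : 0 ≤ M0 := (norm_nonneg _).trans hM1
    nlinarith
  have hts := Complex.hasSum_taylorSeries_of_entire hHd 2 (β : ℂ)
  have hβne : (β : ℂ) ≠ 1 := by
    intro h; rw [← ofReal_one, ofReal_inj] at h; linarith
  have hHβ : H β = G 1 / ((1 - β : ℝ) : ℂ) := by
    have : (β : ℂ) - 1 ≠ 0 := sub_ne_zero.2 hβne
    have h' : (1 : ℂ) - β ≠ 0 := sub_ne_zero.2 hβne.symm
    rw [hHne _ hβne, hz, ofReal_sub, ofReal_one]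
    field_simp; ring
  rw [hHβ] at hts
  have hts2 := Complex.hasSum_re hts
  have key := est_real (h := fun m => (((-1) ^ m * iteratedDeriv m H 2 / m.factorial : ℂ)).re) (l := (G 1).re)
    (b := (G 2).re) (A := 4 * M0) (x := 2 - β) (by linarith) (by linarith) (by
      intro m
      have h := hΦpos m
      rw [hiter m] at h
      have hf : (0:ℝ) < m.factorial := by positivity
      have hf' : (m.factorial : ℂ) ≠ 0 := by exact_mod_cast hf.ne'
      have e : (-1 : ℂ) ^ m * (iteratedDeriv m H 2 + G 1 * ((-1) ^ m * m.factorial)) =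
          ((m.factorial : ℝ) : ℂ) * ((-1) ^ m * iteratedDeriv m H 2 / m.factorial + G 1) := by
        have : (-1 : ℂ) ^ m * (-1) ^ m = 1 := by rw [← mul_pow]; norm_num
        have e2 : (-1 : ℂ) ^ m * (iteratedDeriv m H 2 + G 1 * ((-1) ^ m * m.factorial)) =
          (-1 : ℂ) ^ m * iteratedDeriv m H 2 + G 1 * ((-1 : ℂ) ^ m * (-1) ^ m) * m.factorial := by ring
        rw [e2, this, ofReal_natCast]; field_simp
      rw [e] at h
      have := (Complex.le_def.1 h).1
      rw [re_ofReal_mul, zero_re] at this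
      have := nonneg_of_mul_nonneg_right this hf
      rwa [add_re] at this) (by
      simp only [pow_zero, iteratedDeriv_zero, Nat.factorial_zero, Nat.cast_one, div_one, one_mul]
      rw [hHne 2 (by norm_num)]; norm_num) (by
      intro m
      refine (Complex.abs_re_le_norm _).trans ?_
      rw [norm_div, norm_mul, norm_pow, norm_neg, norm_one, one_pow, one_mul, Complex.norm_natCast,
        div_le_iff₀ (by positivity)]
      refine (hcauchy m).trans (le_of_eq ?_)
      rw [show (2 / 3 : ℝ) = (3 / 2)⁻¹ by norm_num, inv_pow]; ring) (by
      convert hts2 using 1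
      · ext m
        rw [← re_mul_ofReal]
        congr 1
        simp only [smul_eq_mul]
        have : (β : ℂ) - 2 = (-1) * ((2 - β : ℝ) : ℂ) := by push_cast; ring
        rw [this, mul_pow]; push_cast; ring
      · rw [div_ofReal_re]; congr 1; ring) M hM
  have e2 : 2 - β - 1 = 1 - β := by ring
  rw [e2] at key
  have hle : (G 1).re ≤ ‖G 1‖ := re_le_norm _
  refine le_trans ?_ (key.trans ?_)
  · apply le_of_eq; ring
  · have : 0 < 1 - β := by linarith
    have : 0 < 2 - β := by linarith
    gcongr

end SW


open MeasureTheory Finset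

namespace SW

open Complex Metric Filter Topology DirichletCharacter
open scoped ComplexOrder ComplexConjugate

section
variable {q : ℕ} [NeZero q]

lemma quad_val {χ : DirichletCharacter ℂ q} (h2 : χ ^ 2 = 1) {a : ZMod q} (hu : IsUnit a) :
    χ a = 1 ∨ χ a = -1 := by
  have : (χ a) ^ 2 = 1 := by
    rw [← MulChar.pow_apply' χ two_ne_zero, h2, MulChar.one_apply hu]
  exact mul_self_eq_one_iff.1 ((sq _).symm.trans this)

lemma L_two {χ : DirichletCharacter ℂ q} (h2 : χ ^ 2 = 1) :
    ∃ r : ℝ, 1 / 3 ≤ r ∧ LFunction χ 2 = r := by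
  have hs : (1:ℝ) < (2:ℂ).re := by simp
  have hsum := (LSeriesSummable_of_one_lt_re χ hs).hasSum
  have hterm : ∀ n : ℕ, LSeries.term (fun n : ℕ => χ n) 2 n = (((χ n).re / (n:ℝ) ^ 2 : ℝ) : ℂ) := by
    intro n
    have hreal : χ (n : ZMod q) = (((χ n).re : ℝ) : ℂ) := (Complex.conj_eq_iff_re.1 (quad_conj h2 n)).symm
    rcases eq_or_ne n 0 with rfl | hn
    · simp
    · rw [LSeries.term_of_ne_zero hn]
      push_cast
      rw [← hreal]
      congr 1
      exact_mod_cast Complex.cpow_natCast (n:ℂ) 2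
  have hval : ∑' n, LSeries.term (fun n : ℕ => χ n) 2 n = LFunction χ 2 := by
    rw [LFunction_eq_LSeries χ hs]; rfl
  rw [hval, funext hterm] at hsum
  have hre := Complex.hasSum_re hsum
  have him := Complex.hasSum_im hsum
  simp only [ofReal_re, ofReal_im] at hre him
  refine ⟨(LFunction χ 2).re, ?_, ?_⟩
  · have hz := hre.add hasSum_zeta_two
    have hone : (χ ((1:ℕ) : ZMod q)).re / ((1:ℕ):ℝ) ^ 2 + 1 / ((1:ℕ):ℝ) ^ 2 ≤ (LFunction χ 2).re + Real.pi ^ 2 / 6 := by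
      refine le_hasSum hz 1 fun n _ => ?_
      rw [← add_div]
      apply div_nonneg _ (by positivity)
      have h1 := (abs_le.1 ((abs_re_le_norm (χ n)).trans (χ.norm_le_one n))).1
      linarith
    have : (χ ((1:ℕ) : ZMod q)).re = 1 := by simp
    rw [this] at hone
    norm_num at hone
    have hpi := Real.pi_lt_d2
    have hpi0 := Real.pi_pos
    nlinarith
  · apply Complex.ext
    · simp
    · rw [ofReal_im]; exact him.unique hasSum_zero

lemma FF_two {χ : DirichletCharacter ℂ q} (h2 : χ ^ 2 = 1) :
    ∃ r : ℝ, 1 / 3 ≤ r ∧ FF χ 2 = r := by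
  by_cases h : χ = 1
  · subst h
    obtain ⟨r, hr, he⟩ := L_two h2
    refine ⟨r, hr, ?_⟩
    rw [FF_one, LFunctionTrivChar₁, Function.update_of_ne (by norm_num)]
    rw [← he, LFunctionTrivChar]; norm_num
  · rw [FF_ne h]; exact L_two h2

noncomputable def kk (χ ψ : DirichletCharacter ℂ q) : ℕ → ℂ :=
  ((fun n : ℕ => (1 : DirichletCharacter ℂ q) n) * fun n : ℕ => (ArithmeticFunction.vonMangoldt n : ℂ)) +
  ((fun n : ℕ => χ n) * fun n : ℕ => (ArithmeticFunction.vonMangoldt n : ℂ)) +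
  (((fun n : ℕ => ψ n) * fun n : ℕ => (ArithmeticFunction.vonMangoldt n : ℂ)) +
  ((fun n : ℕ => (χ * ψ) n) * fun n : ℕ => (ArithmeticFunction.vonMangoldt n : ℂ)))

lemma kk_nonneg {χ ψ : DirichletCharacter ℂ q} (hχ : χ ^ 2 = 1) (hψ : ψ ^ 2 = 1) : 0 ≤ kk χ ψ := by
  intro n
  have hΛ : (0 : ℂ) ≤ (ArithmeticFunction.vonMangoldt n : ℂ) := by
    exact_mod_cast ArithmeticFunction.vonMangoldt_nonneg
  have e : kk χ ψ n = ((1 : DirichletCharacter ℂ q) n + χ n + ψ n + χ n * ψ n) * (ArithmeticFunction.vonMangoldt n : ℂ) := by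
    simp only [kk, Pi.add_apply, Pi.mul_apply, MulChar.mul_apply]; ring
  rw [e, Pi.zero_apply]
  refine mul_nonneg ?_ hΛ
  by_cases hu : IsUnit (n : ZMod q)
  · rw [MulChar.one_apply hu]
    rcases quad_val hχ hu with h | h <;> rcases quad_val hψ hu with h' | h' <;> rw [h, h'] <;> norm_num
  · rw [MulChar.map_nonunit _ hu, MulChar.map_nonunit _ hu, MulChar.map_nonunit _ hu]; simp

lemma kk_summable (χ ψ : DirichletCharacter ℂ q) {s : ℂ} (hs : 1 < s.re) : LSeriesSummable (kk χ ψ) s :=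
  ((LSeriesSummable_twist_vonMangoldt _ hs).add (LSeriesSummable_twist_vonMangoldt _ hs)).add
    ((LSeriesSummable_twist_vonMangoldt _ hs).add (LSeriesSummable_twist_vonMangoldt _ hs))

lemma kk_eq (χ ψ : DirichletCharacter ℂ q) {s : ℂ} (hs : 1 < s.re) :
    LSeries (kk χ ψ) s = LL (1 : DirichletCharacter ℂ q) s + LL χ s + (LL ψ s + LL (χ * ψ) s) := by
  have h := fun χ : DirichletCharacter ℂ q => LSeriesSummable_twist_vonMangoldt χ hs
  rw [kk, LSeries_add ((h _).add (h _)) ((h _).add (h _)), LSeries_add (h _) (h _), LSeries_add (h _) (h _)]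
  rfl

lemma kk_absc (χ ψ : DirichletCharacter ℂ q) : LSeries.abscissaOfAbsConv (kk χ ψ) ≤ (1:ℝ) :=
  LSeries.abscissaOfAbsConv_le_of_forall_lt_LSeriesSummable fun y hy => kk_summable χ ψ (by simpa using hy)

lemma FF_one_one_le : ‖FF (1 : DirichletCharacter ℂ q) 1‖ ≤ 1 := by
  rw [FF_one_eq (by simp)]
  simp only [sub_self, zero_mul, add_zero, mul_one, norm_prod]
  refine Finset.prod_le_one (fun _ _ => norm_nonneg _) fun p hp => ?_
  have hp' : (1:ℝ) ≤ p := by exact_mod_cast (Nat.prime_of_mem_primeFactors hp).one_le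
  have : (1 : ℂ) - (p:ℂ) ^ (-1 : ℂ) = ((1 - (p:ℝ)⁻¹ : ℝ) : ℂ) := by
    rw [cpow_neg_one]; push_cast; rfl
  rw [this, norm_real, Real.norm_eq_abs, abs_le]
  have h1 : (p:ℝ)⁻¹ ≤ 1 := inv_le_one_of_one_le₀ hp'
  have h2 : 0 ≤ (p:ℝ)⁻¹ := by positivity
  constructor <;> linarith

lemma siegel_lower {χ ψ : DirichletCharacter ℂ q} (hχ2 : χ ^ 2 = 1) (hψ2 : ψ ^ 2 = 1) (hχ : χ ≠ 1) (hψ : ψ ≠ 1)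
    (hχψ : χ * ψ ≠ 1) {β δ : ℝ} (hδ : δ ≤ 1 / 8) (hβ : 1 - δ ≤ β) (hβ1 : β < 1) (hz : LFunction χ β = 0) :
    (1 - β) / 500 * (10000 * (q:ℝ)) ^ (-(16 * δ)) ≤ ‖LFunction χ 1‖ * ‖LFunction ψ 1‖ * ‖LFunction (χ * ψ) 1‖ := by
  have hq1 := one_le_q (q := q)
  set G : ℂ → ℂ := FF (1 : DirichletCharacter ℂ q) * FF χ * (FF ψ * FF (χ * ψ)) with hG
  have hχψ2 : (χ * ψ) ^ 2 = 1 := by rw [mul_pow, hχ2, hψ2, one_mul]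
  have hd := fun χ : DirichletCharacter ℂ q => FF_diff χ
  have hGd : Differentiable ℂ G := ((hd _).mul (hd _)).mul ((hd _).mul (hd _))
  have hlog : ∀ s : ℂ, 1 < s.re → deriv G s = G s * ((s - 1)⁻¹ - LSeries (kk χ ψ) s) := by
    intro s hs
    have hs1 : s - 1 ≠ 0 := by rw [sub_ne_zero]; rintro rfl; simp at hs
    rw [kk_eq χ ψ hs, LL_eq _ hs, LL_eq _ hs, LL_eq _ hs, LL_eq _ hs, dl_one, dl_ne hχ, dl_ne hψ, dl_ne hχψ]
    have h1 := FF_ne_zero (1 : DirichletCharacter ℂ q) hs.le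
    have h2 := FF_ne_zero χ hs.le
    have h3 := FF_ne_zero ψ hs.le
    have h4 := FF_ne_zero (χ * ψ) hs.le
    have hder : HasDerivAt G _ s := ((hd 1 s).hasDerivAt.mul (hd χ s).hasDerivAt).mul
      ((hd ψ s).hasDerivAt.mul (hd (χ * ψ) s).hasDerivAt)
    rw [hder.deriv]
    simp only [hG, Pi.mul_apply, ofReal_one, ofReal_zero]
    field_simp
    ring
  have hKpos : ∀ n, 0 ≤ (-1) ^ n * iteratedDeriv n (LSeries (kk χ ψ)) 2 := by
    intro n
    have := LSeries.iteratedDeriv_alternating (kk_nonneg hχ2 hψ2) (x := 2)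
      ((kk_absc χ ψ).trans_lt (by exact_mod_cast one_lt_two)) n
    simpa using this
  obtain ⟨r0, hr0, e0⟩ := FF_two (q := q) (χ := 1) (one_pow 2)
  obtain ⟨r1, hr1, e1⟩ := FF_two hχ2
  obtain ⟨r2, hr2, e2⟩ := FF_two hψ2
  obtain ⟨r3, hr3, e3⟩ := FF_two hχψ2
  have hG2 : G 2 = ((r0 * r1 * (r2 * r3) : ℝ) : ℂ) := by
    simp only [hG, Pi.mul_apply, e0, e1, e2, e3]; push_cast; ring
  have hr : 1 / 81 ≤ r0 * r1 * (r2 * r3) := by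
    calc (1/81 : ℝ) = (1/3) * (1/3) * ((1/3) * (1/3)) := by norm_num
      _ ≤ r0 * r1 * (r2 * r3) := by gcongr
  have hM0 : ∀ z : ℂ, 1 / 2 ≤ z.re → ‖z‖ ≤ 7 / 2 → ‖G z‖ ≤ (105 * q) ^ 4 := by
    intro z hz hz'
    have hb : ∀ χ : DirichletCharacter ℂ q, ‖FF χ z‖ ≤ 105 * q := by
      intro χ
      refine (FF_growth χ hz).trans ?_
      have : (1 + ‖z‖) ^ 2 ≤ (9/2) ^ 2 := by gcongr; linarith
      nlinarith
    simp only [hG, Pi.mul_apply, norm_mul]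
    calc _ ≤ (105 * (q:ℝ)) * (105 * q) * ((105 * q) * (105 * q)) := by gcongr <;> exact hb _
      _ = _ := by ring
  set X : ℝ := 10000 * q with hX
  have hX0 : 1 ≤ X := by linarith
  have hlX : 0 ≤ Real.log X := Real.log_nonneg hX0
  set M : ℕ := ⌈16 * Real.log X⌉₊ + 1 with hM
  have hMlow : 16 * Real.log X ≤ M := by
    rw [hM]; push_cast; have := Nat.le_ceil (16 * Real.log X); linarith
  have hMup : (M : ℝ) ≤ 16 * Real.log X + 2 := by
    rw [hM]; push_cast; have := Nat.ceil_lt_add_one (show 0 ≤ 16 * Real.log X by positivity); linarith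
  have h34 : (3 / 4 : ℝ) ^ M ≤ (X ^ 4)⁻¹ := by
    have h1 : (3/4 : ℝ) ≤ Real.exp (-(1/4)) := by have := Real.add_one_le_exp (-(1/4) : ℝ); linarith
    calc (3 / 4 : ℝ) ^ M ≤ Real.exp (-(1/4)) ^ M := by gcongr
      _ = Real.exp (-(M / 4)) := by rw [← Real.exp_nat_mul]; congr 1; ring
      _ ≤ Real.exp (-(4 * Real.log X)) := by gcongr; linarith
      _ = (X ^ 4)⁻¹ := by
        rw [Real.exp_neg]; congr 1
        rw [← Real.exp_log (show 0 < X by linarith), ← Real.exp_nat_mul]; simp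
  have key := estermann hGd (K := LSeries (kk χ ψ)) (by
      refine (LSeries_differentiableOn _).mono fun s hs => ?_
      exact (kk_absc χ ψ).trans_lt (by exact_mod_cast hs)) hlog hKpos
    (by rw [hG2]; exact_mod_cast (show (0:ℝ) ≤ 1/81 by norm_num).trans hr) (M0 := (105 * q) ^ 4)
    (by
      intro z hz
      have hz' : ‖z - 2‖ = 3 / 2 := mem_sphere_iff_norm.1 hz
      refine hM0 z ?_ ?_
      · have := (abs_le.1 ((abs_re_le_norm (z - 2)).trans hz'.le)).1
        norm_num at this; linarith
      · calc ‖z‖ = ‖(z - 2) + 2‖ := by ring_nf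
          _ ≤ ‖z - 2‖ + ‖(2:ℂ)‖ := norm_add_le _ _
          _ ≤ 7 / 2 := by rw [hz']; norm_num) (hM0 1 (by simp; norm_num) (by simp; norm_num)) (β := β) (by linarith) hβ1
    (by simp only [hG, Pi.mul_apply, FF_ne hχ, hz]; simp) M (by omega)
  have h16 : 16 * (105 * (q:ℝ)) ^ 4 * (3 / 4) ^ M ≤ 1 / 162 := by
    calc 16 * (105 * (q:ℝ)) ^ 4 * (3 / 4) ^ M ≤ 16 * (105 * (q:ℝ)) ^ 4 * (X ^ 4)⁻¹ := by gcongr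
      _ = 16 * 105 ^ 4 / 10000 ^ 4 := by rw [hX]; field_simp
      _ ≤ 1 / 162 := by norm_num
  have hpow : (2 - β) ^ M ≤ 3 * X ^ (16 * δ) := by
    have hδ0 : 0 ≤ δ := by linarith
    calc (2 - β) ^ M ≤ Real.exp δ ^ M := by
          gcongr
          · linarith
          · have := Real.add_one_le_exp δ; linarith
      _ = Real.exp (M * δ) := by rw [← Real.exp_nat_mul]
      _ ≤ Real.exp (1 + 16 * δ * Real.log X) := by
          gcongr
          have := mul_le_mul_of_nonneg_right hMup hδ0
          linarith
      _ = Real.exp 1 * X ^ (16 * δ) := by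
          rw [Real.exp_add, Real.rpow_def_of_pos (by linarith)]; congr 2; ring
      _ ≤ 3 * X ^ (16 * δ) := by
          gcongr; have := Real.exp_one_lt_d9; linarith
  have hG1 : ‖G 1‖ ≤ ‖LFunction χ 1‖ * ‖LFunction ψ 1‖ * ‖LFunction (χ * ψ) 1‖ := by
    simp only [hG, Pi.mul_apply, norm_mul, FF_ne hχ, FF_ne hψ, FF_ne hχψ]
    calc _ ≤ 1 * ‖LFunction χ 1‖ * (‖LFunction ψ 1‖ * ‖LFunction (χ * ψ) 1‖) := by
          gcongr; exact FF_one_one_le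
      _ = _ := by ring
  refine le_trans ?_ hG1
  rw [hG2, ofReal_re] at key
  have hβ0 : 0 < 1 - β := by linarith
  have key2 : 1 / 162 ≤ ‖G 1‖ * (3 * X ^ (16 * δ)) / (1 - β) := by
    refine le_trans (by linarith) (key.trans ?_)
    gcongr
  rw [le_div_iff₀ hβ0] at key2
  have hXp : 0 < X ^ (16 * δ) := by positivity
  rw [Real.rpow_neg (by linarith), ← div_eq_mul_inv, div_le_iff₀ hXp]
  have := norm_nonneg (G 1)
  nlinarith [mul_nonneg this hXp.le]

lemma siegel_upper {χ : DirichletCharacter ℂ q} (hχ : χ ≠ 1) {δ : ℝ} (hδ0 : 0 < δ) (hδ : δ ≤ 1 / 8) :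
    ‖LFunction χ 1‖ ≤ (q:ℝ) ^ δ / δ := by
  have := LFunction_bound hχ (r := 1 - δ) (by linarith) (by linarith) (s := 1) (by simp; linarith)
  simpa using this

lemma siegel_upper' {χ : DirichletCharacter ℂ q} (hχ : χ ≠ 1) {δ β : ℝ} (hδ0 : 0 < δ) (hδ : δ ≤ 1 / 8)
    (hβ : 1 - δ / 4 ≤ β) (hβ1 : β < 1) (hz : LFunction χ β = 0) :
    ‖LFunction χ 1‖ ≤ 16 * (q:ℝ) ^ δ / δ ^ 2 * (1 - β) := by
  have hq1 := one_le_q (q := q)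
  have hqp : 0 < (q:ℝ) ^ δ := by positivity
  have hd := differentiable_LFunction hχ
  have hb : ∀ z : ℂ, 1 - δ / 2 ≤ z.re → ‖z‖ ≤ 2 → ‖LFunction χ z‖ ≤ 4 * (q:ℝ) ^ δ / δ := by
    intro z hz hz2
    have := LFunction_bound hχ (r := 1 - δ) (by linarith) (by linarith) (s := z) (by linarith)
    rw [sub_sub_cancel] at this
    refine this.trans ?_
    have hp : 0 < z.re - (1 - δ) := by linarith
    calc _ ≤ 2 * ((q:ℝ) ^ δ / (δ / 2)) := by
          gcongr
          linarith
      _ = _ := by field_simp; norm_num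
  have hder : ∀ x ∈ segment ℝ (β : ℂ) 1, ‖deriv (LFunction χ) x‖ ≤ 16 * (q:ℝ) ^ δ / δ ^ 2 := by
    intro x hx
    have hx1 : ‖x - 1‖ ≤ δ / 4 := by
      have := norm_sub_le_of_mem_segment hx
      have e : ‖(β:ℂ) - 1‖ = 1 - β := by
        rw [← ofReal_one, ← ofReal_sub, norm_real, Real.norm_eq_abs, abs_sub_comm, abs_of_pos (by linarith)]
      obtain ⟨a, b, ha, hb, hab, rfl⟩ := hx
      have e2 : a • (β:ℂ) + b • (1:ℂ) - 1 = (a : ℂ) * (β - 1) := by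
        have : (b : ℂ) = 1 - a := by rw [← ofReal_one, ← hab]; push_cast; ring
        simp only [real_smul, mul_one, this]; ring
      rw [e2, norm_mul, e, norm_real, Real.norm_of_nonneg ha]
      nlinarith
    have := Complex.norm_deriv_le_of_forall_mem_sphere_norm_le (c := x) (R := δ / 4) (by linarith)
      (hd.diffContOnCl) (C := 4 * (q:ℝ) ^ δ / δ) (by
        intro z hz
        have hz' : ‖z - x‖ = δ / 4 := mem_sphere_iff_norm.1 hz
        have hz1 : ‖z - 1‖ ≤ δ / 2 := by
          calc ‖z - 1‖ = ‖(z - x) + (x - 1)‖ := by ring_nf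
            _ ≤ ‖z - x‖ + ‖x - 1‖ := norm_add_le _ _
            _ ≤ δ / 2 := by linarith
        refine hb z ?_ ?_
        · have := (abs_le.1 ((abs_re_le_norm (z - 1)).trans hz1)).1
          rw [sub_re, one_re] at this; linarith
        · calc ‖z‖ = ‖(z - 1) + 1‖ := by ring_nf
            _ ≤ ‖z - 1‖ + ‖(1:ℂ)‖ := norm_add_le _ _
            _ ≤ 2 := by rw [norm_one]; linarith)
    refine this.trans (le_of_eq ?_)
    field_simp; norm_num
  have := (convex_segment (𝕜 := ℝ) (β:ℂ) 1).norm_image_sub_le_of_norm_deriv_le (f := LFunction χ)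
    (fun x _ => hd x) hder (left_mem_segment ℝ _ _) (right_mem_segment ℝ _ _)
  rw [hz, sub_zero] at this
  refine this.trans (le_of_eq ?_)
  congr 1
  rw [← ofReal_one, ← ofReal_sub, norm_real, Real.norm_eq_abs, abs_of_pos (by linarith)]

end

theorem siegel {ε : ℝ} (hε : 0 < ε) (hε1 : ε ≤ 1) : ∃ c > 0, ∀ (q : ℕ) [NeZero q] (χ : DirichletCharacter ℂ q) (β : ℝ),
    χ ≠ 1 → χ ^ 2 = 1 → LFunction χ β = 0 → β ≤ 1 - c * (q:ℝ) ^ (-ε) := by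
  obtain ⟨δ, hδ⟩ : ∃ δ : ℝ, δ = ε / 19 := ⟨_, rfl⟩
  have hδ0 : 0 < δ := by rw [hδ]; positivity
  have hδ8 : δ ≤ 1 / 8 := by rw [hδ]; linarith
  have hβlt : ∀ (q : ℕ) [NeZero q] (χ : DirichletCharacter ℂ q) (β : ℝ), χ ≠ 1 → LFunction χ β = 0 → β < 1 := by
    intro q _ χ β hχ hz
    by_contra h
    exact LFunction_ne_zero_of_one_le_re χ (Or.inl hχ) (s := β) (by simpa using h) hz
  have hqle : ∀ (q : ℕ) [NeZero q], (q:ℝ) ^ (-ε) ≤ 1 := by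
    intro q _
    exact Real.rpow_le_one_of_one_le_of_nonpos one_le_q (by linarith)
  have htriv : ∀ (c : ℝ), 0 < c → ∀ (q : ℕ) [NeZero q] (β : ℝ), β ≤ 1 - c → β ≤ 1 - c * (q:ℝ) ^ (-ε) := by
    intro c hc q _ β h
    have := mul_le_mul_of_nonneg_left (hqle q) hc.le
    linarith
  by_cases hex : ∃ (q : ℕ) (_ : NeZero q) (χ : DirichletCharacter ℂ q) (β : ℝ),
      χ ≠ 1 ∧ χ ^ 2 = 1 ∧ LFunction χ β = 0 ∧ 1 - δ < β
  swap
  · refine ⟨δ, hδ0, fun q _ χ β h1 h2 h3 => htriv δ hδ0 q β ?_⟩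
    by_contra h
    exact hex ⟨q, inferInstance, χ, β, h1, h2, h3, by linarith⟩
  obtain ⟨q1, _, χ1, β1, hχ1, hχ12, hz1, hβ1⟩ := hex
  have hβ1lt := hβlt q1 χ1 β1 hχ1 hz1
  -- zeros of χ1 itself
  obtain ⟨d, hd, hball⟩ := Metric.eventually_nhds_iff.1
    ((differentiable_LFunction hχ1).continuous.continuousAt.eventually_ne (x := 1)
      (LFunction_ne_zero_of_one_le_re χ1 (Or.inl hχ1) (s := 1) (by simp)))
  set c1 : ℝ := (1 - β1) / 500 * (10000 * (q1:ℝ)) ^ (-(16 * δ)) * δ ^ 4 / (16 * (q1:ℝ) ^ (3 * δ)) with hc1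
  have hq1 := one_le_q (q := q1)
  have hq1p : (0:ℝ) < q1 := by linarith
  have hc1p : 0 < c1 := by
    have : 0 < 1 - β1 := by linarith
    rw [hc1]; positivity
  refine ⟨min (min (d / 2) (δ / 4)) c1, by positivity, ?_⟩
  intro q _ χ β hχ hχ2 hz
  have hβ := hβlt q χ β hχ hz
  have hq0 := one_le_q (q := q)
  have hqp : (0:ℝ) < q := by linarith
  by_cases hclose : β ≤ 1 - min (d / 2) (δ / 4)
  · refine htriv _ (by positivity) q β (hclose.trans ?_)
    have := min_le_left (min (d / 2) (δ / 4)) c1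
    linarith
  push Not at hclose
  have hcl1 : 1 - d / 2 < β := by have := min_le_left (d / 2) (δ / 4); linarith
  have hcl2 : 1 - δ / 4 < β := by have := min_le_right (d / 2) (δ / 4); linarith
  set χ' := changeLevel (Nat.dvd_mul_right q q1) χ with hχ'
  set ψ := changeLevel (Nat.dvd_mul_left q1 q) χ1 with hψ
  have hχ'ne : χ' ≠ 1 := hχ ∘ (changeLevel_eq_one_iff _).mp
  have hψne : ψ ≠ 1 := hχ1 ∘ (changeLevel_eq_one_iff _).mp
  have hχ'2 : χ' ^ 2 = 1 := by rw [hχ', ← map_pow, hχ2, map_one]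
  have hψ2 : ψ ^ 2 = 1 := by rw [hψ, ← map_pow, hχ12, map_one]
  have hzχ' : LFunction χ' β = 0 := by
    rw [hχ', LFunction_changeLevel _ _ (Or.inl hχ), hz, zero_mul]
  have hzψ : LFunction ψ β1 = 0 := by
    rw [hψ, LFunction_changeLevel _ _ (Or.inl hχ1), hz1, zero_mul]
  have hne : ψ * χ' ≠ 1 := by
    intro h
    have hEq : χ' = ψ := by
      have : ψ * ψ = 1 := by rw [← sq, hψ2]
      calc χ' = ψ * ψ * χ' := by rw [this, one_mul]
        _ = ψ * (ψ * χ') := by rw [mul_assoc]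
        _ = ψ := by rw [h, mul_one]
    rw [hEq, hψ, LFunction_changeLevel _ _ (Or.inl hχ1)] at hzχ'
    rcases mul_eq_zero.1 hzχ' with h0 | h0
    · refine hball (y := (β : ℂ)) ?_ h0
      rw [dist_eq_norm, ← ofReal_one, ← ofReal_sub, norm_real, Real.norm_eq_abs, abs_sub_comm, abs_of_pos (by linarith)]
      linarith
    · exact eulerfac_ne_zero (s := β) (by simp; linarith) (χ := fun p => χ1 p) (fun p => χ1.norm_le_one _)
        (q * q1).primeFactors (fun p hp => Nat.prime_of_mem_primeFactors hp) h0
  have hlow := siegel_lower hψ2 hχ'2 hψne hχ'ne hne hδ8 hβ1.le hβ1lt hzψ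
  have hu1 := siegel_upper hψne hδ0 hδ8
  have hu3 := siegel_upper hne hδ0 hδ8
  have hu2 := siegel_upper' hχ'ne hδ0 hδ8 hcl2.le hβ hzχ'
  have hβ0 : 0 < 1 - β := by linarith
  set N : ℝ := ((q * q1 : ℕ) : ℝ) with hN
  have hNe : N = q * q1 := by rw [hN]; push_cast; rfl
  have hN0 : 0 < N := by rw [hNe]; positivity
  have hcomb : (1 - β1) / 500 * (10000 * N) ^ (-(16 * δ)) ≤ N ^ δ / δ * (16 * N ^ δ / δ ^ 2 * (1 - β)) * (N ^ δ / δ) :=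
    hlow.trans (by gcongr)
  have e1 : N ^ δ / δ * (16 * N ^ δ / δ ^ 2 * (1 - β)) * (N ^ δ / δ) = 16 * N ^ (3 * δ) / δ ^ 4 * (1 - β) := by
    have : N ^ (3 * δ) = N ^ δ * N ^ δ * N ^ δ := by
      rw [← Real.rpow_add hN0, ← Real.rpow_add hN0]; congr 1; ring
    rw [this]; field_simp
  have e2 : (10000 * N) ^ (-(16 * δ)) = (10000 * (q1:ℝ)) ^ (-(16 * δ)) * (q:ℝ) ^ (-(16 * δ)) := by
    rw [← Real.mul_rpow (by positivity) (by positivity), hNe]; congr 1; ring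
  have e3 : N ^ (3 * δ) = (q:ℝ) ^ (3 * δ) * (q1:ℝ) ^ (3 * δ) := by
    rw [hNe, Real.mul_rpow (by positivity) (by positivity)]
  have e4 : (q:ℝ) ^ (-ε) = (q:ℝ) ^ (-(16 * δ)) / (q:ℝ) ^ (3 * δ) := by
    rw [← Real.rpow_sub hqp]; congr 1; rw [hδ]; ring
  rw [e1, e2, e3] at hcomb
  have hfin : c1 * (q:ℝ) ^ (-ε) ≤ 1 - β := by
    rw [e4, hc1]
    have hA : 0 < (q:ℝ) ^ (3 * δ) := by positivity
    have hB : 0 < (q1:ℝ) ^ (3 * δ) := by positivity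
    have hC : 0 < 16 * ((q:ℝ) ^ (3 * δ) * (q1:ℝ) ^ (3 * δ)) / δ ^ 4 := by positivity
    rw [← div_le_iff₀' hC] at hcomb
    refine le_trans (le_of_eq ?_) hcomb
    field_simp
  have hmin : min (min (d / 2) (δ / 4)) c1 * (q:ℝ) ^ (-ε) ≤ c1 * (q:ℝ) ^ (-ε) := by
    gcongr; exact min_le_right _ _
  linarith

end SW


open MeasureTheory Finset

namespace SW

open Complex Metric Filter Topology DirichletCharacter

theorem no_zero {B : ℝ} (hB : 1 ≤ B) : ∃ c > 0, c ≤ 1 ∧ ∃ ℓ₀ : ℝ, 1 ≤ ℓ₀ ∧ ∀ ℓ : ℝ, ℓ₀ ≤ ℓ → ∀ (q : ℕ) [NeZero q]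
    (χ : DirichletCharacter ℂ q) (ρ : ℂ), (q:ℝ) ≤ ℓ ^ B → |ρ.im| ≤ Real.exp (2 * ℓ) → 1 - c / ℓ < ρ.re →
    (q:ℝ) ≤ Real.exp ℓ ∧ FF χ ρ ≠ 0 := by
  obtain ⟨κ, hκ, ℒ₀, hℒ₀, hzf⟩ := zero_free
  have hB0 : 0 < B := by linarith
  obtain ⟨cs, hcs, hsg⟩ := siegel (ε := 1 / B) (by positivity) (by rw [div_le_one hB0]; exact hB)
  have hev : ∀ᶠ ℓ : ℝ in atTop, ℓ ^ B ≤ Real.exp ℓ := by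
    have := (isLittleO_rpow_exp_atTop B).bound one_pos
    filter_upwards [this, eventually_ge_atTop 0] with ℓ h h0
    rw [one_mul, Real.norm_of_nonneg (by positivity), Real.norm_of_nonneg (Real.exp_pos _).le] at h
    exact h
  obtain ⟨ℓ₁, hℓ₁⟩ := eventually_atTop.1 hev
  refine ⟨min 1 (min (κ / 2) cs), by positivity, min_le_left _ _, max ℒ₀ ℓ₁, le_max_of_le_left hℒ₀, ?_⟩
  intro ℓ hℓ q _ χ ρ hq him hre
  have h1 : ℒ₀ ≤ ℓ := le_of_max_le_left hℓ
  have hℓ0 : 0 < ℓ := by linarith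
  have h2 : ℓ ^ B ≤ Real.exp ℓ := hℓ₁ ℓ (le_of_max_le_right hℓ)
  refine ⟨hq.trans h2, fun hz => ?_⟩
  have hc2 : min 1 (min (κ / 2) cs) / ℓ ≤ κ / (2 * ℓ) := by
    rw [← div_div]
    gcongr; exact (min_le_right _ _).trans (min_le_left _ _)
  have hc3 : min 1 (min (κ / 2) cs) / ℓ ≤ cs / ℓ := by
    gcongr; exact (min_le_right _ _).trans (min_le_right _ _)
  obtain ⟨hne, hsq, him0⟩ := hzf (2 * ℓ) (by linarith) q χ ρ
    ((hq.trans h2).trans (by gcongr; linarith)) hz him (by linarith)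
  have hρ : ρ = (ρ.re : ℂ) := by apply Complex.ext <;> simp [him0]
  rw [FF_ne hne, hρ] at hz
  have := hsg q χ ρ.re hne hsq hz
  have hq1 := one_le_q (q := q)
  have hqe : 1 / ℓ ≤ (q:ℝ) ^ (-(1 / B)) := by
    rw [Real.rpow_neg (by linarith), one_div]
    have hqp : (q:ℝ) ^ (1 / B) ≤ ℓ := by
      calc (q:ℝ) ^ (1 / B) ≤ (ℓ ^ B) ^ (1 / B) := by gcongr
        _ = ℓ := by rw [← Real.rpow_mul hℓ0.le, mul_one_div_cancel hB0.ne', Real.rpow_one]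
    gcongr
  have h5 := mul_le_mul_of_nonneg_left hqe hcs.le
  rw [mul_one_div] at h5
  linarith

theorem logder {B : ℝ} (hB : 1 ≤ B) : ∃ c > 0, c ≤ 1 / 8 ∧ ∃ C > 0, ∃ ℓ₀ : ℝ, 1 ≤ ℓ₀ ∧ ∀ ℓ : ℝ, ℓ₀ ≤ ℓ → ∀ (q : ℕ) [NeZero q]
    (χ : DirichletCharacter ℂ q) (s : ℂ), (q:ℝ) ≤ ℓ ^ B → |s.im| ≤ Real.exp ℓ → |s.re - 1| ≤ c / ℓ →
    FF χ s ≠ 0 ∧ ‖deriv (FF χ) s / FF χ s‖ ≤ C * ℓ ^ 2 := by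
  obtain ⟨c, hc, hc1, ℓ₀, hℓ₀, hnz⟩ := no_zero hB
  have hev : ∀ᶠ ℓ : ℝ in atTop, 1280 / c ^ 2 * ℓ ^ (2:ℝ) ≤ Real.exp ℓ := by
    have := (isLittleO_rpow_exp_atTop 2).bound (c := (1280 / c ^ 2)⁻¹) (by positivity)
    filter_upwards [this, eventually_ge_atTop 0] with ℓ h h0
    rw [Real.norm_of_nonneg (by positivity), Real.norm_of_nonneg (Real.exp_pos _).le] at h
    rwa [← le_inv_mul_iff₀ (by positivity)]
  obtain ⟨ℓ₁, hℓ₁⟩ := eventually_atTop.1 hev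
  refine ⟨c / 8, by positivity, by linarith, 240 / c, by positivity, max (max ℓ₀ ℓ₁) 4, le_max_of_le_right (by norm_num), ?_⟩
  intro ℓ hℓ q _ χ s hq him hre
  have h0 : ℓ₀ ≤ ℓ := le_of_max_le_left (le_of_max_le_left hℓ)
  have h1 := hℓ₁ ℓ (le_of_max_le_right (le_of_max_le_left hℓ))
  have h4 : 4 ≤ ℓ := le_of_max_le_right hℓ
  have hℓ0 : 0 < ℓ := by linarith
  obtain ⟨η, hη⟩ : ∃ η : ℝ, η = c / 8 / ℓ := ⟨_, rfl⟩
  have hη0 : 0 < η := by rw [hη]; positivity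
  have hη8 : c / ℓ = 8 * η := by rw [hη]; field_simp
  have hη1 : η ≤ 1 / 8 := by
    rw [hη, div_le_iff₀ hℓ0]; nlinarith
  rw [← hη] at hre
  have hre' := abs_le.1 hre
  have hexp : 4 + Real.exp ℓ ≤ Real.exp (2 * ℓ) := by
    have : 4 ≤ Real.exp ℓ := by have := Real.add_one_le_exp ℓ; linarith
    rw [two_mul, Real.exp_add]; nlinarith
  set w : ℂ := ((1 + η : ℝ) : ℂ) + (s.im : ℂ) * I with hw
  have hwre : w.re = 1 + η := by simp [hw]
  have hwim : w.im = s.im := by simp [hw]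
  have hball : ∀ z ∈ ball w (8 * η), 1 - 8 * η < z.re ∧ ‖z‖ ≤ 3 + Real.exp ℓ ∧ |z.im| ≤ Real.exp (2 * ℓ) := by
    intro z hz
    have hz' : ‖z - w‖ < 8 * η := by rwa [mem_ball, dist_eq_norm] at hz
    have hr := abs_lt.1 ((abs_re_le_norm (z - w)).trans_lt hz')
    have hi := (abs_im_le_norm (z - w)).trans_lt hz'
    rw [sub_re, hwre] at hr
    rw [sub_im, hwim] at hi
    have him2 : |z.im| ≤ 1 + Real.exp ℓ := by
      calc |z.im| = |(z.im - s.im) + s.im| := by ring_nf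
        _ ≤ |z.im - s.im| + |s.im| := abs_add_le _ _
        _ ≤ _ := by linarith
    refine ⟨by linarith [hr.1], ?_, by linarith⟩
    refine (Complex.norm_le_abs_re_add_abs_im z).trans ?_
    have : |z.re| ≤ 2 + 1/8 := abs_le.2 ⟨by linarith, by linarith⟩
    have h8 : |z.im| ≤ 1/8 + 7/8 + Real.exp ℓ := by linarith
    by_cases hsm : z.re ≤ 2
    · have : |z.re| ≤ 2 := abs_le.2 ⟨by linarith, hsm⟩
      linarith
    · push Not at hsm
      have hi2 : |z.im| ≤ 7/8 + Real.exp ℓ := by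
        -- use the disc
        have hsq : (z.re - w.re) ^ 2 + (z.im - w.im) ^ 2 < 1 := by
          have h9 : ‖z - w‖ < 1 := by linarith
          have h10 : normSq (z - w) = (z.re - w.re) ^ 2 + (z.im - w.im) ^ 2 := by
            rw [normSq_apply, sub_re, sub_im]; ring
          rw [← h10, ← Complex.sq_norm]
          have := norm_nonneg (z - w); nlinarith
        rw [hwre, hwim] at hsq
        have h11 : (z.im - s.im) ^ 2 ≤ (7/8) ^ 2 := by nlinarith
        have h12 : |z.im - s.im| ≤ 7 / 8 := abs_le_of_sq_le_sq h11 (by norm_num)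
        calc |z.im| = |(z.im - s.im) + s.im| := by ring_nf
          _ ≤ |z.im - s.im| + |s.im| := abs_add_le _ _
          _ ≤ _ := by linarith
      linarith
  have hqe : (q:ℝ) ≤ Real.exp ℓ := (hnz ℓ h0 q χ w hq (by rw [hwim]; linarith) (by rw [hwre, hη8]; linarith)).1
  have hlow : η ^ 2 / 4 ≤ ‖FF χ w‖ := by
    have := FF_lower χ (s := w) (by rw [hwre]; linarith) (by rw [hwre]; linarith)
    rw [hwre] at this; simpa using this
  have hgrow : ∀ z ∈ ball w (8 * η), ‖FF χ z‖ ≤ Real.exp (6 * ℓ) * ‖FF χ w‖ := by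
    intro z hz
    by_cases hhalf : 1 / 2 ≤ z.re
    · have := FF_growth χ hhalf
      obtain ⟨_, h3, _⟩ := hball z hz
      have hn := norm_nonneg z
      have h20 : 20 / η ^ 2 ≤ Real.exp ℓ := by
        refine le_trans (le_of_eq ?_) h1
        rw [hη, Real.rpow_two]; field_simp; norm_num
      rw [div_le_iff₀ (by positivity)] at h20
      have hq0 := one_le_q (q := q)
      calc ‖FF χ z‖ ≤ 5 * q * (1 + ‖z‖) ^ 2 := this
        _ ≤ 5 * Real.exp ℓ * (Real.exp (2 * ℓ)) ^ 2 := by gcongr; linarith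
        _ ≤ Real.exp (6 * ℓ) * (η ^ 2 / 4) := by
            have e1 : Real.exp (6 * ℓ) = Real.exp ℓ * (Real.exp ℓ * (Real.exp (2 * ℓ)) ^ 2) := by
              rw [← Real.exp_nat_mul, ← Real.exp_add, ← Real.exp_add]; congr 1; push_cast; ring
            rw [e1]
            have hp : 0 < Real.exp ℓ * (Real.exp (2 * ℓ)) ^ 2 := by positivity
            nlinarith
        _ ≤ _ := by gcongr
    · exfalso
      have := (hball z hz).1
      have hη16 : η ≤ 1 / 32 := by
        rw [hη, div_le_iff₀ hℓ0]; nlinarith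
      linarith
  have hnzball : ∀ z ∈ ball w (8 * η), FF χ z ≠ 0 := by
    intro z hz
    obtain ⟨h2, _, h3⟩ := hball z hz
    exact (hnz ℓ h0 q χ z hq h3 (by rw [hη8]; exact h2)).2
  have hdist : dist s w ≤ 2 * η := by
    rw [dist_eq_norm]
    have : s - w = ((s.re - 1 - η : ℝ) : ℂ) := by
      apply Complex.ext <;> simp [hw]; ring
    rw [this, norm_real, Real.norm_eq_abs]
    exact abs_le.2 ⟨by linarith, by linarith⟩
  refine ⟨hnzball s (by rw [mem_ball]; linarith), ?_⟩
  have := logDeriv_bound (f := FF χ) (c := w) (R := 8 * η) (M := 6 * ℓ) (by positivity) (by positivity)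
    (FF_diff χ).differentiableOn hnzball hgrow (z := s) (by linarith)
  refine this.trans (le_of_eq ?_)
  rw [hη]; field_simp; norm_num

end SW


open MeasureTheory Finset

namespace SW

open Complex Metric Filter Topology DirichletCharacter

/-- the kernel 1/(s(s+1)) on a vertical line -/
theorem ker_bound {σ : ℝ} (hσ : 1 ≤ σ) (t : ℝ) :
    ‖(1:ℂ) / (((σ:ℂ) + t * I) * ((σ:ℂ) + t * I + 1))‖ ≤ (1 + t ^ 2)⁻¹ := by
  have h1 : 1 + t^2 ≤ ‖(σ:ℂ) + t * I‖ ^ 2 := by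
    rw [Complex.sq_norm, Complex.normSq_add_mul_I]; nlinarith
  have h2 : ‖(σ:ℂ) + t * I‖ ^ 2 ≤ ‖(σ:ℂ) + t * I + 1‖ ^ 2 := by
    have : (σ:ℂ) + t * I + 1 = ((σ + 1 : ℝ):ℂ) + t * I := by push_cast; ring
    rw [this, Complex.sq_norm, Complex.normSq_add_mul_I, Complex.sq_norm, Complex.normSq_add_mul_I]; nlinarith
  have h3 : ‖(σ:ℂ) + t * I‖ ≤ ‖(σ:ℂ) + t * I + 1‖ := by
    exact (pow_le_pow_iff_left₀ (norm_nonneg _) (norm_nonneg _) two_ne_zero).1 h2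
  rw [norm_div, norm_one, norm_mul, one_div]
  apply inv_anti₀ (by positivity)
  calc 1 + t^2 ≤ ‖(σ:ℂ) + t * I‖ * ‖(σ:ℂ) + t * I‖ := by rw [← sq]; exact h1
    _ ≤ _ := by gcongr

theorem ker_cont {σ : ℝ} (hσ : 1 ≤ σ) :
    Continuous (fun t : ℝ => (1:ℂ) / (((σ:ℂ) + t * I) * ((σ:ℂ) + t * I + 1))) := by
  apply Continuous.div continuous_const (by fun_prop)
  intro t h
  rcases mul_eq_zero.1 h with h | h
  · have := congrArg Complex.re h; simp at this; linarith
  · have := congrArg Complex.re h; simp at this; linarith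

theorem ker_int {σ : ℝ} (hσ : 1 ≤ σ) :
    Integrable (fun t : ℝ => (1:ℂ) / (((σ:ℂ) + t * I) * ((σ:ℂ) + t * I + 1))) := by
  refine Integrable.mono' integrable_inv_one_add_sq (ker_cont hσ).aestronglyMeasurable ?_
  exact Eventually.of_forall (fun t => ker_bound hσ t)

noncomputable def ker (u : ℝ) : ℂ := (Set.Ioc 0 1).indicator (fun _ => (1:ℂ)) u - (Set.Ioc 0 1).indicator (fun t : ℝ => (t:ℂ) ^ (1:ℂ)) u

theorem ker_eq {u : ℝ} (hu : 0 < u) : ker u = ((max 0 (1 - u) : ℝ) : ℂ) := by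
  unfold ker
  by_cases h : u ≤ 1
  · have : u ∈ Set.Ioc (0:ℝ) 1 := ⟨hu, h⟩
    rw [Set.indicator_of_mem this, Set.indicator_of_mem this, max_eq_right (by linarith)]
    simp
  · have : u ∉ Set.Ioc (0:ℝ) 1 := fun h' => h h'.2
    rw [Set.indicator_of_notMem this, Set.indicator_of_notMem this, max_eq_left (by linarith)]
    simp

theorem ker_mellin {s : ℂ} (hs : 0 < s.re) : HasMellin ker s (1 / (s * (s + 1))) := by
  have h1 := hasMellin_one_Ioc hs
  have h2 := hasMellin_cpow_Ioc (1:ℂ) (s := s) (by simp; linarith)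
  have h3 := hasMellin_sub h1.1 h2.1
  rw [h1.2, h2.2] at h3
  have hs0 : s ≠ 0 := by rintro rfl; simp at hs
  have hs1 : s + 1 ≠ 0 := by
    intro h; have := congrArg Complex.re h; simp at this; linarith
  have : 1 / s - 1 / (s + 1) = 1 / (s * (s + 1)) := by field_simp; ring
  rw [this] at h3
  exact h3

theorem perron_one {σ : ℝ} (hσ : 1 ≤ σ) {u : ℝ} (hu : 0 < u) :
    (1 / (2 * Real.pi) : ℝ) • ∫ t : ℝ, (u:ℂ) ^ (-((σ:ℂ) + t * I)) * (1 / (((σ:ℂ) + t * I) * ((σ:ℂ) + t * I + 1)))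
      = ((max 0 (1 - u) : ℝ) : ℂ) := by
  have hm : ∀ t : ℝ, mellin ker ((σ:ℂ) + t * I) = 1 / (((σ:ℂ) + t * I) * ((σ:ℂ) + t * I + 1)) := by
    intro t
    refine (ker_mellin ?_).2
    simp; linarith
  have h := mellinInv_mellin_eq σ ker hu (ker_mellin (by simp; linarith)).1 ?_ ?_
  · rw [ker_eq hu] at h
    rw [← h, mellinInv]
    simp only [hm, smul_eq_mul]
  · unfold VerticalIntegrable
    simp only [hm]
    exact ker_int hσ
  · have : ContinuousAt (fun u : ℝ => ((max 0 (1 - u) : ℝ) : ℂ)) u := by fun_prop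
    refine this.congr ?_
    filter_upwards [lt_mem_nhds hu] with y hy
    exact (ker_eq hy).symm

theorem perron (a : ℕ → ℂ) {σ : ℝ} (hσ : 1 ≤ σ) (ha : LSeriesSummable a σ) {x : ℝ} (hx : 0 < x) :
    ∑ n ∈ Icc 1 ⌊x⌋₊, a n * ((1 - n / x : ℝ) : ℂ) =
    (1 / (2 * Real.pi) : ℝ) • ∫ t : ℝ, LSeries a ((σ:ℂ) + t * I) * (x:ℂ) ^ ((σ:ℂ) + t * I) * (1 / (((σ:ℂ) + t * I) * ((σ:ℂ) + t * I + 1))) := by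
  set K : ℝ → ℂ := fun t => (1 / (((σ:ℂ) + t * I) * ((σ:ℂ) + t * I + 1))) with hK
  have hre : ∀ t : ℝ, ((σ:ℂ) + t * I).re = σ := by intro t; simp
  have hterm : ∀ n : ℕ, ∀ t : ℝ, ‖LSeries.term a ((σ:ℂ) + t * I) n‖ = ‖LSeries.term a (σ:ℂ) n‖ := by
    intro n t
    rw [LSeries.norm_term_eq, LSeries.norm_term_eq, hre]; simp
  have hcont : ∀ n : ℕ, Continuous (fun t : ℝ => LSeries.term a ((σ:ℂ) + t * I) n) := by
    intro n
    by_cases hn : n = 0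
    · subst hn; simp only [LSeries.term_zero]; exact continuous_const
    · simp only [LSeries.term_of_ne_zero hn]
      have hn' : (n:ℂ) ≠ 0 := by exact_mod_cast hn
      apply Continuous.div continuous_const
      · exact Continuous.const_cpow (by fun_prop) (Or.inl hn')
      · intro t; simp [Complex.cpow_eq_zero_iff, hn]
  have hxn : ∀ t : ℝ, ‖(x:ℂ) ^ ((σ:ℂ) + t * I)‖ = x ^ σ := by
    intro t; rw [Complex.norm_cpow_eq_rpow_re_of_pos hx, hre]
  have hxc : Continuous (fun t : ℝ => (x:ℂ) ^ ((σ:ℂ) + t * I)) :=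
    Continuous.const_cpow (by fun_prop) (Or.inl (by exact_mod_cast hx.ne'))
  set F : ℕ → ℝ → ℂ := fun n t => LSeries.term a ((σ:ℂ) + t * I) n * (x:ℂ) ^ ((σ:ℂ) + t * I) * K t with hF
  have hFn : ∀ n t, ‖F n t‖ = ‖LSeries.term a (σ:ℂ) n‖ * x ^ σ * ‖K t‖ := by
    intro n t; simp only [hF]; rw [norm_mul, norm_mul, hterm, hxn]
  have hFi : ∀ n, Integrable (F n) := by
    intro n
    refine Integrable.mono ((ker_int hσ).norm.const_mul (‖LSeries.term a (σ:ℂ) n‖ * x ^ σ)) ?_ ?_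
    · exact (((hcont n).mul hxc).mul (ker_cont hσ)).aestronglyMeasurable
    · refine Eventually.of_forall (fun t => ?_)
      rw [hFn, Real.norm_of_nonneg (by positivity)]
  have hsum := hasSum_integral_of_summable_integral_norm hFi (by
    simp only [hFn, integral_const_mul]
    exact (ha.norm.mul_right _).mul_right _)
  have htsum : ∀ t : ℝ, ∑' n, F n t = LSeries a ((σ:ℂ) + t * I) * (x:ℂ) ^ ((σ:ℂ) + t * I) * K t := by
    intro t
    simp only [hF]
    rw [tsum_mul_right, tsum_mul_right]; rfl
  simp only [htsum] at hsum
  have hval : ∀ n, (1 / (2 * Real.pi) : ℝ) • ∫ t, F n t = if n ∈ Icc 1 ⌊x⌋₊ then a n * ((1 - n / x : ℝ) : ℂ) else 0 := by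
    intro n
    by_cases hn : n = 0
    · subst hn; simp [hF]
    have hn0 : (0:ℝ) < n := by exact_mod_cast Nat.pos_of_ne_zero hn
    have h := perron_one hσ (div_pos hn0 hx)
    have hFF : ∀ t : ℝ, F n t = a n * ((((n / x : ℝ)):ℂ) ^ (-((σ:ℂ) + t * I)) * K t) := by
      intro t
      simp only [hF]
      rw [LSeries.term_of_ne_zero hn, Complex.ofReal_div, Complex.div_cpow_ofReal_nonneg hn0.le hx.le, Complex.cpow_neg, Complex.cpow_neg]
      simp only [Complex.ofReal_natCast]
      field_simp
    simp only [hFF]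
    rw [integral_const_mul, ← mul_smul_comm, h]
    split_ifs with hmem
    · rw [mem_Icc, Nat.le_floor_iff hx.le] at hmem
      rw [max_eq_right]
      have : (n:ℝ) / x ≤ 1 := by rw [div_le_one hx]; exact hmem.2
      linarith
    · rw [mem_Icc, Nat.le_floor_iff hx.le] at hmem
      have : ¬ (n:ℝ) ≤ x := fun h => hmem ⟨Nat.pos_of_ne_zero hn, h⟩
      rw [max_eq_left]
      · simp
      have : 1 ≤ (n:ℝ) / x := by rw [le_div_iff₀ hx]; linarith
      linarith
  have hs2 := hsum.const_smul (1 / (2 * Real.pi) : ℝ)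
  simp only [hval] at hs2
  have hs3 : HasSum (fun n => if n ∈ Icc 1 ⌊x⌋₊ then a n * ((1 - n / x : ℝ) : ℂ) else 0)
      (∑ n ∈ Icc 1 ⌊x⌋₊, if n ∈ Icc 1 ⌊x⌋₊ then a n * ((1 - n / x : ℝ) : ℂ) else 0) :=
    hasSum_sum_of_ne_finset_zero (by intro b hb; simp only [if_neg hb])
  rw [hs2.unique hs3]
  exact (Finset.sum_congr rfl (fun n hn => by rw [if_pos hn]))

end SW


open MeasureTheory Finset

namespace SW

open Complex Metric Filter Topology DirichletCharacter

theorem rect_shift {G : ℂ → ℂ} {σ₀ σ₁ T Mh Ml : ℝ} (hσ : σ₀ ≤ σ₁) (hT : 0 ≤ T)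
    (hG : ∀ s : ℂ, σ₀ ≤ s.re → s.re ≤ σ₁ → |s.im| ≤ T → DifferentiableAt ℂ G s)
    (hh : ∀ s : ℂ, σ₀ ≤ s.re → s.re ≤ σ₁ → |s.im| = T → ‖G s‖ ≤ Mh)
    (hl : ∀ s : ℂ, s.re = σ₀ → |s.im| ≤ T → ‖G s‖ ≤ Ml) :
    ‖∫ t in (-T)..T, G ((σ₁:ℂ) + t * I)‖ ≤ 2 * (σ₁ - σ₀) * Mh + 2 * T * Ml := by
  have h := Complex.integral_boundary_rect_eq_zero_of_differentiableOn G ((σ₀:ℂ) + ((-T:ℝ):ℂ) * I) ((σ₁:ℂ) + (T:ℂ) * I) (by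
    intro s hs
    refine (hG s ?_ ?_ ?_).differentiableWithinAt
    · have := hs.1; simp [Set.uIcc_of_le hσ] at this; exact this.1
    · have := hs.1; simp [Set.uIcc_of_le hσ] at this; exact this.2
    · have := hs.2; simp [Set.uIcc_of_le (show -T ≤ T by linarith)] at this; exact abs_le.2 this)
  have e1 : ((σ₀:ℂ) + ((-T:ℝ):ℂ) * I).re = σ₀ := by simp
  have e2 : ((σ₀:ℂ) + ((-T:ℝ):ℂ) * I).im = -T := by simp
  have e3 : ((σ₁:ℂ) + (T:ℂ) * I).re = σ₁ := by simp
  have e4 : ((σ₁:ℂ) + (T:ℂ) * I).im = T := by simp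
  rw [e1, e2, e3, e4] at h
  have b1 : ‖∫ x in σ₀..σ₁, G ((x:ℂ) + ((-T:ℝ):ℂ) * I)‖ ≤ Mh * |σ₁ - σ₀| := by
    apply intervalIntegral.norm_integral_le_of_norm_le_const
    intro x hx
    rw [Set.uIoc_of_le hσ] at hx
    apply hh <;> simp [hx.1.le, hx.2, abs_of_nonneg hT]
  have b2 : ‖∫ x in σ₀..σ₁, G ((x:ℂ) + (T:ℂ) * I)‖ ≤ Mh * |σ₁ - σ₀| := by
    apply intervalIntegral.norm_integral_le_of_norm_le_const
    intro x hx
    rw [Set.uIoc_of_le hσ] at hx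
    apply hh <;> simp [hx.1.le, hx.2, abs_of_nonneg hT]
  have b3 : ‖∫ y in (-T)..T, G ((σ₀:ℂ) + (y:ℂ) * I)‖ ≤ Ml * |T - -T| := by
    apply intervalIntegral.norm_integral_le_of_norm_le_const
    intro x hx
    rw [Set.uIoc_of_le (by linarith)] at hx
    apply hl
    · simp
    · simp only [add_im, ofReal_im, mul_im, ofReal_re, I_im, mul_one, I_re, mul_zero, add_zero, zero_add]
      exact abs_le.2 ⟨hx.1.le, hx.2⟩
  rw [abs_of_nonneg (by linarith)] at b1 b2 b3
  set X1 := ∫ x in σ₀..σ₁, G ((x:ℂ) + ((-T:ℝ):ℂ) * I)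
  set X2 := ∫ x in σ₀..σ₁, G ((x:ℂ) + (T:ℂ) * I)
  set X3 := ∫ y in (-T)..T, G ((σ₀:ℂ) + (y:ℂ) * I)
  set X4 := ∫ t in (-T)..T, G ((σ₁:ℂ) + t * I)
  have hX : I * X4 = X2 - X1 + I * X3 := by
    simp only [smul_eq_mul] at h
    linear_combination h
  have hn : ‖X4‖ = ‖I * X4‖ := by simp
  rw [hn, hX]
  calc _ ≤ ‖X2 - X1‖ + ‖I * X3‖ := norm_add_le _ _
    _ ≤ ‖X2‖ + ‖X1‖ + ‖X3‖ := by gcongr; exact norm_sub_le _ _; simp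
    _ ≤ _ := by linarith

theorem tail_bound {g : ℝ → ℂ} {M T : ℝ} (hT : 0 < T) (hM : 0 ≤ M) (hg : Integrable g)
    (hb : ∀ t, ‖g t‖ ≤ M * (1 + t^2)⁻¹) :
    ‖∫ t, g t‖ ≤ ‖∫ t in (-T)..T, g t‖ + 2 * (M / T) := by
  have hI : ∀ u : ℝ → ℂ, (∀ t, ‖u t‖ ≤ M * (1 + t^2)⁻¹) → ‖∫ t in Set.Ioi T, u t‖ ≤ M / T := by
    intro u hu
    have hval : ∫ t in Set.Ioi T, M * t ^ (-2:ℝ) = M / T := by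
      rw [integral_const_mul, integral_Ioi_rpow_of_lt (by norm_num) hT]
      norm_num [Real.rpow_neg_one]; rfl
    rw [← hval]
    apply norm_integral_le_of_norm_le
    · exact (integrableOn_Ioi_rpow_of_lt (by norm_num) hT).const_mul M
    · refine (ae_restrict_iff' measurableSet_Ioi).2 (Eventually.of_forall (fun t ht => ?_))
      have ht0 : 0 < t := lt_trans hT ht
      refine (hu t).trans ?_
      rw [Real.rpow_neg ht0.le, Real.rpow_two]
      gcongr
      linarith
  have h1 : ∫ t, g t = (∫ t in Set.Iic (-T), g t) + ((∫ t in (-T)..T, g t) + ∫ t in Set.Ioi T, g t) := by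
    rw [intervalIntegral.integral_interval_add_Ioi hg.integrableOn hg.integrableOn,
      intervalIntegral.integral_Iic_add_Ioi hg.integrableOn hg.integrableOn]
  have h2 : ∫ t in Set.Iic (-T), g t = ∫ t in Set.Ioi T, g (-t) := by rw [integral_comp_neg_Ioi]
  rw [h1, h2]
  have b1 := hI (fun t => g (-t)) (fun t => by simpa using hb (-t))
  have b2 := hI g hb
  calc _ ≤ ‖∫ t in Set.Ioi T, g (-t)‖ + (‖∫ t in (-T)..T, g t‖ + ‖∫ t in Set.Ioi T, g t‖) :=
        (norm_add_le _ _).trans (by gcongr; exact norm_add_le _ _)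
    _ ≤ _ := by linarith

/-- crude bound on the line just right of one -/
theorem right_line {a : ℕ → ℂ} {ℓ : ℝ} (hℓ : 1 ≤ ℓ) (ha : ∀ n : ℕ, ‖a n‖ ≤ ArithmeticFunction.vonMangoldt n + 1)
    {s : ℂ} (hs : s.re = 1 + 1 / ℓ^2) : LSeriesSummable a s ∧ ‖LSeries a s‖ ≤ 12 * ℓ^4 := by
  have hℓ2 : 1 ≤ ℓ^2 := one_le_pow₀ hℓ
  set ε : ℝ := 1 / (2 * ℓ^2) with hε
  have hε0 : 0 < ε := by positivity
  have hterm : ∀ n : ℕ, ‖LSeries.term a s n‖ ≤ 3 * ℓ^2 * (1 / (n:ℝ)^(1 + ε)) := by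
    intro n
    by_cases hn : n = 0
    · subst hn; simp; positivity
    have hn0 : (0:ℝ) < n := by exact_mod_cast Nat.pos_of_ne_zero hn
    have hn1 : (1:ℝ) ≤ n := by exact_mod_cast Nat.pos_of_ne_zero hn
    rw [LSeries.norm_term_eq, if_neg hn, hs]
    have hsplit : (n:ℝ) ^ (1 + 1/ℓ^2) = n ^ (1 + ε) * n ^ ε := by
      rw [← Real.rpow_add hn0]; congr 1; rw [hε]; field_simp; ring
    have hlog : Real.log n ≤ n ^ ε / ε := Real.log_le_rpow_div hn0.le hε0
    have h1 : 1 ≤ (n:ℝ) ^ ε := Real.one_le_rpow hn1 hε0.le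
    have hL : ‖a n‖ ≤ 3 * ℓ^2 * n ^ ε := by
      have h2 : n ^ ε / ε = 2 * ℓ^2 * n ^ ε := by rw [hε]; field_simp
      have h3 := ArithmeticFunction.vonMangoldt_le_log (n := n)
      have h4 : 1 ≤ ℓ^2 * (n:ℝ) ^ ε := one_le_mul_of_one_le_of_one_le hℓ2 h1
      have := ha n
      linarith
    rw [hsplit, ← div_div, mul_one_div, div_right_comm]
    gcongr
    rw [div_le_iff₀ (by positivity)]
    exact hL
  have hsum : Summable (fun n : ℕ => 3 * ℓ^2 * (1 / (n:ℝ)^(1 + ε))) :=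
    (Real.summable_one_div_nat_rpow.2 (by linarith)).mul_left _
  refine ⟨Summable.of_norm_bounded hsum hterm, ?_⟩
  calc ‖LSeries a s‖ ≤ ∑' n : ℕ, 3 * ℓ^2 * (1 / (n:ℝ)^(1 + ε)) := tsum_of_norm_bounded hsum.hasSum hterm
    _ = 3 * ℓ^2 * ∑' n : ℕ, (1 / (n:ℝ)^(1 + ε)) := tsum_mul_left
    _ ≤ 3 * ℓ^2 * ((1 + ε) / (1 + ε - 1) + 1) := by gcongr; exact norm_zeta_real (by linarith)
    _ = 3 * ℓ^2 * (2 * ℓ^2 + 2) := by rw [hε]; field_simp; ring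
    _ ≤ _ := by nlinarith

end SW


open MeasureTheory Finset

namespace SW

open Complex Metric Filter Topology DirichletCharacter

noncomputable def DD {q : ℕ} [NeZero q] (χ : DirichletCharacter ℂ q) (s : ℂ) : ℂ :=
  -(deriv (FF χ) s / FF χ s) - dl χ * (1 + s * Hz s)

noncomputable def aa {q : ℕ} (χ : DirichletCharacter ℂ q) (n : ℕ) : ℂ :=
  χ n * (ArithmeticFunction.vonMangoldt n : ℂ) - dl χ

lemma dl_nonneg {q : ℕ} (χ : DirichletCharacter ℂ q) : 0 ≤ dl χ := by
  unfold dl; split_ifs <;> norm_num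

lemma dl_le {q : ℕ} (χ : DirichletCharacter ℂ q) : dl χ ≤ 1 := by
  unfold dl; split_ifs <;> norm_num

lemma aa_norm {q : ℕ} (χ : DirichletCharacter ℂ q) (n : ℕ) :
    ‖aa χ n‖ ≤ ArithmeticFunction.vonMangoldt n + 1 := by
  unfold aa
  refine (norm_sub_le _ _).trans ?_
  rw [norm_mul, Complex.norm_real, Complex.norm_real, Real.norm_of_nonneg (dl_nonneg χ),
    Real.norm_of_nonneg ArithmeticFunction.vonMangoldt_nonneg]
  have h1 := DirichletCharacter.norm_le_one χ (n : ZMod q)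
  have h2 := dl_le χ
  have h3 := ArithmeticFunction.vonMangoldt_nonneg (n := n)
  nlinarith

section
variable {q : ℕ} [NeZero q]

lemma aa_LSeries (χ : DirichletCharacter ℂ q) {s : ℂ} (hs : 1 < s.re) :
    LSeries (aa χ) s = DD χ s := by
  have h1 : LSeriesSummable ((fun n : ℕ => χ n) * fun n : ℕ => (ArithmeticFunction.vonMangoldt n : ℂ)) s :=
    LSeriesSummable_twist_vonMangoldt χ hs
  have h2 : LSeriesSummable (1 : ℕ → ℂ) s := LSeriesSummable_one_iff.2 hs
  have h3 : aa χ = ((fun n : ℕ => χ n) * fun n : ℕ => (ArithmeticFunction.vonMangoldt n : ℂ)) - (dl χ : ℂ) • (1 : ℕ → ℂ) := by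
    ext n; simp [aa]
  have hs1 : s ≠ 1 := by rintro rfl; simp at hs
  have hs1' : s - 1 ≠ 0 := sub_ne_zero.2 hs1
  rw [h3, LSeries_sub h1 (h2.smul _), LSeries_smul, LSeries_one_eq_riemannZeta hs, Hz_eq (by linarith) hs1]
  have := LL_eq χ hs
  unfold LL at this
  rw [this, DD]
  field_simp
  ring

lemma DD_diff (χ : DirichletCharacter ℂ q) {s : ℂ} (hs : 0 < s.re) (h : FF χ s ≠ 0) :
    DifferentiableAt ℂ (DD χ) s := by
  have h1 : DifferentiableAt ℂ (deriv (FF χ)) s :=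
    ((FF_diff χ).contDiff (n := 2)).differentiable_deriv_two s
  have h2 : DifferentiableAt ℂ Hz s :=
    Hz_diff.differentiableAt ((isOpen_lt continuous_const Complex.continuous_re).mem_nhds hs)
  unfold DD
  exact ((h1.div ((FF_diff χ) s) h).neg).sub
    ((differentiableAt_const _).mul ((differentiableAt_const _).add (differentiableAt_id.mul h2)))

noncomputable def GG (χ : DirichletCharacter ℂ q) (x : ℝ) (s : ℂ) : ℂ :=
  DD χ s * (x:ℂ) ^ s * (1 / (s * (s + 1)))

lemma GG_diff (χ : DirichletCharacter ℂ q) {x : ℝ} (hx : 0 < x) {s : ℂ} (hs : 0 < s.re) (h : FF χ s ≠ 0) :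
    DifferentiableAt ℂ (GG χ x) s := by
  have hs0 : s ≠ 0 := by rintro rfl; simp at hs
  have hs1 : s + 1 ≠ 0 := by
    intro h; have := congrArg Complex.re h; simp at this; linarith
  have hx0 : (x:ℂ) ≠ 0 := by exact_mod_cast hx.ne'
  unfold GG
  refine ((DD_diff χ hs h).mul ?_).mul ?_
  · exact differentiableAt_id.const_cpow (Or.inl hx0)
  · exact (differentiableAt_const _).div (differentiableAt_id.mul (differentiableAt_id.add_const _)) (mul_ne_zero hs0 hs1)

lemma GG_bound (χ : DirichletCharacter ℂ q) {x : ℝ} (hx : 0 < x) {s : ℂ} (hs : 1/2 ≤ s.re) {M W : ℝ} (hM : 0 ≤ M)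
    (h : ‖deriv (FF χ) s / FF χ s‖ ≤ M) (hW : 1/2 ≤ W) (hW1 : W ≤ ‖s‖) :
    ‖GG χ x s‖ ≤ (2 * M + 4) / W * x ^ s.re := by
  have hs0 : 0 < ‖s‖ := by linarith
  have hss : ‖s‖ ≤ ‖s + 1‖ := by
    rw [← pow_le_pow_iff_left₀ (norm_nonneg _) (norm_nonneg _) two_ne_zero, Complex.sq_norm, Complex.sq_norm,
      Complex.normSq_apply, Complex.normSq_apply]
    simp; nlinarith
  have hHz : ‖s * Hz s‖ ≤ 2 * ‖s‖ := by
    rw [norm_mul, mul_comm]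
    have h1 := Hz_bound (s := s) (by linarith)
    have : 1 / s.re ≤ 2 := by rw [div_le_iff₀ (by linarith)]; linarith
    gcongr; linarith
  have hs12 : 1 / 2 ≤ ‖s‖ := hs.trans (Complex.re_le_norm s)
  have hs1 : 1 ≤ ‖s + 1‖ := by
    have := Complex.re_le_norm (s + 1); simp at this; linarith
  have hD : ‖DD χ s‖ ≤ M + 1 + 2 * ‖s‖ := by
    unfold DD
    refine (norm_sub_le _ _).trans ?_
    rw [norm_neg, norm_mul, Complex.norm_real, Real.norm_of_nonneg (dl_nonneg χ)]
    have h1 : ‖1 + s * Hz s‖ ≤ 1 + 2 * ‖s‖ := (norm_add_le _ _).trans (by simp only [norm_one]; linarith)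
    have h2 : dl χ * ‖1 + s * Hz s‖ ≤ 1 * (1 + 2 * ‖s‖) := by
      apply mul_le_mul (dl_le χ) h1 (norm_nonneg _) zero_le_one
    linarith
  unfold GG
  rw [norm_mul, norm_mul, Complex.norm_cpow_eq_rpow_re_of_pos hx, norm_div, norm_one, norm_mul]
  have hk : ‖DD χ s‖ * (1 / (‖s‖ * ‖s + 1‖)) ≤ (2 * M + 4) / W := by
    have : (2 * M + 4) / ‖s‖ ≤ (2 * M + 4) / W := by gcongr
    refine le_trans ?_ this
    rw [mul_one_div, div_le_div_iff₀ (by positivity) hs0]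
    have : ‖DD χ s‖ ≤ (2 * M + 4) * ‖s + 1‖ := by nlinarith
    nlinarith
  calc _ = ‖DD χ s‖ * (1 / (‖s‖ * ‖s + 1‖)) * x ^ s.re := by ring
    _ ≤ _ := by gcongr

end

theorem smooth_bound {B : ℝ} (hB : 1 ≤ B) : ∃ μ > 0, ∃ C > 0, ∃ ℓ₀ : ℝ, 1 ≤ ℓ₀ ∧ ∀ ℓ, ℓ₀ ≤ ℓ → ∀ (q : ℕ) [NeZero q]
    (χ : DirichletCharacter ℂ q) (x : ℝ), (q:ℝ) ≤ ℓ ^ B → x = Real.exp (ℓ^2) →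
    ‖∑ n ∈ Icc 1 ⌊x⌋₊, aa χ n * ((1 - n / x : ℝ) : ℂ)‖ ≤ C * ℓ^4 * x * Real.exp (-(μ * ℓ)) := by
  obtain ⟨c, hc, hc8, C, hC, ℓ₀, hℓ₀, hld⟩ := logder hB
  refine ⟨c / 2, by positivity, 2 * (2 * C + 4) * 2 + 4 * (2 * C + 4) * 3 + 2 * 36 , by positivity, max ℓ₀ (1 / c), le_max_of_le_left hℓ₀, ?_⟩
  intro ℓ hℓ q _ χ x hq hx
  have hℓ1 : ℓ₀ ≤ ℓ := (le_max_left _ _).trans hℓ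
  have hℓc : 1 / c ≤ ℓ := (le_max_right _ _).trans hℓ
  have h1 : 1 ≤ ℓ := hℓ₀.trans hℓ1
  have hℓp : 0 < ℓ := by linarith
  have hℓ2 : 1 ≤ ℓ^2 := one_le_pow₀ h1
  have hx0 : 0 < x := by rw [hx]; positivity
  set T := Real.exp (c / 2 * ℓ) with hT
  have hT1 : 1 ≤ T := Real.one_le_exp (by positivity)
  have hTe : T ≤ Real.exp ℓ := by rw [hT]; gcongr; nlinarith
  set σ₁ : ℝ := 1 + 1 / ℓ^2 with hσ₁
  set σ₀ : ℝ := 1 - c / ℓ with hσ₀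
  have hcl : 1 / ℓ^2 ≤ c / ℓ := by
    rw [div_le_iff₀ hc] at hℓc
    rw [div_le_div_iff₀ (by positivity) hℓp]; nlinarith
  have hcl8 : c / ℓ ≤ 1 / 8 := by rw [div_le_iff₀ hℓp]; linarith
  have hcl0 : 0 < c / ℓ := by positivity
  have hl20 : 0 < 1 / ℓ^2 := by positivity
  have hstrip : ∀ s : ℂ, σ₀ ≤ s.re → s.re ≤ σ₁ → |s.im| ≤ T → FF χ s ≠ 0 ∧ ‖deriv (FF χ) s / FF χ s‖ ≤ C * ℓ^2 := by
    intro s h2 h3 h4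
    exact hld ℓ hℓ1 q χ s hq (h4.trans hTe) (abs_le.2 ⟨by linarith, by linarith⟩)
  have hxσ₁ : x ^ σ₁ ≤ 3 * x := by
    have : x ^ σ₁ = x * Real.exp 1 := by
      rw [hx, ← Real.exp_mul, ← Real.exp_add]; congr 1; rw [hσ₁]; field_simp
    rw [this]; nlinarith [Real.exp_one_lt_d9]
  have hx1 : 1 ≤ x := by rw [hx]; exact Real.one_le_exp (by positivity)
  have hxσ₀ : x ^ σ₀ = x * (T⁻¹ * T⁻¹) := by
    rw [hx, ← Real.exp_mul, hT, ← Real.exp_neg, ← Real.exp_add, ← Real.exp_add]; congr 1; rw [hσ₀]; field_simp; ring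
  have hC2 : 2 * (C * ℓ^2) + 4 ≤ (2 * C + 4) * ℓ^2 := by nlinarith
  -- rectangle
  have hrect := rect_shift (G := GG χ x) (σ₀ := σ₀) (σ₁ := σ₁) (T := T) (Mh := (2 * C + 4) * ℓ^2 / T * (3 * x))
    (Ml := (2 * C + 4) * ℓ^2 * 2 * (x * (T⁻¹ * T⁻¹))) (by linarith) (by linarith)
    (fun s h2 h3 h4 => GG_diff χ hx0 (by linarith) (hstrip s h2 h3 h4).1)
    (by
      intro s h2 h3 h4
      have := GG_bound χ hx0 (s := s) (M := C * ℓ^2) (W := T) (by linarith) (by positivity) (hstrip s h2 h3 h4.le).2 (by linarith)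
        (by rw [← h4]; exact Complex.abs_im_le_norm s)
      refine this.trans ?_
      have h5 : x ^ s.re ≤ 3 * x := (Real.rpow_le_rpow_of_exponent_le hx1 h3).trans hxσ₁
      gcongr)
    (by
      intro s h2 h4
      have := GG_bound χ hx0 (s := s) (M := C * ℓ^2) (W := 1/2) (by linarith) (by positivity) (hstrip s h2.ge (by linarith) h4).2 (le_refl _)
        (le_trans (by linarith) (Complex.re_le_norm s))
      refine this.trans ?_
      rw [h2, hxσ₀, div_div_eq_mul_div, div_one]
      gcongr)
  -- perron
  have hre : ∀ t : ℝ, ((σ₁:ℂ) + t * I).re = 1 + 1 / ℓ^2 := by intro t; rw [← hσ₁]; simp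
  have hgt : ∀ t : ℝ, 1 < ((σ₁:ℂ) + t * I).re := by intro t; rw [hre]; linarith
  have hper := perron (aa χ) (σ := σ₁) (by linarith) (right_line h1 (aa_norm χ) (by rw [← hσ₁]; simp)).1 hx0
  have hGG : ∀ t : ℝ, LSeries (aa χ) ((σ₁:ℂ) + t * I) * (x:ℂ) ^ ((σ₁:ℂ) + t * I) * (1 / (((σ₁:ℂ) + t * I) * ((σ₁:ℂ) + t * I + 1)))
      = GG χ x ((σ₁:ℂ) + t * I) := by
    intro t; rw [GG, aa_LSeries χ (hgt t)]
  simp only [hGG] at hper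
  have hbound : ∀ t : ℝ, ‖GG χ x ((σ₁:ℂ) + t * I)‖ ≤ 36 * ℓ^4 * x * (1 + t^2)⁻¹ := by
    intro t
    rw [GG, ← aa_LSeries χ (hgt t), norm_mul, norm_mul, Complex.norm_cpow_eq_rpow_re_of_pos hx0, hre]
    have h2 := (right_line h1 (aa_norm χ) (hre t)).2
    have h3 := ker_bound (σ := σ₁) (by linarith) t
    calc _ ≤ 12 * ℓ^4 * (3 * x) * (1 + t^2)⁻¹ := by gcongr
      _ = _ := by ring
  have hcont : Continuous (fun t : ℝ => GG χ x ((σ₁:ℂ) + t * I)) := by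
    rw [continuous_iff_continuousAt]
    intro t
    have h2 : ContinuousAt (GG χ x) ((σ₁:ℂ) + t * I) :=
      (GG_diff χ hx0 (by linarith [hgt t]) (FF_ne_zero χ (hgt t).le)).continuousAt
    exact ContinuousAt.comp (f := fun t : ℝ => (σ₁:ℂ) + t * I) h2 (by fun_prop)
  have hIntg : Integrable (fun t : ℝ => GG χ x ((σ₁:ℂ) + t * I)) :=
    Integrable.mono' (integrable_inv_one_add_sq.const_mul (36 * ℓ^4 * x)) hcont.aestronglyMeasurable
      (Eventually.of_forall hbound)
  have htail := tail_bound (T := T) (by linarith) (by positivity) hIntg hbound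
  rw [hper, norm_smul, Real.norm_of_nonneg (by positivity)]
  have hTi : Real.exp (-(c / 2 * ℓ)) = T⁻¹ := by rw [Real.exp_neg]
  rw [hTi]
  have hT0 : 0 < T := by linarith
  have hpi : 1 / (2 * Real.pi) ≤ 1 := by
    rw [div_le_one (by positivity)]; linarith [Real.pi_gt_three]
  have hw : σ₁ - σ₀ ≤ 2 := by linarith
  calc 1 / (2 * Real.pi) * ‖∫ t : ℝ, GG χ x ((σ₁:ℂ) + t * I)‖ ≤ 1 * ‖∫ t : ℝ, GG χ x ((σ₁:ℂ) + t * I)‖ := by gcongr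
    _ ≤ 2 * (σ₁ - σ₀) * ((2 * C + 4) * ℓ^2 / T * (3 * x)) + 2 * T * ((2 * C + 4) * ℓ^2 * 2 * (x * (T⁻¹ * T⁻¹))) + 2 * (36 * ℓ^4 * x / T) := by
        linarith
    _ ≤ 2 * 2 * ((2 * C + 4) * ℓ^4 / T * (3 * x)) + 2 * T * ((2 * C + 4) * ℓ^4 * 2 * (x * (T⁻¹ * T⁻¹))) + 2 * (36 * ℓ^4 * x / T) := by
        have : ℓ^2 ≤ ℓ^4 := pow_le_pow_right₀ h1 (by norm_num)
        gcongr
    _ = _ := by field_simp; ring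

end SW


open MeasureTheory Finset

namespace SW

open Complex Metric Filter Topology DirichletCharacter

/-- von Mangoldt restricted to a residue class -/
noncomputable def LA (q : ℕ) (r : ZMod q) (n : ℕ) : ℝ := if (n : ZMod q) = r then ArithmeticFunction.vonMangoldt n else 0

lemma LA_nonneg (q : ℕ) (r : ZMod q) (n : ℕ) : 0 ≤ LA q r n := by
  unfold LA; split_ifs
  · exact ArithmeticFunction.vonMangoldt_nonneg
  · exact le_rfl

theorem orth {q : ℕ} [NeZero q] {r : ZMod q} (hr : IsUnit r) (s : Finset ℕ) (w : ℕ → ℝ) {M : ℝ}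
    (h : ∀ χ : DirichletCharacter ℂ q, ‖∑ n ∈ s, aa χ n * ((w n : ℝ) : ℂ)‖ ≤ M) :
    |∑ n ∈ s, LA q r n * w n - (1 / (q.totient : ℝ)) * ∑ n ∈ s, w n| ≤ M := by
  have hφ : (0:ℝ) < q.totient := by exact_mod_cast Nat.totient_pos.2 (Nat.pos_of_ne_zero (NeZero.ne q))
  have hcard : (Fintype.card (DirichletCharacter ℂ q) : ℝ) = q.totient := by
    rw [← Nat.card_eq_fintype_card, card_eq_totient_of_hasEnoughRootsOfUnity]
  have hdl : ∑ χ : DirichletCharacter ℂ q, χ r⁻¹ * (dl χ : ℂ) = 1 := by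
    rw [Finset.sum_eq_single (1 : DirichletCharacter ℂ q)]
    · rw [dl_one]
      have : IsUnit r⁻¹ := by
        obtain ⟨u, rfl⟩ := hr
        rw [ZMod.inv_coe_unit]; exact Units.isUnit _
      rw [MulChar.one_apply this]; simp
    · intro b _ hb; rw [dl_ne hb]; simp
    · simp
  have key : ∑ χ : DirichletCharacter ℂ q, χ r⁻¹ * ∑ n ∈ s, aa χ n * ((w n : ℝ) : ℂ)
      = ((q.totient * ∑ n ∈ s, LA q r n * w n - ∑ n ∈ s, w n : ℝ) : ℂ) := by
    simp only [Finset.mul_sum]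
    rw [Finset.sum_comm]
    have : ∀ n ∈ s, ∑ χ : DirichletCharacter ℂ q, χ r⁻¹ * (aa χ n * ((w n : ℝ) : ℂ))
        = ((q.totient * (LA q r n * w n) - w n : ℝ) : ℂ) := by
      intro n _
      have h1 : ∀ χ : DirichletCharacter ℂ q, χ r⁻¹ * (aa χ n * ((w n : ℝ) : ℂ)) =
          (χ r⁻¹ * χ n) * ((ArithmeticFunction.vonMangoldt n * w n : ℝ) : ℂ) - (χ r⁻¹ * (dl χ : ℂ)) * (w n : ℂ) := by
        intro χ; unfold aa; push_cast; ring
      simp only [h1]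
      rw [Finset.sum_sub_distrib, ← Finset.sum_mul, ← Finset.sum_mul, hdl, sum_char_inv_mul_char_eq ℂ hr]
      unfold LA
      by_cases h : (n : ZMod q) = r
      · rw [if_pos h.symm, if_pos h]; push_cast; ring
      · rw [if_neg (Ne.symm h), if_neg h]; push_cast; ring
    rw [Finset.sum_congr rfl this]
    push_cast
    rw [Finset.sum_sub_distrib]
  have hb : ‖∑ χ : DirichletCharacter ℂ q, χ r⁻¹ * ∑ n ∈ s, aa χ n * ((w n : ℝ) : ℂ)‖ ≤ q.totient * M := by
    refine (norm_sum_le _ _).trans ?_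
    rw [← hcard]
    have : ∀ χ ∈ (Finset.univ : Finset (DirichletCharacter ℂ q)), ‖χ r⁻¹ * ∑ n ∈ s, aa χ n * ((w n : ℝ) : ℂ)‖ ≤ M := by
      intro χ _
      rw [norm_mul]
      calc _ ≤ 1 * ‖∑ n ∈ s, aa χ n * ((w n : ℝ) : ℂ)‖ := by gcongr; exact DirichletCharacter.norm_le_one χ _
        _ ≤ M := by rw [one_mul]; exact h χ
    refine (Finset.sum_le_card_nsmul _ _ _ this).trans ?_
    simp
  rw [key, Complex.norm_real, Real.norm_eq_abs] at hb
  have h2 : (q.totient * ∑ n ∈ s, LA q r n * w n - ∑ n ∈ s, w n : ℝ)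
      = q.totient * (∑ n ∈ s, LA q r n * w n - (1 / (q.totient : ℝ)) * ∑ n ∈ s, w n) := by
    field_simp
  rw [h2, abs_mul, abs_of_pos hφ] at hb
  exact le_of_mul_le_mul_left hb hφ

theorem sum_weight {x : ℝ} (hx : 1 ≤ x) : |∑ n ∈ Icc 1 ⌊x⌋₊, (1 - n / x : ℝ) - x / 2| ≤ 1 := by
  have hx0 : 0 < x := by linarith
  have h1 : ∀ N : ℕ, ∑ n ∈ Icc 1 N, (1 - n / x : ℝ) = N - N * (N + 1) / (2 * x) := by
    intro N
    induction N with
    | zero => simp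
    | succ N ih => rw [Finset.sum_Icc_succ_top (by omega), ih]; push_cast; field_simp; ring
  rw [h1]
  set N := ⌊x⌋₊
  have h2 : (N:ℝ) ≤ x := Nat.floor_le hx0.le
  have h3 : x < N + 1 := Nat.lt_floor_add_one x
  have h4 : (N:ℝ) - N * (N + 1) / (2 * x) - x / 2 = -(((x - N)^2 + N) / (2 * x)) := by field_simp; ring
  rw [h4, abs_neg, abs_of_nonneg (by positivity), div_le_one (by positivity)]
  nlinarith

/-- smoothed psi -/
noncomputable def P1 (q : ℕ) (r : ZMod q) (x : ℝ) : ℝ := ∑ n ∈ Icc 1 ⌊x⌋₊, LA q r n * (x - n)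

noncomputable def P0 (q : ℕ) (r : ZMod q) (x : ℝ) : ℝ := ∑ n ∈ Icc 1 ⌊x⌋₊, LA q r n

theorem psi1 {B : ℝ} (hB : 1 ≤ B) : ∃ μ > 0, ∃ C > 0, ∃ ℓ₀ : ℝ, 1 ≤ ℓ₀ ∧ ∀ ℓ, ℓ₀ ≤ ℓ → ∀ (q : ℕ) [NeZero q]
    (r : ZMod q) (x : ℝ), IsUnit r → (q:ℝ) ≤ ℓ ^ B → x = Real.exp (ℓ^2) →
    |P1 q r x - x^2 / (2 * q.totient)| ≤ C * x^2 * Real.exp (-(μ * ℓ)) := by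
  obtain ⟨μ, hμ, C, hC, ℓ₀, hℓ₀, hs⟩ := smooth_bound hB
  have hev : ∀ᶠ ℓ : ℝ in atTop, ℓ^4 ≤ Real.exp (μ / 2 * ℓ) := by
    have := (isLittleO_pow_exp_pos_mul_atTop 4 (show 0 < μ / 2 by positivity)).bound one_pos
    filter_upwards [this] with ℓ h
    rw [one_mul, Real.norm_of_nonneg (by positivity), Real.norm_of_nonneg (Real.exp_pos _).le] at h
    exact h
  obtain ⟨ℓ₁, hℓ₁⟩ := eventually_atTop.1 hev
  refine ⟨μ / 2, by positivity, C + 1, by positivity, max ℓ₀ (max ℓ₁ (μ / 2)), le_max_of_le_left hℓ₀, ?_⟩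
  intro ℓ hℓ q _ r x hr hq hx
  have hl0 : ℓ₀ ≤ ℓ := (le_max_left _ _).trans hℓ
  have hl1 : ℓ₁ ≤ ℓ := (le_max_left _ _).trans ((le_max_right _ _).trans hℓ)
  have hl2 : μ / 2 ≤ ℓ := (le_max_right _ _).trans ((le_max_right _ _).trans hℓ)
  have h1 : 1 ≤ ℓ := hℓ₀.trans hl0
  have hx1 : 1 ≤ x := by rw [hx]; exact Real.one_le_exp (by positivity)
  have hx0 : 0 < x := by linarith
  have ho := orth hr (Icc 1 ⌊x⌋₊) (fun n => (1 - n / x : ℝ)) (fun χ => hs ℓ hl0 q χ x hq hx)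
  have hw := sum_weight hx1
  have hφ : (1:ℝ) ≤ q.totient := by exact_mod_cast Nat.totient_pos.2 (Nat.pos_of_ne_zero (NeZero.ne q))
  set W := ∑ n ∈ Icc 1 ⌊x⌋₊, (1 - n / x : ℝ)
  set V := ∑ n ∈ Icc 1 ⌊x⌋₊, LA q r n * (1 - n / x : ℝ) with hV
  have hPV : P1 q r x = x * V := by
    rw [P1, hV, Finset.mul_sum]
    refine Finset.sum_congr rfl (fun n _ => ?_)
    field_simp
  have hE : ℓ^4 * Real.exp (-(μ * ℓ)) ≤ Real.exp (-(μ / 2 * ℓ)) := by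
    have := hℓ₁ ℓ hl1
    calc _ ≤ Real.exp (μ / 2 * ℓ) * Real.exp (-(μ * ℓ)) := by gcongr
      _ = _ := by rw [← Real.exp_add]; congr 1; ring
  have hxE : 1 ≤ x * Real.exp (-(μ / 2 * ℓ)) := by
    rw [hx, ← Real.exp_add]; apply Real.one_le_exp; nlinarith
  have hdecomp : P1 q r x - x^2 / (2 * q.totient) = x * (V - 1 / (q.totient:ℝ) * W) + x / q.totient * (W - x / 2) := by
    rw [hPV]; field_simp; ring
  rw [hdecomp]
  have hxφ : x / q.totient ≤ x := div_le_self hx0.le hφ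
  calc _ ≤ |x * (V - 1 / (q.totient:ℝ) * W)| + |x / q.totient * (W - x / 2)| := abs_add_le _ _
    _ = x * |V - 1 / (q.totient:ℝ) * W| + x / q.totient * |W - x / 2| := by
        rw [abs_mul, abs_mul, abs_of_pos hx0, abs_of_pos (show 0 < x / (q.totient:ℝ) by positivity)]
    _ ≤ x * (C * ℓ^4 * x * Real.exp (-(μ * ℓ))) + x * 1 := by gcongr
    _ = C * x^2 * (ℓ^4 * Real.exp (-(μ * ℓ))) + x * 1 := by ring
    _ ≤ C * x^2 * Real.exp (-(μ / 2 * ℓ)) + x * (x * Real.exp (-(μ / 2 * ℓ))) := by gcongr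
    _ = _ := by ring

theorem P1_upper (q : ℕ) (r : ZMod q) {x h : ℝ} (hx : 0 ≤ x) (hh : 0 ≤ h) :
    h * P0 q r x ≤ P1 q r (x + h) - P1 q r x := by
  have hsub : Icc 1 ⌊x⌋₊ ⊆ Icc 1 ⌊x + h⌋₊ := Finset.Icc_subset_Icc_right (Nat.floor_mono (by linarith))
  have h1 : ∑ n ∈ Icc 1 ⌊x⌋₊, LA q r n * (x + h - n) ≤ P1 q r (x + h) := by
    apply Finset.sum_le_sum_of_subset_of_nonneg hsub
    intro n hn _
    rw [mem_Icc, Nat.le_floor_iff (by linarith)] at hn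
    exact mul_nonneg (LA_nonneg q r n) (by linarith [hn.2])
  have h2 : ∑ n ∈ Icc 1 ⌊x⌋₊, LA q r n * (x + h - n) = P1 q r x + h * P0 q r x := by
    rw [P1, P0, Finset.mul_sum, ← Finset.sum_add_distrib]
    refine Finset.sum_congr rfl (fun n _ => by ring)
  linarith

theorem P1_lower (q : ℕ) (r : ZMod q) {x h : ℝ} (hx : h ≤ x) (hh : 0 ≤ h) :
    P1 q r x - P1 q r (x - h) ≤ h * P0 q r x := by
  have hsub : Icc 1 ⌊x - h⌋₊ ⊆ Icc 1 ⌊x⌋₊ := Finset.Icc_subset_Icc_right (Nat.floor_mono (by linarith))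
  have h1 : ∑ n ∈ Icc 1 ⌊x⌋₊, LA q r n * (x - h - n) ≤ P1 q r (x - h) := by
    rw [P1, ← Finset.sum_sdiff hsub]
    have : ∑ n ∈ Icc 1 ⌊x⌋₊ \ Icc 1 ⌊x - h⌋₊, LA q r n * (x - h - n) ≤ 0 := by
      apply Finset.sum_nonpos
      intro n hn
      rw [Finset.mem_sdiff, mem_Icc, mem_Icc, Nat.le_floor_iff (by linarith)] at hn
      have : x - h < n := by
        by_contra hc
        push Not at hc
        exact hn.2 ⟨hn.1.1, (Nat.le_floor_iff (by linarith)).2 hc⟩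
      exact mul_nonpos_of_nonneg_of_nonpos (LA_nonneg q r n) (by linarith)
    linarith
  have h2 : ∑ n ∈ Icc 1 ⌊x⌋₊, LA q r n * (x - h - n) = P1 q r x - h * P0 q r x := by
    rw [P1, P0, Finset.mul_sum, ← Finset.sum_sub_distrib]
    refine Finset.sum_congr rfl (fun n _ => by ring)
  linarith

end SW


open MeasureTheory Finset

namespace SW

open Complex Metric Filter Topology DirichletCharacter

theorem swpsi {B : ℝ} (hB : 1 ≤ B) : ∃ c > 0, ∃ C > 0, ∃ ℓ₀ : ℝ, 1 ≤ ℓ₀ ∧ ∀ ℓ, ℓ₀ ≤ ℓ → ∀ (q : ℕ) [NeZero q]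
    (r : ZMod q) (x : ℝ), IsUnit r → (q:ℝ) ≤ ℓ ^ B → x = Real.exp (ℓ^2) →
    |P0 q r x - x / q.totient| ≤ C * x * Real.exp (-(c * ℓ)) := by
  obtain ⟨μ, hμ, C, hC, ℓ₀, hℓ₀, hs⟩ := psi1 (show 1 ≤ B + 1 by linarith)
  refine ⟨μ / 4, by positivity, 1 + 16 * C, by positivity, max (2 * ℓ₀) (2 ^ (B + 1)), le_max_of_le_left (by linarith), ?_⟩
  intro ℓ hℓ q _ r x hr hq hx
  have hl0 : 2 * ℓ₀ ≤ ℓ := (le_max_left _ _).trans hℓ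
  have hl1 : (2:ℝ) ^ (B + 1) ≤ ℓ := (le_max_right _ _).trans hℓ
  have h1 : 2 ≤ ℓ := by linarith
  have hx0 : 0 < x := by rw [hx]; positivity
  have hφ : (1:ℝ) ≤ q.totient := by exact_mod_cast Nat.totient_pos.2 (Nat.pos_of_ne_zero (NeZero.ne q))
  set δ := Real.exp (-(μ / 4 * ℓ)) with hδ
  have hδ1 : δ ≤ 1 := Real.exp_le_one_iff.2 (by have : 0 ≤ μ / 4 * ℓ := by positivity
                                                linarith)
  have hδ0 : 0 < δ := Real.exp_pos _
  have hδ2 : δ^2 = Real.exp (-(μ * (ℓ / 2))) := by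
    rw [hδ, ← Real.exp_nat_mul]; congr 1; push_cast; ring
  have hnear : ∀ y : ℝ, x / 2 ≤ y → y ≤ 2 * x → |P1 q r y - y^2 / (2 * q.totient)| ≤ 4 * C * x^2 * δ^2 := by
    intro y hy1 hy2
    have hy0 : 0 < y := by linarith
    have hlog : ℓ^2 / 4 ≤ Real.log y := by
      have h2 : Real.log (x / 2) ≤ Real.log y := Real.log_le_log (by positivity) hy1
      rw [Real.log_div hx0.ne' two_ne_zero, hx, Real.log_exp] at h2
      have := Real.log_two_lt_d9
      nlinarith
    have hlog0 : 0 ≤ Real.log y := le_trans (by positivity) hlog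
    have hl' : ℓ / 2 ≤ √(Real.log y) := by
      apply Real.le_sqrt_of_sq_le; linarith [hlog, show (ℓ/2)^2 = ℓ^2/4 by ring]
    have := hs (√(Real.log y)) (by linarith) q r y hr (by
      refine hq.trans ?_
      calc ℓ ^ B ≤ (ℓ / 2) ^ (B + 1) := by
            rw [Real.div_rpow (by linarith) (by norm_num), Real.rpow_add_one (by linarith), le_div_iff₀ (by positivity)]
            gcongr
        _ ≤ _ := by gcongr) (by rw [Real.sq_sqrt hlog0, Real.exp_log hy0])
    refine this.trans ?_
    rw [hδ2]
    have h3 : y^2 ≤ 4 * x^2 := by nlinarith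
    calc _ ≤ C * (4 * x^2) * Real.exp (-(μ * (ℓ / 2))) := by gcongr
      _ = _ := by ring
  set h := x * δ / 2 with hh
  have hh0 : 0 < h := by positivity
  have hhx : h ≤ x / 2 := by rw [hh]; nlinarith
  have n0 := abs_le.1 (hnear x (by linarith) (by linarith))
  have n1 := abs_le.1 (hnear (x + h) (by linarith) (by linarith))
  have n2 := abs_le.1 (hnear (x - h) (by linarith) (by linarith))
  have u := P1_upper q r hx0.le hh0.le
  have l := P1_lower q r (show h ≤ x by linarith) hh0.le
  have e1 : (x + h)^2 / (2 * q.totient) - x^2 / (2 * q.totient) = h * (x / q.totient + h / (2 * q.totient)) := by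
    field_simp; ring
  have e2 : x^2 / (2 * q.totient) - (x - h)^2 / (2 * q.totient) = h * (x / q.totient - h / (2 * q.totient)) := by
    field_simp; ring
  have e3 : 8 * C * x^2 * δ^2 = h * (16 * C * x * δ) := by rw [hh]; ring
  have hhφ : h / (2 * q.totient) ≤ x * δ := by
    rw [div_le_iff₀ (by positivity), hh]; 
    have : 0 < x * δ := by positivity
    nlinarith
  rw [abs_le]
  constructor
  · have : h * (x / q.totient - h / (2 * q.totient) - 16 * C * x * δ) ≤ h * P0 q r x := by
      rw [mul_sub, ← e2, ← e3]; linarith [n0.1, n2.2]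
    have := le_of_mul_le_mul_left this hh0
    linarith
  · have : h * P0 q r x ≤ h * (x / q.totient + h / (2 * q.totient) + 16 * C * x * δ) := by
      rw [mul_add, ← e1, ← e3]; linarith [n0.1, n1.2]
    have := le_of_mul_le_mul_left this hh0
    linarith

/-- theta in a residue class -/
noncomputable def T0 (q : ℕ) (r : ZMod q) (x : ℝ) : ℝ :=
  ∑ p ∈ (Icc 1 ⌊x⌋₊).filter (fun p : ℕ => p.Prime ∧ (p : ZMod q) = r), Real.log p

theorem P0_sub_T0 (q : ℕ) (r : ZMod q) {x : ℝ} (hx : 1 ≤ x) :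
    |P0 q r x - T0 q r x| ≤ 2 * √x * Real.log x := by
  have h := Chebyshev.psi_sub_theta_le hx
  have hsub : P0 q r x - T0 q r x = ∑ n ∈ Icc 1 ⌊x⌋₊, if n.Prime then 0 else LA q r n := by
    rw [P0, T0, Finset.sum_filter, ← Finset.sum_sub_distrib]
    refine Finset.sum_congr rfl (fun n _ => ?_)
    unfold LA
    by_cases hp : n.Prime <;> by_cases hr : (n : ZMod q) = r <;> simp [hp, hr, ArithmeticFunction.vonMangoldt_apply_prime]
  have hps : Chebyshev.psi x - Chebyshev.theta x = ∑ n ∈ Icc 1 ⌊x⌋₊, if n.Prime then 0 else ArithmeticFunction.vonMangoldt n := by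
    have e1 : Finset.Ioc 0 ⌊x⌋₊ = Icc 1 ⌊x⌋₊ := rfl
    rw [Chebyshev.psi, Chebyshev.theta, e1, Finset.sum_filter, ← Finset.sum_sub_distrib]
    refine Finset.sum_congr rfl (fun n _ => ?_)
    by_cases hp : n.Prime <;> simp [hp, ArithmeticFunction.vonMangoldt_apply_prime]
  rw [hsub, abs_of_nonneg]
  · refine le_trans ?_ h
    rw [hps]
    apply Finset.sum_le_sum
    intro n _
    split_ifs
    · exact le_rfl
    · unfold LA; split_ifs
      · exact le_rfl
      · exact ArithmeticFunction.vonMangoldt_nonneg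
  · apply Finset.sum_nonneg
    intro n _
    split_ifs
    · exact le_rfl
    · exact LA_nonneg q r n

theorem swtheta {B : ℝ} (hB : 1 ≤ B) : ∃ c > 0, ∃ C > 0, ∃ X : ℝ, 1 ≤ X ∧ ∀ x, X ≤ x → ∀ (q : ℕ) [NeZero q]
    (r : ZMod q), IsUnit r → (q:ℝ) ≤ Real.log x ^ B →
    |T0 q r x - x / q.totient| ≤ C * x * Real.exp (-(c * √(Real.log x))) := by
  obtain ⟨c, hc, C, hC, ℓ₀, hℓ₀, hs⟩ := swpsi (show 1 ≤ 2 * B by linarith)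
  refine ⟨min c (1/4), by positivity, C + 16, by positivity, Real.exp (ℓ₀^2), Real.one_le_exp (by positivity), ?_⟩
  intro x hx q _ r hr hq
  have hx0 : 0 < x := lt_of_lt_of_le (Real.exp_pos _) hx
  have hx1 : 1 ≤ x := (Real.one_le_exp (by positivity)).trans hx
  have hlog : ℓ₀^2 ≤ Real.log x := by rwa [Real.le_log_iff_exp_le hx0]
  have hlog0 : 0 ≤ Real.log x := le_trans (by positivity) hlog
  set ℓ := √(Real.log x) with hℓ
  have hsq : ℓ^2 = Real.log x := Real.sq_sqrt hlog0
  have hl : ℓ₀ ≤ ℓ := Real.le_sqrt_of_sq_le hlog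
  have hl1 : 1 ≤ ℓ := hℓ₀.trans hl
  have h1 := hs ℓ hl q r x hr (by rw [Real.rpow_mul (by linarith), Real.rpow_two, hsq]; exact hq)
    (by rw [hsq, Real.exp_log hx0])
  have h2 := P0_sub_T0 q r hx1
  have h3 : 2 * √x * Real.log x ≤ 16 * x * Real.exp (-(min c (1/4) * ℓ)) := by
    have hxe : x = Real.exp (ℓ^2) := by rw [hsq, Real.exp_log hx0]
    have e1 : √x = Real.exp (ℓ^2 / 2) := by rw [hxe, Real.exp_half]
    have e2 : Real.log x ≤ 8 * Real.exp (ℓ^2 / 8) := by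
      rw [← hsq]; have := Real.add_one_le_exp (ℓ^2/8); linarith
    have e3 : Real.exp (ℓ^2/2) * Real.exp (ℓ^2 / 8) ≤ x * Real.exp (-(min c (1/4) * ℓ)) := by
      rw [hxe, ← Real.exp_add, ← Real.exp_add]
      apply Real.exp_le_exp.2
      have : min c (1/4) ≤ 1/4 := min_le_right _ _
      nlinarith
    rw [e1]
    calc _ ≤ 2 * Real.exp (ℓ^2/2) * (8 * Real.exp (ℓ^2 / 8)) := by gcongr
      _ = 16 * (Real.exp (ℓ^2/2) * Real.exp (ℓ^2 / 8)) := by ring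
      _ ≤ 16 * (x * Real.exp (-(min c (1/4) * ℓ))) := by gcongr
      _ = _ := by ring
  have h4 : C * x * Real.exp (-(c * ℓ)) ≤ C * x * Real.exp (-(min c (1/4) * ℓ)) := by
    gcongr
    exact min_le_left _ _
  have h5 : T0 q r x - x / q.totient = (P0 q r x - x / q.totient) - (P0 q r x - T0 q r x) := by ring
  rw [h5]
  refine (abs_sub _ _).trans ?_
  linarith

end SW


open MeasureTheory Finset

namespace SW

open Complex Metric Filter Topology DirichletCharacter

theorem abel_id (b w : ℕ → ℂ) (M : ℕ) : ∀ d : ℕ, ∑ m ∈ Ioc M (M + d), b m * w m =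
    (∑ m ∈ Ioc M (M + d), b m) * w (M + d) - ∑ j ∈ range d, (∑ m ∈ Ioc M (M + j), b m) * (w (M + j + 1) - w (M + j)) := by
  intro d
  induction d with
  | zero => simp
  | succ d ih =>
    have e1 : ∀ g : ℕ → ℂ, ∑ m ∈ Ioc M (M + (d + 1)), g m = ∑ m ∈ Ioc M (M + d), g m + g (M + d + 1) := by
      intro g
      rw [← add_assoc, Finset.sum_Ioc_succ_top (by omega)]
    rw [e1, e1, ih, Finset.sum_range_succ, ← add_assoc]
    ring

theorem abel_bound (b w : ℕ → ℂ) {M N : ℕ} (hMN : M ≤ N) {R δ : ℝ} (hR : 0 ≤ R)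
    (hb : ∀ u, M ≤ u → u ≤ N → ‖∑ m ∈ Ioc M u, b m‖ ≤ R) (hw : ∀ m, ‖w m‖ ≤ 1)
    (hd : ∀ m, ‖w (m + 1) - w m‖ ≤ δ) : ‖∑ m ∈ Ioc M N, b m * w m‖ ≤ R * (1 + N * δ) := by
  obtain ⟨d, rfl⟩ := Nat.exists_eq_add_of_le hMN
  have hδ : 0 ≤ δ := (norm_nonneg _).trans (hd 0)
  rw [abel_id]
  have h1 : ‖(∑ m ∈ Ioc M (M + d), b m) * w (M + d)‖ ≤ R * 1 := by
    rw [norm_mul]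
    exact mul_le_mul (hb _ hMN le_rfl) (hw _) (norm_nonneg _) hR
  have h2 : ‖∑ j ∈ range d, (∑ m ∈ Ioc M (M + j), b m) * (w (M + j + 1) - w (M + j))‖ ≤ d * (R * δ) := by
    refine (norm_sum_le_of_le (f := fun j => (∑ m ∈ Ioc M (M + j), b m) * (w (M + j + 1) - w (M + j))) (range d) (n := fun _ => R * δ) ?_).trans ?_
    · intro j hj
      rw [mem_range] at hj
      rw [norm_mul]
      exact mul_le_mul (hb _ (by omega) (by omega)) (hd _) (norm_nonneg _) hR
    · simp
  have h3 : (d:ℝ) ≤ ((M + d : ℕ) : ℝ) := by exact_mod_cast Nat.le_add_left d M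
  have h4 : d * (R * δ) ≤ ((M + d : ℕ) : ℝ) * (R * δ) := by gcongr
  calc _ ≤ _ := norm_sub_le _ _
    _ ≤ R * 1 + d * (R * δ) := add_le_add h1 h2
    _ ≤ _ := by linarith

lemma e_def (x : ℝ) : e x = Complex.exp (((2 * Real.pi * x : ℝ) : ℂ) * I) := by
  unfold e; congr 1; push_cast; ring

lemma e_norm (x : ℝ) : ‖e x‖ = 1 := by
  rw [e_def, Complex.norm_exp_ofReal_mul_I]

lemma e_add (x y : ℝ) : e (x + y) = e x * e y := by
  rw [e_def, e_def, e_def, ← Complex.exp_add]; congr 1; push_cast; ring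

lemma e_int (m : ℤ) : e (m : ℝ) = 1 := by
  unfold e
  have := Complex.exp_int_mul_two_pi_mul_I m
  rw [← this]; congr 1; push_cast; ring

lemma e_sub_one (x : ℝ) : ‖e x - 1‖ ≤ 2 * Real.pi * |x| := by
  rw [e_def, mul_comm _ I]
  refine (Real.norm_exp_I_mul_ofReal_sub_one_le).trans ?_
  rw [Real.norm_eq_abs, abs_mul, abs_of_pos (by positivity)]

lemma e_diff (β : ℝ) (m : ℕ) : ‖e (β * ((m + 1 : ℕ) : ℝ)) - e (β * m)‖ ≤ 2 * Real.pi * |β| := by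
  have : β * ((m + 1 : ℕ) : ℝ) = β * m + β := by push_cast; ring
  rw [this, e_add]
  have h2 : e (β * m) * e β - e (β * m) = e (β * m) * (e β - 1) := by ring
  rw [h2, norm_mul, e_norm, one_mul]
  exact e_sub_one β

/-- one step comparison -/
lemma pow_step {t : ℝ} (ht0 : 0 < t) (ht1 : t < 1) {m : ℝ} (hm : 0 < m) :
    t * (m + 1) ^ (t - 1) ≤ (m + 1) ^ t - m ^ t ∧ (m + 1) ^ t - m ^ t ≤ t * m ^ (t - 1) := by
  have hder : ∀ y ∈ Set.Ioo m (m + 1), HasDerivAt (fun y : ℝ => y ^ t) (t * y ^ (t - 1)) y := by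
    intro y hy
    exact Real.hasDerivAt_rpow_const (Or.inl (by linarith [hy.1]))
  obtain ⟨y, hy, hy2⟩ := exists_hasDerivAt_eq_slope (fun y : ℝ => y ^ t) (fun y => t * y ^ (t - 1)) (show m < m + 1 by linarith)
    (by
      apply ContinuousOn.rpow_const continuousOn_id
      intro z hz; exact Or.inl (by simp only [id]; linarith [hz.1])) hder
  have h3 : (m + 1) ^ t - m ^ t = t * y ^ (t - 1) := by rw [hy2]; simp
  rw [h3]
  constructor
  · gcongr ?_ * ?_
    exact Real.rpow_le_rpow_of_nonpos (by linarith [hy.1]) hy.2.le (by linarith)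
  · gcongr ?_ * ?_
    exact Real.rpow_le_rpow_of_nonpos hm hy.1.le (by linarith)

theorem pow_tele {t : ℝ} (ht0 : 0 < t) (ht1 : t < 1) {M u : ℕ} (hM : 1 ≤ M) (hu : M ≤ u) :
    |∑ m ∈ Ioc M u, t * (m:ℝ) ^ (t - 1) - ((u:ℝ) ^ t - (M:ℝ) ^ t)| ≤ 1 := by
  have key : ∀ d : ℕ, 0 ≤ (((M + d : ℕ) : ℝ) ^ t - (M:ℝ) ^ t) - ∑ m ∈ Ioc M (M + d), t * (m:ℝ) ^ (t - 1) ∧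
      (((M + d : ℕ) : ℝ) ^ t - (M:ℝ) ^ t) - ∑ m ∈ Ioc M (M + d), t * (m:ℝ) ^ (t - 1) ≤ t * (M:ℝ) ^ (t - 1) - t * ((M + d : ℕ):ℝ) ^ (t - 1) := by
    intro d
    induction d with
    | zero => simp
    | succ d ih =>
      have hp : (0:ℝ) < ((M + d : ℕ) : ℝ) := by exact_mod_cast (by omega : 0 < M + d)
      have h1 := pow_step ht0 ht1 hp
      rw [← add_assoc, Finset.sum_Ioc_succ_top (by omega)]
      rw [Nat.cast_succ (M + d)]
      constructor
      · linarith [ih.1, h1.1]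
      · linarith [ih.2, h1.2]
  obtain ⟨d, rfl⟩ := Nat.exists_eq_add_of_le hu
  obtain ⟨h1, h2⟩ := key d
  have h3 : (M:ℝ) ^ (t - 1) ≤ 1 := Real.rpow_le_one_of_one_le_of_nonpos (by exact_mod_cast hM) (by linarith)
  have h4 : 0 ≤ t * ((M + d : ℕ):ℝ) ^ (t - 1) := by positivity
  have h5 : t * (M:ℝ) ^ (t - 1) ≤ 1 * 1 := mul_le_mul ht1.le h3 (by positivity) zero_le_one
  rw [abs_le]; constructor <;> linarith

end SW


open MeasureTheory Finset

namespace SW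

open Complex Metric Filter Topology DirichletCharacter

/-- primes up to n in a residue class -/
noncomputable def AA (q : ℕ) (r : ZMod q) (n : ℕ) : Finset ℕ :=
  (range (n + 1)).filter (fun p : ℕ => p.Prime ∧ (p : ZMod q) = r)

lemma le_root_iff {k : ℕ} (hk : 2 ≤ k) (p u : ℕ) : (p:ℝ) ≤ (u:ℝ) ^ ((k:ℝ)⁻¹) ↔ p ^ k ≤ u := by
  rw [Real.le_rpow_inv_iff_of_pos (by positivity) (by positivity) (by positivity), Real.rpow_natCast]
  norm_cast

lemma T0_eq {q : ℕ} (r : ZMod q) {n k u : ℕ} (hk : 2 ≤ k) (hu : u ≤ n) :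
    T0 q r ((u:ℝ) ^ ((k:ℝ)⁻¹)) = ∑ p ∈ (AA q r n).filter (fun p => p ^ k ≤ u), Real.log p := by
  unfold T0 AA
  refine Finset.sum_congr ?_ (fun _ _ => rfl)
  ext p
  simp only [mem_filter, mem_Icc, mem_range]
  rw [Nat.le_floor_iff (by positivity), le_root_iff hk]
  constructor
  · rintro ⟨⟨h1, h2⟩, h3⟩
    have : p ≤ p ^ k := Nat.le_self_pow (by omega) p
    exact ⟨⟨by omega, h3⟩, h2⟩
  · rintro ⟨⟨h1, h3⟩, h2⟩
    exact ⟨⟨h3.1.one_lt.le, h2⟩, h3⟩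

theorem resid {q : ℕ} [NeZero q] (r : ZMod q) {n k M : ℕ} (hk : 2 ≤ k) (hM : 1 ≤ M) (hMn : M ≤ n) {R : ℝ}
    (hR : ∀ u : ℕ, M ≤ u → u ≤ n → |T0 q r ((u:ℝ) ^ ((k:ℝ)⁻¹)) - (u:ℝ) ^ ((k:ℝ)⁻¹) / q.totient| ≤ R) (β : ℝ) :
    ‖∑ p ∈ (AA q r n).filter (fun p => p ^ k ∈ Ioc M n), e (β * ((p ^ k : ℕ) : ℝ)) * (Real.log p : ℂ) -
      (1 / (q.totient : ℂ)) * ((k:ℂ)⁻¹ * ∑ m ∈ Ioc M n, (((m:ℝ) ^ ((k:ℝ)⁻¹ - 1) : ℝ) : ℂ) * e (β * m))‖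
      ≤ (2 * R + 1) * (1 + n * (2 * Real.pi * |β|)) := by
  have hφ : (1:ℝ) ≤ q.totient := by exact_mod_cast Nat.totient_pos.2 (Nat.pos_of_ne_zero (NeZero.ne q))
  set t : ℝ := (k:ℝ)⁻¹ with ht
  have hk2 : (2:ℝ) ≤ k := by exact_mod_cast hk
  have ht0 : 0 < t := by positivity
  have ht1 : t < 1 := inv_lt_one_of_one_lt₀ (by linarith)
  set b : ℕ → ℝ := fun m => ∑ p ∈ (AA q r n).filter (fun p => p ^ k = m), Real.log p - (1 / (q.totient : ℝ)) * (t * (m:ℝ) ^ (t - 1)) with hb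
  have hR0 : 0 ≤ R := (abs_nonneg _).trans (hR M le_rfl hMn)
  have hbs : ∀ u, M ≤ u → u ≤ n → ‖∑ m ∈ Ioc M u, ((b m : ℝ) : ℂ)‖ ≤ 2 * R + 1 := by
    intro u h1 h2
    rw [← Complex.ofReal_sum, Complex.norm_real, Real.norm_eq_abs]
    have e1 : ∑ m ∈ Ioc M u, b m = (T0 q r ((u:ℝ)^t) - T0 q r ((M:ℝ)^t)) - (1 / (q.totient : ℝ)) * ∑ m ∈ Ioc M u, t * (m:ℝ) ^ (t - 1) := by
      simp only [hb]
      rw [Finset.sum_sub_distrib, ← Finset.mul_sum]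
      congr 1
      rw [Finset.sum_fiberwise_eq_sum_filter, T0_eq r hk h2, T0_eq r hk hMn, eq_sub_iff_add_eq, Finset.sum_filter, Finset.sum_filter, Finset.sum_filter, ← Finset.sum_add_distrib]
      refine Finset.sum_congr rfl (fun p _ => ?_)
      simp only [mem_Ioc]
      by_cases h3 : p ^ k ≤ M
      · rw [if_neg (by omega), if_pos h3, if_pos (by omega), zero_add]
      · by_cases h4 : p ^ k ≤ u
        · rw [if_pos (by omega), if_neg h3, if_pos h4, add_zero]
        · rw [if_neg (by omega), if_neg h3, if_neg h4, add_zero]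
    have e2 : ∑ m ∈ Ioc M u, b m = (T0 q r ((u:ℝ)^t) - (u:ℝ)^t / q.totient) - (T0 q r ((M:ℝ)^t) - (M:ℝ)^t / q.totient)
        - (1 / (q.totient : ℝ)) * (∑ m ∈ Ioc M u, t * (m:ℝ) ^ (t - 1) - ((u:ℝ)^t - (M:ℝ)^t)) := by
      rw [e1]; ring
    have a1 := hR u h1 h2
    have a2 := hR M le_rfl hMn
    have a3 := pow_tele ht0 ht1 hM h1
    have a4 : |(1 / (q.totient : ℝ)) * (∑ m ∈ Ioc M u, t * (m:ℝ) ^ (t - 1) - ((u:ℝ)^t - (M:ℝ)^t))| ≤ 1 := by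
      rw [abs_mul, abs_of_nonneg (by positivity)]
      have : 1 / (q.totient : ℝ) ≤ 1 := by rw [div_le_one (by linarith)]; exact hφ
      calc _ ≤ 1 * 1 := mul_le_mul this a3 (abs_nonneg _) zero_le_one
        _ = 1 := one_mul 1
    rw [e2]
    refine (abs_sub _ _).trans ?_
    have := abs_sub (T0 q r ((u:ℝ)^t) - (u:ℝ)^t / q.totient) (T0 q r ((M:ℝ)^t) - (M:ℝ)^t / q.totient)
    linarith
  have hmain := abel_bound (fun m => ((b m : ℝ) : ℂ)) (fun m => e (β * m)) hMn (by linarith) hbs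
    (fun m => (e_norm _).le) (fun m => e_diff β m)
  refine le_trans (le_of_eq ?_) hmain
  congr 1
  simp only [hb]
  push_cast
  simp only [sub_mul]
  rw [Finset.sum_sub_distrib]
  congr 1
  · rw [← Finset.sum_fiberwise_eq_sum_filter (AA q r n) (Ioc M n) (fun p => p ^ k)]
    refine Finset.sum_congr rfl (fun m _ => ?_)
    rw [Finset.sum_mul]
    refine Finset.sum_congr rfl (fun p hp => ?_)
    rw [mem_filter] at hp
    rw [← hp.2, mul_comm]
    push_cast
    rfl
  · rw [Finset.mul_sum, Finset.mul_sum]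
    refine Finset.sum_congr rfl (fun m _ => ?_)
    rw [ht]; push_cast; ring

lemma zmod_red {q p r : ℕ} (hq : 1 ≤ q) (hp : 1 ≤ p) (hr : r ∈ Icc 1 q) : (p - 1) % q + 1 = r ↔ (p : ZMod q) = r := by
  rw [mem_Icc] at hr
  obtain ⟨p, rfl⟩ := Nat.exists_eq_add_of_le' hp
  obtain ⟨r, rfl⟩ := Nat.exists_eq_add_of_le' hr.1
  rw [ZMod.natCast_eq_natCast_iff]
  have h1 : r % q = r := Nat.mod_eq_of_lt (by omega)
  constructor
  · intro h
    have : p % q = r % q := by rw [h1]; simpa using h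
    exact Nat.ModEq.add_right 1 this
  · intro h
    have : p % q = r % q := Nat.ModEq.add_right_cancel' 1 h
    rw [h1] at this
    simpa using this

lemma e_red {q p r a k : ℕ} (hq : 1 ≤ q) (h : (p : ZMod q) = r) (α : ℝ) :
    e (α * (p:ℝ) ^ k) = e ((a:ℝ) * (r:ℝ) ^ k / q) * e ((α - a / q) * ((p ^ k : ℕ) : ℝ)) := by
  have hq0 : (q:ℝ) ≠ 0 := by exact_mod_cast (by omega : q ≠ 0)
  have h1 : ((p ^ k : ℕ) : ZMod q) = ((r ^ k : ℕ) : ZMod q) := by push_cast; rw [h]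
  have h2 : (q : ℤ) ∣ ((p ^ k : ℕ) : ℤ) - ((r ^ k : ℕ) : ℤ) := by
    rw [← ZMod.intCast_zmod_eq_zero_iff_dvd]
    push_cast; push_cast at h1; rw [h1]; ring
  obtain ⟨z, hz⟩ := h2
  have h3 : (p:ℝ)^k = (r:ℝ)^k + q * z := by
    have : (((p ^ k : ℕ) : ℤ) : ℝ) - ((r ^ k : ℕ) : ℤ) = (q * z : ℤ) := by rw [← hz]; push_cast; ring
    push_cast at this; linarith
  have h4 : α * (p:ℝ)^k = (a:ℝ) * (r:ℝ) ^ k / q + (α - a / q) * ((p ^ k : ℕ) : ℝ) + (((a:ℤ) * z : ℤ) : ℝ) := by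
    push_cast
    have : (a:ℝ) * z = a / q * ((p:ℝ)^k - (r:ℝ)^k) := by rw [h3]; field_simp; ring
    rw [this]; ring
  rw [h4, e_add, e_add, e_int, mul_one]

end SW


open MeasureTheory Finset

namespace SW

open Complex Metric Filter Topology DirichletCharacter

lemma P_eq_pow (n k : ℕ) : P n k = (n:ℝ) ^ ((k:ℝ)⁻¹) := rfl

lemma P_half {n k p : ℕ} (hk : 2 ≤ k) : P n k / 2 < (p:ℝ) ↔ n / 2 ^ k < p ^ k := by
  have h2 : P n k / 2 < (p:ℝ) ↔ P n k < ((2 * p : ℕ) : ℝ) := by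
    rw [div_lt_iff₀ two_pos, mul_comm]; push_cast; rfl
  rw [h2, Nat.div_lt_iff_lt_mul (by positivity), P_eq_pow, Real.rpow_inv_lt_iff_of_pos (by positivity) (by positivity) (by positivity),
    Real.rpow_natCast, ← Nat.cast_pow, Nat.cast_lt, mul_pow, mul_comm]

lemma v_eq {n k : ℕ} (β : ℝ) : v n k β = (k:ℂ)⁻¹ * ∑ m ∈ Ioc (n / 2 ^ k) n, (((m:ℝ) ^ ((k:ℝ)⁻¹ - 1) : ℝ) : ℂ) * e (β * m) := by
  unfold v
  congr 1
  refine Finset.sum_congr ?_ (fun _ _ => rfl)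
  ext m
  simp only [mem_filter, mem_Icc, mem_Ioc]
  rw [div_lt_iff₀ (by positivity), Nat.div_lt_iff_lt_mul (by positivity)]
  have : (n:ℝ) < m * 2 ^ k ↔ n < m * 2 ^ k := by norm_cast
  rw [this]
  constructor
  · rintro ⟨⟨h1, h2⟩, h3⟩; exact ⟨h3, h2⟩
  · rintro ⟨h3, h2⟩
    refine ⟨⟨?_, h2⟩, h3⟩
    rcases Nat.eq_zero_or_pos m with h | h
    · subst h; simp at h3
    · exact h

theorem f_decomp {n k q a : ℕ} (hk : 2 ≤ k) (hq : 1 ≤ q) (hqP : (q:ℝ) < P n k / 2) (α : ℝ) :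
    f n k α = ∑ r ∈ (Icc 1 q).filter (fun x => Nat.gcd x q = 1), e ((a:ℝ) * (r:ℝ)^k / q) *
      ∑ p ∈ (AA q (r : ZMod q) n).filter (fun p => p ^ k ∈ Ioc (n / 2 ^ k) n), e ((α - a / q) * ((p ^ k : ℕ) : ℝ)) * (Real.log p : ℂ) := by
  unfold f
  have hmaps : ∀ p ∈ (range (n + 1)).filter (fun p : ℕ => p.Prime ∧ P n k / 2 < (p:ℝ) ∧ (p:ℝ) ≤ P n k),
      (p - 1) % q + 1 ∈ (Icc 1 q).filter (fun x => Nat.gcd x q = 1) := by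
    intro p hp
    rw [mem_filter] at hp
    obtain ⟨_, hpr, h1, h2⟩ := hp
    have hr : (p - 1) % q + 1 ∈ Icc 1 q := by
      rw [mem_Icc]; have := Nat.mod_lt (p - 1) (show 0 < q by omega); omega
    have hz := (zmod_red hq hpr.one_lt.le hr).1 rfl
    rw [mem_filter]
    refine ⟨hr, ?_⟩
    have hcop : Nat.Coprime p q := by
      rw [hpr.coprime_iff_not_dvd]
      intro hd
      have : (p:ℝ) ≤ q := by exact_mod_cast Nat.le_of_dvd (by omega) hd
      linarith
    rw [ZMod.natCast_eq_natCast_iff] at hz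
    rw [← hz.gcd_eq]
    exact hcop
  rw [← Finset.sum_fiberwise_of_maps_to hmaps]
  refine Finset.sum_congr rfl (fun r hr => ?_)
  rw [Finset.mul_sum]
  rw [mem_filter] at hr
  refine Finset.sum_congr ?_ ?_
  · ext p
    simp only [AA, mem_filter, mem_range, mem_Ioc]
    rw [P_half hk, P_eq_pow, le_root_iff hk]
    constructor
    · rintro ⟨⟨h1, h2, h3, h4⟩, h5⟩
      exact ⟨⟨h1, h2, (zmod_red hq h2.one_lt.le hr.1).1 h5⟩, h3, h4⟩
    · rintro ⟨⟨h1, h2, h5⟩, h3, h4⟩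
      exact ⟨⟨h1, h2, h3, h4⟩, (zmod_red hq h2.one_lt.le hr.1).2 h5⟩
  · intro p hp
    rw [mem_filter, AA, mem_filter] at hp
    rw [e_red (a := a) hq hp.1.2.2 α, mul_assoc]

theorem major_bound {n k q a : ℕ} (hk : 2 ≤ k) (hq : 1 ≤ q) (hqP : (q:ℝ) < P n k / 2) (hM : 1 ≤ n / 2 ^ k) {R : ℝ} (hR0 : 0 ≤ R)
    (hR : ∀ r : ZMod q, IsUnit r → ∀ u : ℕ, n / 2 ^ k ≤ u → u ≤ n →
      |T0 q r ((u:ℝ) ^ ((k:ℝ)⁻¹)) - (u:ℝ) ^ ((k:ℝ)⁻¹) / q.totient| ≤ R) (α : ℝ) :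
    ‖f n k α - S k q a / (Nat.totient q : ℂ) * v n k (α - (a : ℝ) / q)‖ ≤
      q * ((2 * R + 1) * (1 + n * (2 * Real.pi * |α - a / q|))) := by
  haveI : NeZero q := ⟨by omega⟩
  set β := α - (a:ℝ) / q with hβ
  rw [f_decomp (a := a) hk hq hqP α, S, Finset.sum_div, Finset.sum_mul, ← Finset.sum_sub_distrib]
  refine (norm_sum_le_of_le _ (n := fun _ => (2 * R + 1) * (1 + n * (2 * Real.pi * |β|))) ?_).trans ?_
  · intro r hr
    rw [mem_filter] at hr
    have hu : IsUnit (r : ZMod q) := (ZMod.isUnit_iff_coprime r q).2 hr.2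
    have h1 := resid (r : ZMod q) hk hM (Nat.div_le_self _ _) (hR _ hu) β
    rw [← v_eq] at h1
    have h2 : ∀ X : ℂ, e ((a:ℝ) * (r:ℝ)^k / q) * X - e ((a:ℝ) * (r:ℝ)^k / q) / (q.totient : ℂ) * v n k β
        = e ((a:ℝ) * (r:ℝ)^k / q) * (X - 1 / (q.totient : ℂ) * v n k β) := by intro X; ring
    rw [h2, norm_mul, e_norm, one_mul]
    exact h1
  · rw [Finset.sum_const, nsmul_eq_mul]
    have : (#{x ∈ Icc 1 q | x.gcd q = 1} : ℝ) ≤ q := by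
      have := Finset.card_filter_le (Icc 1 q) (fun x => x.gcd q = 1)
      simp only [Nat.card_Icc] at this
      exact_mod_cast (by omega : #{x ∈ Icc 1 q | x.gcd q = 1} ≤ q)
    gcongr

theorem final (B : ℝ) (hB : 1 ≤ B) (k : ℕ)
    (hk : k = 2 ∨ k = 3 ∨ k = 6 ∨ k = 7) :
    ∃ c1 : ℝ, 0 < c1 ∧ ∃ C : ℝ, 0 < C ∧ ∃ N : ℕ, ∀ n : ℕ, N ≤ n →
      ∀ a q : ℕ, a ≤ q → 1 ≤ q → (q : ℝ) ≤ Real.log n ^ B → Nat.gcd a q = 1 →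
        ∀ α : ℝ, |α - (a : ℝ) / q| ≤ Real.log n ^ B / n →
          ‖f n k α - S k q a / (Nat.totient q : ℂ) * v n k (α - (a : ℝ) / q)‖ ≤
            C * P n k * Real.exp (-c1 * Real.sqrt (Real.log n)) := by
  have hk2 : 2 ≤ k := by omega
  have hk7 : k ≤ 7 := by omega
  have hk2r : (2:ℝ) ≤ k := by exact_mod_cast hk2
  have hk7r : (k:ℝ) ≤ 7 := by exact_mod_cast hk7
  obtain ⟨c, hc, C, hC, X, hX, hsw⟩ := swtheta (show 1 ≤ B + 1 by linarith)
  have ev1 : ∀ᶠ L : ℝ in atTop, L ^ B ≤ Real.exp (1 / 14 * L) := by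
    have := (isLittleO_rpow_exp_pos_mul_atTop B (show (0:ℝ) < 1 / 14 by norm_num)).bound one_pos
    filter_upwards [this, eventually_ge_atTop 0] with L h h0
    rw [one_mul, Real.norm_of_nonneg (by positivity), Real.norm_of_nonneg (Real.exp_pos _).le] at h
    exact h
  have ev2 : ∀ᶠ L : ℝ in atTop, L ^ (2 * B) ≤ Real.exp (c / 8 * √L) := by
    have := (isLittleO_rpow_exp_pos_mul_atTop (4 * B) (show (0:ℝ) < c / 8 by positivity)).bound one_pos
    have h2 := Real.tendsto_sqrt_atTop.eventually this
    filter_upwards [h2, eventually_ge_atTop 0] with L h h0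
    rw [one_mul, Real.norm_of_nonneg (by positivity), Real.norm_of_nonneg (Real.exp_pos _).le,
      show 4 * B = 2 * (2 * B) by ring, Real.rpow_mul (Real.sqrt_nonneg _), Real.rpow_two, Real.sq_sqrt h0] at h
    exact h
  have ev3 : ∀ᶠ n : ℕ in atTop, (4 ^ k ≤ n) ∧ Real.log n ^ B ≤ Real.exp (1 / 14 * Real.log n) ∧
      Real.log n ^ (2 * B) ≤ Real.exp (c / 8 * √(Real.log n)) ∧ 28 ≤ Real.log n ∧ 14 * Real.log X ≤ Real.log n ∧
      14 ^ (B + 1) ≤ Real.log n ∧ c ^ 2 * 4 ≤ Real.log n := by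
    have hl : Tendsto (fun n : ℕ => Real.log n) atTop atTop := Real.tendsto_log_atTop.comp tendsto_natCast_atTop_atTop
    filter_upwards [eventually_ge_atTop (4 ^ k), hl.eventually ev1, hl.eventually ev2, hl.eventually (eventually_ge_atTop 28),
      hl.eventually (eventually_ge_atTop (14 * Real.log X)), hl.eventually (eventually_ge_atTop (14 ^ (B + 1))),
      hl.eventually (eventually_ge_atTop (c ^ 2 * 4))] with n h1 h2 h3 h4 h5 h6 h7
    exact ⟨h1, h2, h3, h4, h5, h6, h7⟩
  obtain ⟨N, hN⟩ := eventually_atTop.1 ev3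
  refine ⟨c / 8, by positivity, 8 * (2 * C + 1), by positivity, N, ?_⟩
  intro n hn a q haq hq1 hqL hcop α hα
  obtain ⟨g1, g2, g3, g4, g5, g6, g7⟩ := hN n hn
  haveI : NeZero q := ⟨by omega⟩
  have hnpos : 0 < n := lt_of_lt_of_le (by positivity) g1
  have hn0 : (0:ℝ) < n := by exact_mod_cast hnpos
  set L := Real.log n with hL
  have hL0 : 0 < L := by linarith
  have hP : P n k = Real.exp (L / k) := by
    rw [P_eq_pow, Real.rpow_def_of_pos hn0, ← hL, div_eq_mul_inv]
  have hlog4 : Real.log 4 ≤ 2 := by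
    rw [show (4:ℝ) = 2 ^ 2 by norm_num, Real.log_pow]; have := Real.log_two_lt_d9; push_cast; linarith
  have hLk : L / 7 ≤ L / k := by gcongr
  have hP4 : Real.exp (L / 14) ≤ P n k / 4 := by
    rw [hP, le_div_iff₀ (by norm_num), ← Real.exp_log (show (0:ℝ) < 4 by norm_num), ← Real.exp_add]
    apply Real.exp_le_exp.2
    linarith
  have hPpos : 0 < P n k := by rw [hP]; positivity
  have hqP : (q:ℝ) < P n k / 2 := by
    have : (q:ℝ) ≤ Real.exp (L / 14) := by
      refine hqL.trans (g2.trans (le_of_eq ?_)); congr 1; ring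
    linarith
  have h42 : (4:ℕ) ^ k = 2 ^ k * 2 ^ k := by rw [← mul_pow]; norm_num
  have hM : 1 ≤ n / 2 ^ k := by
    rw [Nat.le_div_iff_mul_le (by positivity), one_mul]
    refine le_trans ?_ g1
    exact Nat.pow_le_pow_left (by norm_num) k
  have hMn : n ≤ 4 ^ k * (n / 2 ^ k) := by
    have h1 := Nat.lt_mul_div_succ n (show 0 < 2 ^ k by positivity)
    have h2 : 2 ≤ 2 ^ k := by
      calc 2 = 2 ^ 1 := by norm_num
        _ ≤ 2 ^ k := Nat.pow_le_pow_right (by norm_num) (by omega)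
    rw [h42]
    set m := n / 2 ^ k
    calc n ≤ 2 ^ k * (m + 1) := h1.le
      _ ≤ 2 ^ k * (2 ^ k * m) := by gcongr; nlinarith
      _ = _ := by ring
  set η := Real.exp (-(c / 4 * √L)) with hη
  have hη0 : 0 < η := Real.exp_pos _
  have hR : ∀ r : ZMod q, IsUnit r → ∀ u : ℕ, n / 2 ^ k ≤ u → u ≤ n →
      |T0 q r ((u:ℝ) ^ ((k:ℝ)⁻¹)) - (u:ℝ) ^ ((k:ℝ)⁻¹) / q.totient| ≤ C * P n k * η := by
    intro r hr u hu1 hu2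
    set y := (u:ℝ) ^ ((k:ℝ)⁻¹) with hy
    have hyP : y ≤ P n k := by
      rw [P_eq_pow, hy]; gcongr
    have hy4 : P n k / 4 ≤ y := by
      rw [div_le_iff₀ (by norm_num), P_eq_pow, Real.rpow_inv_le_iff_of_pos (by positivity) (by positivity) (by positivity),
        Real.mul_rpow (by positivity) (by positivity), hy, Real.rpow_inv_rpow (by positivity) (by positivity), Real.rpow_natCast]
      have : n ≤ u * 4 ^ k := by
        refine hMn.trans ?_; rw [mul_comm]; gcongr
      exact_mod_cast this
    have hye : Real.exp (L / 14) ≤ y := hP4.trans hy4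
    have hy0 : 0 < y := lt_of_lt_of_le (Real.exp_pos _) hye
    have hlogy : L / 14 ≤ Real.log y := by rwa [Real.le_log_iff_exp_le hy0]
    have hXy : X ≤ y := by
      refine le_trans ?_ hye
      rw [← Real.exp_log (show 0 < X by linarith)]
      apply Real.exp_le_exp.2; linarith
    have hqy : (q:ℝ) ≤ Real.log y ^ (B + 1) := by
      refine hqL.trans ?_
      calc L ^ B ≤ (L / 14) ^ (B + 1) := by
            rw [Real.div_rpow (by linarith) (by norm_num), Real.rpow_add_one hL0.ne', le_div_iff₀ (by positivity)]
            gcongr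
        _ ≤ _ := by gcongr
    have h1 := hsw y hXy q r hr hqy
    refine h1.trans ?_
    have hsq : 1 / 4 * √L ≤ √(Real.log y) := by
      apply Real.le_sqrt_of_sq_le
      rw [mul_pow, Real.sq_sqrt hL0.le]; linarith
    have h2 : Real.exp (-(c * √(Real.log y))) ≤ η := by
      apply Real.exp_le_exp.2
      have : c * (1 / 4 * √L) ≤ c * √(Real.log y) := by gcongr
      linarith
    gcongr
  have hmb := major_bound (a := a) hk2 hq1 hqP hM (by positivity) hR α
  refine hmb.trans ?_
  have hPη : 1 ≤ P n k * η := by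
    rw [hP, hη, ← Real.exp_add]
    apply Real.one_le_exp
    have hsL : 2 * c ≤ √L := Real.le_sqrt_of_sq_le (by rw [mul_pow]; linarith)
    have hss : √L * √L = L := Real.mul_self_sqrt hL0.le
    have h0 : 0 ≤ √L := Real.sqrt_nonneg L
    have h1 : 2 * c * √L ≤ √L * √L := by gcongr
    linarith
  have hβ : n * (2 * Real.pi * |α - a / q|) ≤ 7 * L ^ B := by
    have h1 : n * |α - a / q| ≤ L ^ B := by
      rw [le_div_iff₀ hn0] at hα; linarith
    have h2 : 2 * Real.pi ≤ 7 := by have := Real.pi_lt_d2; linarith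
    calc _ = 2 * Real.pi * (n * |α - a / q|) := by ring
      _ ≤ 7 * L ^ B := by gcongr
  have hLB : 1 ≤ L ^ B := Real.one_le_rpow (by linarith) (by linarith)
  have hL2 : L ^ B * L ^ B = L ^ (2 * B) := by rw [← Real.rpow_add hL0]; congr 1; ring
  calc _ ≤ L ^ B * ((2 * (C * P n k * η) + P n k * η) * (L ^ B + 7 * L ^ B)) := by gcongr
    _ = 8 * (2 * C + 1) * P n k * (L ^ (2 * B) * η) := by rw [← hL2]; ring
    _ ≤ 8 * (2 * C + 1) * P n k * (Real.exp (c / 8 * √L) * η) := by gcongr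
    _ = _ := by rw [hη, ← Real.exp_add]; congr 2; ring

end SW

/-- Major-arc approximation of `f_k(α)` (Lemma "hua6", first part). -/
theorem fk_major_arc_approx (B : ℝ) (hB : 1 ≤ B) (k : ℕ)
    (hk : k = 2 ∨ k = 3 ∨ k = 6 ∨ k = 7) :
    ∃ c1 : ℝ, 0 < c1 ∧ ∃ C : ℝ, 0 < C ∧ ∃ N : ℕ, ∀ n : ℕ, N ≤ n →
      ∀ a q : ℕ, a ≤ q → 1 ≤ q → (q : ℝ) ≤ Real.log n ^ B → Nat.gcd a q = 1 →
        ∀ α : ℝ, |α - (a : ℝ) / q| ≤ Real.log n ^ B / n →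
          ‖f n k α - S k q a / (Nat.totient q : ℂ) * v n k (α - (a : ℝ) / q)‖ ≤
            C * P n k * Real.exp (-c1 * Real.sqrt (Real.log n)) := by
  exact SW.final B hB k hk
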